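/- Let G be a finitely generated, non-elementary group and let X be a quasi-convex G-space with basepoint o such that X is CAT(0). If some element g ∈ G acts on X as a rank 1 hyperbolic isometry, then the action of G on X is a growth tight action: δ_{G/Γ} < δ_G for every infinite normal subgroup Γ of G. -/

import Mathlib

open Filter Metric
open scoped ENNReal

section Defs

variable {G : Type*} {X : Type*} [Group G] [MetricSpace X] [MulAction G X]

/-- A geodesic from `x` to `y`: an isometric parameterization of `[0, dist x y]`. -/
def GeodesicFromTo (γ : ℝ → X) (x y : X) : Prop :=
  γ 0 = x ∧ γ (dist x y) = y ∧
    ∀ s ∈ Set.Icc (0 : ℝ) (dist x y), ∀ t ∈ Set.Icc (0 : ℝ) (dist x y),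
      dist (γ s) (γ t) = |s - t|

/-- A geodesic metric space. -/
def GeodesicSpace (X : Type*) [MetricSpace X] : Prop :=
  ∀ x y : X, ∃ γ : ℝ → X, GeodesicFromTo γ x y

/-- The action of `G` on `X` is by isometries. -/
def IsometricAction (G X : Type*) [Group G] [MetricSpace X] [MulAction G X] : Prop :=
  ∀ (g : G) (x y : X), dist (g • x) (g • y) = dist x y

/-- The action of `G` on `X` is properly discontinuous. -/
def ProperlyDiscontinuousAction (G X : Type*) [Group G] [MetricSpace X] [MulAction G X] : Prop :=
  ∀ K : Set X, IsCompact K → {g : G | ((g • ·) '' K ∩ K).Nonempty}.Finite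

/-- `G` is non-elementary: no cyclic subgroup has finite index. -/
def NonElementary (G : Type*) [Group G] : Prop :=
  ∀ g : G, (Subgroup.zpowers g).index = 0

/-- Growth exponent of a subset `A ⊆ G`, with respect to basepoint `o`. -/
noncomputable def growthExp (o : X) (A : Set G) : ℝ≥0∞ :=
  Filter.limsup (fun r : ℝ =>
    ENNReal.ofReal (Real.log (Nat.card {g : G // g ∈ A ∧ dist o (g • o) ≤ r}) / r))
    Filter.atTop

/-- Growth exponent of the quotient `G ⧸ Γ` with the induced pseudo-metric. -/
noncomputable def quotGrowthExp (o : X) (Γ : Subgroup G) : ℝ≥0∞ :=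
  Filter.limsup (fun r : ℝ =>
    ENNReal.ofReal (Real.log (Nat.card
      {q : G ⧸ Γ // ∃ g : G, QuotientGroup.mk g = q ∧ (⨅ γ : Γ, dist o ((g * γ) • o)) ≤ r}) / r))
    Filter.atTop

/-- A growth tight action. -/
def GrowthTight (G : Type*) [Group G] {X : Type*} [MetricSpace X] [MulAction G X] (o : X) : Prop :=
  ∀ Γ : Subgroup G, Γ.Normal → (Γ : Set G).Infinite →
    quotGrowthExp o Γ < growthExp o (Set.univ : Set G)

/-- The `⟨h⟩`-orbit of the basepoint. -/
def zOrbit (o : X) (h : G) : Set X := Set.range fun i : ℤ => h ^ i • o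

/-- Nearest point projection to a subset. -/
def nprojSet (S : Set X) (x : X) : Set X := {a ∈ S | dist x a = Metric.infDist x S}

/-- `h` is a strongly contracting element for `G ↷ X`. -/
def StronglyContractingElem (o : X) (h : G) : Prop :=
  ¬ IsOfFinOrder h ∧
  (∃ M C : ℝ, 1 ≤ M ∧ 0 ≤ C ∧ ∀ i j : ℤ,
    (1 / M) * |(i : ℝ) - (j : ℝ)| - C ≤ dist (h ^ i • o) (h ^ j • o) ∧
    dist (h ^ i • o) (h ^ j • o) ≤ M * |(i : ℝ) - (j : ℝ)| + C) ∧
  (∃ C : ℝ, 0 ≤ C ∧ ∀ x y : X,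
    dist x y < Metric.infDist x (zOrbit o h) - C →
    Metric.diam (nprojSet (zOrbit o h) x ∪ nprojSet (zOrbit o h) y) ≤ C)

def QuasiConvexGSpace (G : Type*) [Group G] {X : Type*} [MetricSpace X] [MulAction G X]
    (o : X) : Prop :=
  ∃ C : ℝ, 0 ≤ C ∧ ∀ g g' : G, ∃ γ : ℝ → X, GeodesicFromTo γ (g • o) (g' • o) ∧
    ∀ t ∈ Set.Icc (0 : ℝ) (dist (g • o) (g' • o)),
      Metric.infDist (γ t) (Set.range fun g'' : G => g'' • o) ≤ C


/-- `X` is a CAT(0) space: geodesic triangles are at least as thin as Euclidean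
comparison triangles. -/
def CAT0 (X : Type*) [MetricSpace X] : Prop :=
  ∀ x y z : X, y ≠ z → ∀ γ : ℝ → X, GeodesicFromTo γ y z →
    ∀ t ∈ Set.Icc (0 : ℝ) (dist y z),
    ∀ xb yb zb : EuclideanSpace ℝ (Fin 2),
      ‖xb - yb‖ = dist x y → ‖yb - zb‖ = dist y z → ‖xb - zb‖ = dist x z →
      dist x (γ t) ≤ ‖xb - (yb + (t / dist y z) • (zb - yb))‖

/-- `g` acts on `X` as a hyperbolic isometry with translation length `ℓ`:
`ℓ = inf_x d(x, g·x)` is positive and attained. -/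
def IsHyperbolicWithLength {G : Type*} [Group G] (X : Type*) [MetricSpace X] [MulAction G X]
    (g : G) (ℓ : ℝ) : Prop :=
  0 < ℓ ∧ (∀ x : X, ℓ ≤ dist x (g • x)) ∧ (∃ x : X, dist x (g • x) = ℓ)

/-- `g` acts on `X` as a rank 1 isometry: it is hyperbolic and has an axis that does not
bound an isometrically embedded Euclidean half-plane. -/
def Rank1Isometry {G : Type*} [Group G] (X : Type*) [MetricSpace X] [MulAction G X]
    (g : G) : Prop :=
  ∃ ℓ : ℝ, IsHyperbolicWithLength X g ℓ ∧ ∃ γ : ℝ → X,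
    (∀ s t : ℝ, dist (γ s) (γ t) = |s - t|) ∧
    (∀ t : ℝ, g • γ t = γ (t + ℓ)) ∧
    ¬ ∃ F : ℝ → ℝ → X, (∀ t : ℝ, F t 0 = γ t) ∧
      ∀ t t' s s' : ℝ, 0 ≤ s → 0 ≤ s' →
        dist (F t s) (F t' s') = Real.sqrt ((t - t') ^ 2 + (s - s') ^ 2)

end Defs

namespace GrowthTightness

section CatZero

variable {X : Type*} [MetricSpace X]

/-- `m` divides the geodesic from `x` to `y` in the ratio `l : 1 - l`, in the sense of the
CAT(0) inequality of Bruhat and Tits. -/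
def IsPt (x y : X) (l : ℝ) (m : X) : Prop :=
  ∀ w, dist w m ^ 2 ≤ (1 - l) * dist w x ^ 2 + l * dist w y ^ 2 - l * (1 - l) * dist x y ^ 2

/-- Every two points are joined by a geodesic satisfying the CAT(0) inequality. -/
def BruhatTits (X : Type*) [MetricSpace X] : Prop :=
  ∀ (x y : X) (l : ℝ), 0 ≤ l → l ≤ 1 → ∃ m, IsPt x y l m

theorem exists_comparison {a b c : ℝ} (hc : 0 < c) (ha : 0 ≤ a) (hb : 0 ≤ b) (h1 : a ≤ b + c)
    (h2 : b ≤ a + c) (h3 : c ≤ a + b) :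
    ∃ x y z : EuclideanSpace ℝ (Fin 2), ‖x - y‖ = a ∧ ‖y - z‖ = c ∧ ‖x - z‖ = b := by
  set u : ℝ := (a ^ 2 + c ^ 2 - b ^ 2) / (2 * c) with hu
  have hu' : 2 * c * u = a ^ 2 + c ^ 2 - b ^ 2 := by rw [hu]; field_simp
  have hv : 0 ≤ a ^ 2 - u ^ 2 := by
    have : 0 ≤ (2 * c) ^ 2 * (a ^ 2 - u ^ 2) := by
      have : (2 * c) ^ 2 * (a ^ 2 - u ^ 2) = (2 * c * a) ^ 2 - (2 * c * u) ^ 2 := by ring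
      rw [this, hu']
      have : (2 * c * a) ^ 2 - (a ^ 2 + c ^ 2 - b ^ 2) ^ 2
        = ((b + c - a) * (a + b - c)) * ((a + c - b) * (a + b + c)) := by ring
      rw [this]
      apply mul_nonneg <;> apply mul_nonneg <;> linarith
    exact nonneg_of_mul_nonneg_right this (by positivity)
  refine ⟨!₂[u, √(a ^ 2 - u ^ 2)], !₂[0, 0], !₂[c, 0], ?_, ?_, ?_⟩
  · rw [EuclideanSpace.norm_eq, Real.sqrt_eq_iff_mul_self_eq (by positivity) ha]
    simp [Fin.sum_univ_two, Real.sq_sqrt hv]; ring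
  · rw [EuclideanSpace.norm_eq, Real.sqrt_eq_iff_mul_self_eq (by positivity) hc.le]
    simp [Fin.sum_univ_two]; ring
  · rw [EuclideanSpace.norm_eq, Real.sqrt_eq_iff_mul_self_eq (by positivity) hb]
    simp [Fin.sum_univ_two, Real.sq_sqrt hv]; linarith

theorem norm_sub_lineMap_sq {E : Type*} [NormedAddCommGroup E] [InnerProductSpace ℝ E]
    (x y z : E) (l : ℝ) :
    ‖x - (y + l • (z - y))‖ ^ 2
      = (1 - l) * ‖x - y‖ ^ 2 + l * ‖x - z‖ ^ 2 - l * (1 - l) * ‖y - z‖ ^ 2 := by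
  have h1 : x - (y + l • (z - y)) = (x - y) - l • (z - y) := by abel
  have h2 : x - z = (x - y) - (z - y) := by abel
  have h3 : ‖y - z‖ = ‖z - y‖ := norm_sub_rev _ _
  rw [h1, h2, h3, norm_sub_sq_real (x - y) (l • (z - y)), norm_sub_sq_real (x - y) (z - y),
    inner_smul_right, norm_smul, mul_pow]
  simp only [Real.norm_eq_abs, sq_abs]
  ring

theorem bruhatTits_of_CAT0 (hG : GeodesicSpace X) (hC : CAT0 X) : BruhatTits X := by
  intro x y l h0 h1
  by_cases hxy : x = y
  · subst hxy
    exact ⟨x, fun w => by simp; linarith⟩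
  obtain ⟨γ, hγ⟩ := hG x y
  have hd : 0 < dist x y := dist_pos.2 hxy
  refine ⟨γ (l * dist x y), fun w => ?_⟩
  obtain ⟨a, b, c, hab, hbc, hac⟩ := exists_comparison (a := dist w x) (b := dist w y) hd
    dist_nonneg dist_nonneg (by have := dist_triangle w y x; rw [dist_comm y x] at this; exact this)
    (dist_triangle w x y) (by have := dist_triangle x w y; rw [dist_comm x w] at this; exact this)
  have h := hC w x y hxy γ hγ (l * dist x y) ⟨by positivity, by nlinarith⟩ a b c hab hbc hac
  rw [mul_div_cancel_right₀ _ hd.ne'] at h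
  calc _ ≤ ‖a - (b + l • (c - b))‖ ^ 2 := by gcongr
    _ = _ := by rw [norm_sub_lineMap_sq, hab, hbc, hac]

theorem IsPt.symm {x y m : X} {l : ℝ} (h : IsPt x y l m) : IsPt y x (1 - l) m := by
  intro w
  have := h w
  rw [dist_comm y x]
  linarith

theorem IsPt.dist_left {x y m : X} {l : ℝ} (h : IsPt x y l m) (h0 : 0 ≤ l) (h1 : l ≤ 1) :
    dist x m = l * dist x y := by
  have hx := h x
  have hy := h y
  rw [dist_self] at hx hy
  rw [dist_comm y x] at hy
  have e1 : dist x m ≤ l * dist x y := by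
    apply abs_le_of_sq_le_sq' _ (by positivity) |>.2
    linarith
  have e2 : dist y m ≤ (1 - l) * dist x y := by
    apply abs_le_of_sq_le_sq' _ (mul_nonneg (by linarith) dist_nonneg) |>.2
    linarith
  have := dist_triangle x m y
  rw [dist_comm m y] at this
  linarith

theorem IsPt.dist_right {x y m : X} {l : ℝ} (h : IsPt x y l m) (h0 : 0 ≤ l) (h1 : l ≤ 1) :
    dist y m = (1 - l) * dist x y := by
  rw [h.symm.dist_left (by linarith) (by linarith), dist_comm]

theorem IsPt.eq_of_dist {x y m w : X} {l : ℝ} (h : IsPt x y l m)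
    (hx : dist w x = l * dist x y) (hy : dist w y = (1 - l) * dist x y) : w = m := by
  have := h w
  rw [hx, hy] at this
  have : dist w m ^ 2 ≤ 0 := by linarith
  exact dist_eq_zero.1 (pow_eq_zero_iff (two_ne_zero) |>.1 (le_antisymm this (by positivity)))

theorem IsPt.dist_le {x y m : X} {l : ℝ} (h : IsPt x y l m) (h0 : 0 ≤ l) (h1 : l ≤ 1) (w : X) :
    dist w m ≤ (1 - l) * dist w x + l * dist w y := by
  have a1 : 0 ≤ 1 - l := by linarith
  apply abs_le_of_sq_le_sq' _ (by positivity) |>.2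
  refine (h w).trans ?_
  have : |dist w x - dist w y| ≤ dist x y := by
    rw [dist_comm w x, dist_comm w y]; exact abs_dist_sub_le x y w
  have : (dist w x - dist w y) ^ 2 ≤ dist x y ^ 2 := sq_le_sq' (by linarith [neg_abs_le (dist w x - dist w y)]) (by linarith [le_abs_self (dist w x - dist w y)])
  have := mul_le_mul_of_nonneg_left this (mul_nonneg h0 a1)
  nlinarith

/-- Euclidean comparison for two points on two geodesics issuing from `x`. -/
theorem IsPt.fan {x a b m n : X} {u v : ℝ} (hm : IsPt x a u m) (hn : IsPt x b v n)
    (hu : 0 ≤ u) (hu' : u ≤ 1) (hv : 0 ≤ v) :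
    dist m n ^ 2 ≤ u ^ 2 * dist x a ^ 2 + v ^ 2 * dist x b ^ 2
      + u * v * (dist a b ^ 2 - dist x a ^ 2 - dist x b ^ 2) := by
  have h1 := hn m
  have h2 := hm b
  rw [dist_comm m x, hm.dist_left hu hu', dist_comm m b] at h1
  rw [dist_comm b x, dist_comm b a] at h2
  have := mul_le_mul_of_nonneg_left h2 hv
  nlinarith

/-- Points in the same ratio on two geodesics with a common start. -/
theorem IsPt.dist_le_of_left {x a b m n : X} {u : ℝ} (hm : IsPt x a u m) (hn : IsPt x b u n)
    (hu : 0 ≤ u) (hu' : u ≤ 1) : dist m n ≤ u * dist a b := by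
  have := hm.fan hn hu hu' hu
  apply abs_le_of_sq_le_sq' _ (by positivity) |>.2
  linarith

theorem IsPt.dist_le_convex (hX : BruhatTits X) {x y x' y' m n : X} {u : ℝ} (hm : IsPt x y u m)
    (hn : IsPt x' y' u n) (hu : 0 ≤ u) (hu' : u ≤ 1) :
    dist m n ≤ (1 - u) * dist x x' + u * dist y y' := by
  obtain ⟨k, hk⟩ := hX x y' u hu hu'
  have h1 := hm.dist_le_of_left hk hu hu'
  have h2 := hk.symm.dist_le_of_left hn.symm (by linarith) (by linarith)
  linarith [dist_triangle m k n]

theorem quadrilateral (hX : BruhatTits X) (x y z w : X) :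
    dist x z ^ 2 + dist y w ^ 2
      ≤ dist x y ^ 2 + dist y z ^ 2 + dist z w ^ 2 + dist w x ^ 2 := by
  obtain ⟨m, hm⟩ := hX x z (1 / 2) (by norm_num) (by norm_num)
  have h1 := hm y
  have h2 := hm w
  have h3 := dist_triangle y m w
  rw [dist_comm m w] at h3
  rw [dist_comm y x] at h1
  rw [dist_comm w z] at h2
  have h4 : dist y w ^ 2 ≤ (dist y m + dist w m) ^ 2 := by gcongr
  nlinarith [sq_nonneg (dist y m - dist w m)]

/-- A point on the geodesic from `x` to `y` (a choice of one). -/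
noncomputable def pt (hX : BruhatTits X) (x y : X) (l : ℝ) : X :=
  if h : 0 ≤ l ∧ l ≤ 1 then (hX x y l h.1 h.2).choose else x

theorem isPt_pt (hX : BruhatTits X) (x y : X) {l : ℝ} (h0 : 0 ≤ l) (h1 : l ≤ 1) :
    IsPt x y l (pt hX x y l) := by
  rw [pt, dif_pos ⟨h0, h1⟩]
  exact (hX x y l h0 h1).choose_spec

theorem dist_pt_pt (hX : BruhatTits X) (x y : X) {l k : ℝ} (h0 : 0 ≤ l) (h1 : l ≤ 1)
    (h2 : 0 ≤ k) (h3 : k ≤ 1) : dist (pt hX x y l) (pt hX x y k) = |l - k| * dist x y := by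
  have A : dist (pt hX x y l) (pt hX x y k) ≤ |l - k| * dist x y := by
    have := (isPt_pt hX x y h0 h1).fan (isPt_pt hX x y h2 h3) h0 h1 h2
    apply abs_le_of_sq_le_sq' _ (by positivity) |>.2
    rw [mul_pow, sq_abs]
    simp only [dist_self] at this
    linarith
  refine le_antisymm A ?_
  have e1 := (isPt_pt hX x y h0 h1).dist_left h0 h1
  have e2 := (isPt_pt hX x y h2 h3).dist_left h2 h3
  have t1 := dist_triangle x (pt hX x y l) (pt hX x y k)
  have t2 := dist_triangle x (pt hX x y k) (pt hX x y l)
  rw [dist_comm (pt hX x y k) (pt hX x y l)] at t2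
  rcases abs_cases (l - k) with ⟨h, _⟩ | ⟨h, _⟩ <;> rw [h] <;> linarith

/-- A sub-geodesic of a geodesic. -/
theorem isPt_pt_pt (hX : BruhatTits X) (x y : X) {a b u : ℝ} (ha : a ∈ Set.Icc (0 : ℝ) 1)
    (hb : b ∈ Set.Icc (0 : ℝ) 1) (hu : u ∈ Set.Icc (0 : ℝ) 1) :
    IsPt (pt hX x y a) (pt hX x y b) u (pt hX x y ((1 - u) * a + u * b)) := by
  have hc0 : 0 ≤ (1 - u) * a + u * b :=
    add_nonneg (mul_nonneg (by linarith [hu.2]) ha.1) (mul_nonneg hu.1 hb.1)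
  have hc1 : (1 - u) * a + u * b ≤ 1 := by
    nlinarith [mul_nonneg (by linarith [hu.2] : 0 ≤ 1 - u) (by linarith [ha.2] : 0 ≤ 1 - a),
      mul_nonneg hu.1 (by linarith [hb.2] : 0 ≤ 1 - b)]
  obtain ⟨m, hm⟩ := hX (pt hX x y a) (pt hX x y b) u hu.1 hu.2
  have e : pt hX x y ((1 - u) * a + u * b) = m := by
    apply hm.eq_of_dist
    · rw [dist_pt_pt hX x y hc0 hc1 ha.1 ha.2, dist_pt_pt hX x y ha.1 ha.2 hb.1 hb.2,
        show (1 - u) * a + u * b - a = u * (b - a) by ring, abs_mul, abs_of_nonneg hu.1,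
        abs_sub_comm]
      ring
    · rw [dist_pt_pt hX x y hc0 hc1 hb.1 hb.2, dist_pt_pt hX x y ha.1 ha.2 hb.1 hb.2,
        show (1 - u) * a + u * b - b = (1 - u) * (a - b) by ring, abs_mul,
        abs_of_nonneg (by linarith [hu.2] : 0 ≤ 1 - u)]
      ring
  rw [e]; exact hm

end CatZero

section Lines

variable {X : Type*} [MetricSpace X]

/-- A geodesic line. -/
def Line (γ : ℝ → X) : Prop := ∀ s t : ℝ, dist (γ s) (γ t) = |s - t|

/-- The line `γ` bounds a Euclidean half-plane. -/
def HalfFlat (γ : ℝ → X) : Prop :=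
  ∃ F : ℝ → ℝ → X, (∀ t : ℝ, F t 0 = γ t) ∧
    ∀ t t' s s' : ℝ, 0 ≤ s → 0 ≤ s' →
      dist (F t s) (F t' s') = Real.sqrt ((t - t') ^ 2 + (s - s') ^ 2)

variable {γ : ℝ → X}

theorem Line.neg (hγ : Line γ) : Line fun t => γ (-t) := by
  intro s t
  rw [hγ, show -s - -t = -(s - t) by ring, abs_neg]

theorem HalfFlat.of_neg (h : HalfFlat fun t => γ (-t)) : HalfFlat γ := by
  obtain ⟨F, h0, hF⟩ := h
  refine ⟨fun t s => F (-t) s, fun t => by simp [h0], fun t t' s s' hs hs' => ?_⟩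
  rw [hF _ _ _ _ hs hs']
  congr 1; ring

theorem Line.sq_dist (hγ : Line γ) (s t : ℝ) : dist (γ s) (γ t) ^ 2 = (s - t) ^ 2 := by
  rw [hγ, sq_abs]

theorem Line.isPt (hX : BruhatTits X) (hγ : Line γ) (a b : ℝ) {l : ℝ} (h0 : 0 ≤ l)
    (h1 : l ≤ 1) : IsPt (γ a) (γ b) l (γ ((1 - l) * a + l * b)) := by
  obtain ⟨m, hm⟩ := hX (γ a) (γ b) l h0 h1
  have : γ ((1 - l) * a + l * b) = m := by
    apply hm.eq_of_dist
    · rw [hγ, hγ, show (1 - l) * a + l * b - a = l * (b - a) by ring, abs_mul, abs_of_nonneg h0,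
        abs_sub_comm]
    · rw [hγ, hγ, show (1 - l) * a + l * b - b = (1 - l) * (a - b) by ring, abs_mul,
        abs_of_nonneg (by linarith : 0 ≤ 1 - l)]
  rw [this]; exact hm

theorem Line.continuous (hγ : Line γ) : Continuous γ :=
  (Isometry.of_dist_eq fun s t => by rw [hγ, Real.dist_eq]).continuous

theorem Line.exists_nearest (hγ : Line γ) (x : X) :
    ∃ t, ∀ s, dist x (γ t) ≤ dist x (γ s) := by
  apply Continuous.exists_forall_le (continuous_const.dist hγ.continuous)
  have h1 : Tendsto (fun t : ℝ => ‖t‖ - dist x (γ 0)) (cocompact ℝ) atTop :=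
    tendsto_atTop_add_const_right _ _ (tendsto_norm_cocompact_atTop)
  refine tendsto_atTop_mono (fun t => ?_) h1
  have := dist_triangle_left (γ t) (γ 0) x
  rw [hγ, sub_zero] at this
  rw [Real.norm_eq_abs]
  linarith

/-- The parameter of the nearest point of `γ`. -/
noncomputable def pr (γ : ℝ → X) (x : X) : ℝ :=
  Classical.epsilon fun t => ∀ s, dist x (γ t) ≤ dist x (γ s)

/-- The distance to `γ`. -/
noncomputable def ht (γ : ℝ → X) (x : X) : ℝ := dist x (γ (pr γ x))

theorem ht_nonneg (x : X) : 0 ≤ ht γ x := dist_nonneg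

theorem Line.ht_le (hγ : Line γ) (x : X) (s : ℝ) : ht γ x ≤ dist x (γ s) :=
  Classical.epsilon_spec (hγ.exists_nearest x) s

theorem Line.sq_le (hX : BruhatTits X) (hγ : Line γ) (x : X) (s : ℝ) :
    ht γ x ^ 2 + (s - pr γ x) ^ 2 ≤ dist x (γ s) ^ 2 := by
  set p := pr γ x
  have key : ∀ l : ℝ, 0 < l → l ≤ 1 →
      ht γ x ^ 2 + (s - p) ^ 2 - dist x (γ s) ^ 2 ≤ l * (s - p) ^ 2 := by
    intro l h0 h1
    have h := hγ.isPt hX p s h0.le h1 x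
    rw [hγ.sq_dist] at h
    have h2 : ht γ x ^ 2 ≤ dist x (γ ((1 - l) * p + l * s)) ^ 2 :=
      pow_le_pow_left₀ (ht_nonneg x) (hγ.ht_le x _) 2
    have h3 : dist x (γ p) = ht γ x := rfl
    rw [h3] at h
    have : l * (ht γ x ^ 2 + (s - p) ^ 2 - dist x (γ s) ^ 2) ≤ l * (l * (s - p) ^ 2) := by
      nlinarith
    exact le_of_mul_le_mul_left this h0
  by_contra! hc
  set D := ht γ x ^ 2 + (s - p) ^ 2 - dist x (γ s) ^ 2 with hD
  have hD0 : 0 < D := by rw [hD]; linarith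
  have h1 := key 1 one_pos le_rfl
  have hq : 0 < (s - p) ^ 2 := by linarith
  have h2 := key (D / (2 * (s - p) ^ 2)) (by positivity)
    (by rw [div_le_one (by positivity)]; linarith)
  rw [show D / (2 * (s - p) ^ 2) * (s - p) ^ 2 = D / 2 by
    rw [div_mul_eq_mul_div, div_eq_div_iff (by positivity) (by positivity)]; ring] at h2
  linarith

theorem Line.pr_eq (hX : BruhatTits X) (hγ : Line γ) {x : X} {t : ℝ}
    (h : ∀ s, dist x (γ t) ≤ dist x (γ s)) : pr γ x = t := by
  have h1 := hγ.sq_le hX x t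
  have h2 : dist x (γ t) ^ 2 ≤ ht γ x ^ 2 := pow_le_pow_left₀ dist_nonneg (h _) 2
  have : (t - pr γ x) ^ 2 = 0 := le_antisymm (by linarith) (by positivity)
  have := pow_eq_zero_iff (two_ne_zero) |>.1 this
  linarith

theorem Line.pr_self (hX : BruhatTits X) (hγ : Line γ) (t : ℝ) : pr γ (γ t) = t :=
  hγ.pr_eq hX fun s => by simp

theorem Line.ht_self (hX : BruhatTits X) (hγ : Line γ) (t : ℝ) : ht γ (γ t) = 0 := by
  rw [ht, hγ.pr_self hX, dist_self]

theorem Line.pr_map (hX : BruhatTits X) (hγ : Line γ) {T : X → X}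
    (hT : ∀ x y, dist (T x) (T y) = dist x y) {c : ℝ} (hc : ∀ t, T (γ t) = γ (t + c)) (x : X) :
    pr γ (T x) = pr γ x + c := by
  apply hγ.pr_eq hX
  intro s
  rw [← hc, hT, show s = (s - c) + c by ring, ← hc, hT]
  exact hγ.ht_le x _

theorem Line.ht_map (hX : BruhatTits X) (hγ : Line γ) {T : X → X}
    (hT : ∀ x y, dist (T x) (T y) = dist x y) {c : ℝ} (hc : ∀ t, T (γ t) = γ (t + c)) (x : X) :
    ht γ (T x) = ht γ x := by
  rw [ht, hγ.pr_map hX hT hc, ← hc, hT, ht]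

theorem Line.pr_neg (hX : BruhatTits X) (hγ : Line γ) (x : X) :
    pr (fun t => γ (-t)) x = -pr γ x := by
  apply hγ.neg.pr_eq hX
  intro s
  rw [neg_neg]
  exact hγ.ht_le x _

theorem Line.ht_neg (hX : BruhatTits X) (hγ : Line γ) (x : X) :
    ht (fun t => γ (-t)) x = ht γ x := by
  rw [ht, hγ.pr_neg hX, neg_neg, ht]

theorem Line.ht_lip (hγ : Line γ) (x y : X) : ht γ x ≤ dist x y + ht γ y :=
  (hγ.ht_le x (pr γ y)).trans (dist_triangle _ _ _)

theorem Line.ht_convex (hX : BruhatTits X) (hγ : Line γ) {x y m : X} {l : ℝ} (h0 : 0 ≤ l)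
    (h1 : l ≤ 1) (hm : IsPt x y l m) : ht γ m ≤ (1 - l) * ht γ x + l * ht γ y :=
  (hγ.ht_le m _).trans (hm.dist_le_convex hX (hγ.isPt hX (pr γ x) (pr γ y) h0 h1) h0 h1)

theorem Line.pr_lip (hX : BruhatTits X) (hγ : Line γ) (x y : X) :
    |pr γ x - pr γ y| ≤ dist x y := by
  have h := quadrilateral hX x y (γ (pr γ y)) (γ (pr γ x))
  rw [hγ.sq_dist, dist_comm (γ (pr γ x)) x] at h
  have h1 := hγ.sq_le hX x (pr γ y)
  have h2 := hγ.sq_le hX y (pr γ x)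
  rw [ht] at h1 h2
  apply abs_le_of_sq_le_sq _ dist_nonneg
  nlinarith

theorem Line.dist_convex (hX : BruhatTits X) (hγ : Line γ) (x : X) (a b : ℝ) {l : ℝ} (h0 : 0 ≤ l)
    (h1 : l ≤ 1) :
    dist x (γ ((1 - l) * a + l * b)) ≤ (1 - l) * dist x (γ a) + l * dist x (γ b) :=
  (hγ.isPt hX a b h0 h1).dist_le h0 h1 x

/-- A map of the half-plane that is short, and long on enough vectors from the boundary, is an
isometric embedding. -/
theorem halfFlat_of_expanding (hX : BruhatTits X) (hγ : Line γ) (F : ℝ → ℝ → X)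
    (h0 : ∀ t, F t 0 = γ t)
    (hle : ∀ t t' s s' : ℝ, 0 ≤ s → 0 ≤ s' →
      dist (F t s) (F t' s') ^ 2 ≤ (t - t') ^ 2 + (s - s') ^ 2)
    (hx : ∀ t s : ℝ, 0 ≤ s → ∃ τ, (t - τ) ^ 2 + s ^ 2 ≤ dist (F t s) (γ τ) ^ 2) :
    HalfFlat γ := by
  have base : ∀ t s τ : ℝ, 0 ≤ s → dist (F t s) (γ τ) ^ 2 = (t - τ) ^ 2 + s ^ 2 := by
    intro t s τ hs
    have up : ∀ τ, dist (F t s) (γ τ) ^ 2 ≤ (t - τ) ^ 2 + s ^ 2 := by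
      intro τ
      have := hle t τ s 0 hs le_rfl
      rwa [h0, sub_zero] at this
    refine le_antisymm (up τ) ?_
    obtain ⟨τ₀, hτ⟩ := hx t s hs
    have h1 := hγ.isPt hX τ (2 * τ₀ - τ) (l := 1 / 2) (by norm_num) (by norm_num) (F t s)
    rw [hγ.sq_dist, show (1 - 1 / 2) * τ + 1 / 2 * (2 * τ₀ - τ) = τ₀ by ring] at h1
    have h2 := up (2 * τ₀ - τ)
    nlinarith
  have lt : ∀ t t' s s' : ℝ, 0 ≤ s → s < s' →
      Real.sqrt ((t - t') ^ 2 + (s - s') ^ 2) ≤ dist (F t s) (F t' s') := by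
    intro t t' s s' hs hss
    have hp : 0 < s' - s := by linarith
    set D := Real.sqrt ((t - t') ^ 2 + (s - s') ^ 2)
    have hD : D ^ 2 = (t - t') ^ 2 + (s - s') ^ 2 := Real.sq_sqrt (by positivity)
    have hD0 : 0 ≤ D := Real.sqrt_nonneg _
    set τ := (s' * t - s * t') / (s' - s) with hτ
    have e1 : dist (F t s) (γ τ) = s / (s' - s) * D := by
      rw [← sq_eq_sq₀ dist_nonneg (by positivity), base _ _ _ hs, mul_pow, hD, hτ]
      field_simp; ring
    have e2 : dist (F t' s') (γ τ) = s' / (s' - s) * D := by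
      have hs' : 0 ≤ s' := by linarith
      rw [← sq_eq_sq₀ dist_nonneg (by positivity), base _ _ _ hs', mul_pow, hD, hτ]
      field_simp; ring
    have h3 := dist_triangle_left (F t' s') (γ τ) (F t s)
    have h4 : s' / (s' - s) * D - s / (s' - s) * D = D := by field_simp
    linarith
  have key : ∀ t t' s s' : ℝ, 0 ≤ s → s ≤ s' →
      Real.sqrt ((t - t') ^ 2 + (s - s') ^ 2) ≤ dist (F t s) (F t' s') := by
    intro t t' s s' hs hss
    rcases hss.lt_or_eq with hss | rfl
    · exact lt t t' s s' hs hss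
    · rw [sub_self, zero_pow two_ne_zero, add_zero, Real.sqrt_sq_eq_abs]
      apply le_of_forall_pos_le_add
      intro η hη
      have h1 := lt t t' s (s + η / 2) hs (by linarith)
      have h2 : |t - t'| ≤ Real.sqrt ((t - t') ^ 2 + (s - (s + η / 2)) ^ 2) := by
        rw [← Real.sqrt_sq_eq_abs]
        apply Real.sqrt_le_sqrt
        nlinarith [sq_nonneg η]
      have h3 : dist (F t' s) (F t' (s + η / 2)) ≤ η / 2 := by
        apply abs_le_of_sq_le_sq' _ (by positivity) |>.2
        refine (hle _ _ _ _ hs (by linarith)).trans ?_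
        apply le_of_eq; ring
      linarith [dist_triangle (F t s) (F t' s) (F t' (s + η / 2))]
  refine ⟨F, h0, fun t t' s s' hs hs' => le_antisymm ?_ ?_⟩
  · exact Real.le_sqrt_of_sq_le (hle _ _ _ _ hs hs')
  · rcases le_total s s' with h | h
    · exact key _ _ _ _ hs h
    · rw [dist_comm, show (t - t') ^ 2 + (s - s') ^ 2 = (t' - t) ^ 2 + (s' - s) ^ 2 by ring]
      exact key _ _ _ _ hs' h

/-- Bounded sequences in a proper space converge along an ultrafilter. -/
theorem exists_ulim [ProperSpace X] (ω : Ultrafilter ℕ) {ι : Type*} (u : ι → ℕ → X)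
    (hb : ∀ i, ∃ p R, ∀ᶠ n in ω, dist (u i n) p ≤ R) :
    ∃ v : ι → X, ∀ i, Tendsto (u i) ω (nhds (v i)) := by
  have : ∀ i, ∃ v, Tendsto (u i) ω (nhds v) := by
    intro i
    obtain ⟨p, R, h⟩ := hb i
    obtain ⟨v, -, hv⟩ := (isCompact_closedBall p R).ultrafilter_le_nhds (ω.map (u i))
      (by rw [le_principal_iff]; exact h)
    exact ⟨v, hv⟩
  choose v hv using this
  exact ⟨v, hv⟩

/-- Rays towards a sequence of points with Busemann function of slope `a ∈ (-1, 1)` on `γ`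
span a half-plane. -/
theorem halfFlat_of_slope [ProperSpace X] (hX : BruhatTits X) (hγ : Line γ) (ω : Ultrafilter ℕ)
    (z : ℕ → X) (hz : Tendsto (fun n => dist (z n) (γ 0)) ω atTop) {a : ℝ} (ha : -1 < a)
    (ha' : a < 1)
    (hs : ∀ t, Tendsto (fun n => dist (z n) (γ t) - dist (z n) (γ 0)) ω (nhds (a * t))) :
    HalfFlat γ := by
  have hzt : ∀ t, Tendsto (fun n => dist (z n) (γ t)) ω atTop := by
    intro t
    have := (hs t).add_atTop hz
    simpa using this
  have hev : ∀ t S : ℝ, ∀ᶠ n in (ω : Filter ℕ), 0 < dist (z n) (γ t) ∧ S / dist (z n) (γ t) ≤ 1 := by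
    intro t S
    filter_upwards [(hzt t).eventually_gt_atTop 0, (hzt t).eventually_ge_atTop S] with n h1 h2
    exact ⟨h1, (div_le_one h1).2 h2⟩
  set ρ : ℝ → ℝ → ℕ → X := fun t S n => pt hX (γ t) (z n) (S / dist (z n) (γ t)) with hρ
  have hρd : ∀ t S : ℝ, 0 ≤ S → ∀ᶠ n in (ω : Filter ℕ), dist (γ t) (ρ t S n) = S := by
    intro t S hS
    filter_upwards [hev t S] with n hn
    rw [(isPt_pt hX (γ t) (z n) (by positivity) hn.2).dist_left (by positivity) hn.2,
      dist_comm (γ t)]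
    exact div_mul_cancel₀ _ hn.1.ne'
  obtain ⟨v, hv⟩ := exists_ulim ω (fun i : ℝ × {S : ℝ // 0 ≤ S} => ρ i.1 i.2) (by
    rintro ⟨t, S, hS⟩
    refine ⟨γ t, S, ?_⟩
    filter_upwards [hρd t S hS] with n hn
    rw [dist_comm, hn])
  have hvd : ∀ t S (hS : 0 ≤ S), dist (γ t) (v (t, ⟨S, hS⟩)) = S := by
    intro t S hS
    have h1 : Tendsto (fun n => dist (γ t) (ρ t S n)) ω (nhds (dist (γ t) (v (t, ⟨S, hS⟩)))) :=
      tendsto_const_nhds.dist (hv (t, ⟨S, hS⟩))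
    refine tendsto_nhds_unique h1 (tendsto_const_nhds.congr' ?_)
    filter_upwards [hρd t S hS] with n hn using hn.symm
  have hup : ∀ t t' S S' (hS : 0 ≤ S) (hS' : 0 ≤ S'),
      dist (v (t, ⟨S, hS⟩)) (v (t', ⟨S', hS'⟩)) ^ 2
        ≤ (a * (t - t') - (S - S')) ^ 2 + (t - t') ^ 2 - (a * (t - t')) ^ 2 := by
    intro t t' S S' hS hS'
    have h1 : Tendsto (fun n => dist (ρ t S n) (ρ t' S' n) ^ 2) ω
        (nhds (dist (v (t, ⟨S, hS⟩)) (v (t', ⟨S', hS'⟩)) ^ 2)) :=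
      ((hv (t, ⟨S, hS⟩)).dist (hv (t', ⟨S', hS'⟩))).pow 2
    have h2 : Tendsto (fun n => dist (z n) (γ t) - dist (z n) (γ t')) ω
        (nhds (a * (t - t'))) := by
      have := (hs t).sub (hs t')
      rw [mul_sub]
      refine this.congr fun n => by ring
    have h3 := (((h2.sub_const (S - S')).pow 2).add_const ((t - t') ^ 2)).sub (h2.pow 2)
    refine le_of_tendsto_of_tendsto h1 h3 ?_
    filter_upwards [hev t S, hev t' S'] with n hn hn'
    set b := dist (z n) (γ t)
    set c := dist (z n) (γ t')
    have u0 : 0 ≤ S / b := by positivity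
    have u1 : 0 ≤ S' / c := by positivity
    have f := (isPt_pt hX (γ t) (z n) u0 hn.2).symm.fan
      (isPt_pt hX (γ t') (z n) u1 hn'.2).symm (by linarith [hn.2]) (by linarith) (by linarith [hn'.2])
    rw [hγ.sq_dist] at f
    have hbc : |b - c| ≤ |t - t'| := by
      have := abs_dist_sub_le (γ t) (γ t') (z n)
      rw [hγ, dist_comm _ (z n), dist_comm _ (z n)] at this
      exact this
    have hbc2 : (b - c) ^ 2 ≤ (t - t') ^ 2 := sq_le_sq.2 hbc
    have e1 : (1 - S / b) * b = b - S := by rw [sub_mul, div_mul_cancel₀ _ hn.1.ne', one_mul]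
    have e2 : (1 - S' / c) * c = c - S' := by rw [sub_mul, div_mul_cancel₀ _ hn'.1.ne', one_mul]
    have huv : (1 - S / b) * (1 - S' / c) ≤ 1 :=
      mul_le_one₀ (by linarith) (by linarith [hn'.2]) (by linarith)
    have e3 : (1 - S / b) ^ 2 * b ^ 2 + (1 - S' / c) ^ 2 * c ^ 2
        + (1 - S / b) * (1 - S' / c) * ((t - t') ^ 2 - b ^ 2 - c ^ 2)
        = ((b - S) - (c - S')) ^ 2
          + (1 - S / b) * (1 - S' / c) * ((t - t') ^ 2 - (b - c) ^ 2) := by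
      rw [← e1, ← e2]; ring
    refine f.trans ?_
    rw [e3]
    nlinarith [mul_le_mul_of_nonneg_right huv (sub_nonneg.2 hbc2)]
  have ha2 : 0 < 1 - a ^ 2 := by nlinarith
  set k := Real.sqrt (1 - a ^ 2) with hk
  have hk0 : 0 < k := Real.sqrt_pos.2 ha2
  have hk2 : k ^ 2 = 1 - a ^ 2 := Real.sq_sqrt ha2.le
  set w : ℝ → ℝ → X := fun t S => if h : 0 ≤ S then v (t, ⟨S, h⟩) else γ t with hw
  have hw1 : ∀ t S, 0 ≤ S → dist (γ t) (w t S) = S := by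
    intro t S hS
    simp only [hw, dif_pos hS, hvd]
  have hw2 : ∀ t t' S S', 0 ≤ S → 0 ≤ S' → dist (w t S) (w t' S') ^ 2
        ≤ (a * (t - t') - (S - S')) ^ 2 + (t - t') ^ 2 - (a * (t - t')) ^ 2 := by
    intro t t' S S' hS hS'
    simp only [hw, dif_pos hS, dif_pos hS']
    exact hup _ _ _ _ _ _
  refine halfFlat_of_expanding hX hγ (fun x y => w (x + a * (y / k)) (y / k)) ?_ ?_ ?_
  · intro t
    have := hw1 t 0 le_rfl
    simp only [zero_div, mul_zero, add_zero]
    exact (dist_eq_zero.1 this).symm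
  · intro t t' s s' hs hs'
    refine (hw2 _ _ _ _ (by positivity) (by positivity)).trans (le_of_eq ?_)
    have e : s - s' = k * (s / k - s' / k) := by field_simp
    rw [e, mul_pow k, hk2]
    ring
  · intro t s hs
    refine ⟨t + a * (s / k), ?_⟩
    rw [dist_comm, hw1 _ _ (by positivity)]
    have e : s = k * (s / k) := by field_simp
    have : s ^ 2 = (1 - a ^ 2) * (s / k) ^ 2 := by rw [← hk2, ← mul_pow, ← e]
    rw [this]
    apply le_of_eq; ring

end Lines

section RankOne

variable {X : Type*} [MetricSpace X] {γ : ℝ → X}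

theorem surjective_of_isometry {h : ℝ → ℝ} (hh : ∀ s t, |h s - h t| = |s - t|) (t : ℝ) :
    ∃ s, h s = t := by
  have h1 := hh (t - h 0) 0
  have h2 := hh (-(t - h 0)) 0
  have h3 := hh (t - h 0) (-(t - h 0))
  rw [show t - h 0 - -(t - h 0) = 2 * (t - h 0) by ring, abs_mul, abs_two] at h3
  rw [sub_zero] at h1 h2
  rw [abs_neg] at h2
  rcases abs_eq_abs.1 h1 with h1 | h1
  · exact ⟨t - h 0, by linarith⟩
  · rcases abs_eq_abs.1 h2 with h2 | h2
    · exact ⟨-(t - h 0), by linarith⟩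
    · rw [show h (t - h 0) - h (-(t - h 0)) = 0 by linarith, abs_zero] at h3
      have : t - h 0 = 0 := abs_eq_zero.1 (by linarith)
      exact ⟨0, by linarith⟩

theorem Line.strip (hX : BruhatTits X) (hγ : Line γ) {σ : ℝ → X} (hσ : Line σ) {H : ℝ}
    (hH : ∀ s, ht γ (σ s) = H) :
    ∃ S : ℝ → X, Line S ∧ ∀ t t', dist (S t) (γ t') ^ 2 = H ^ 2 + (t - t') ^ 2 := by
  set h : ℝ → ℝ := fun s => pr γ (σ s) with hh
  have hn : ∀ s, pr σ (γ (h s)) = s := by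
    intro s
    apply hσ.pr_eq hX
    intro s'
    have : dist (σ s) (γ (h s)) = H := hH s
    rw [dist_comm, this, ← hH s', dist_comm]
    exact hγ.ht_le _ _
  have hiso : ∀ s t, |h s - h t| = |s - t| := by
    intro s t
    apply le_antisymm
    · exact (hγ.pr_lip hX _ _).trans (hσ s t).le
    · have := hσ.pr_lip hX (γ (h s)) (γ (h t))
      rwa [hn, hn, hγ] at this
  choose g hg using surjective_of_isometry hiso
  have hgd : ∀ t t', |g t - g t'| = |t - t'| := by
    intro t t'
    rw [← hiso, hg, hg]
  refine ⟨fun t => σ (g t), fun s t => by rw [hσ, hgd], fun t t' => ?_⟩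
  have p1 : ∀ t, pr γ (σ (g t)) = t := hg
  have q := quadrilateral hX (σ (g t)) (σ (g t')) (γ t') (γ t)
  have e1 : ∀ t, dist (σ (g t)) (γ t) = H := by
    intro t
    rw [← hH (g t), ht, p1]
  rw [hσ.sq_dist, hγ.sq_dist, dist_comm (γ t), e1, e1, ← sq_abs (g t - g t'), hgd, sq_abs] at q
  have l1 := hγ.sq_le hX (σ (g t)) t'
  have l2 := hγ.sq_le hX (σ (g t')) t
  rw [hH, p1] at l1 l2
  nlinarith

theorem halfFlat_of_strips [ProperSpace X] (hX : BruhatTits X) (hγ : Line γ)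
    (h : ∀ N : ℕ, 0 < N → ∃ σ, Line σ ∧ ∀ s, ht γ (σ s) = N) : HalfFlat γ := by
  have h1 : ∀ N : ℕ, 0 < N → ∃ S : ℝ → X, Line S ∧
      ∀ t t', dist (S t) (γ t') ^ 2 = (N : ℝ) ^ 2 + (t - t') ^ 2 := by
    intro N hN
    obtain ⟨σ, hσ, hH⟩ := h N hN
    exact hγ.strip hX hσ hH
  have : Nonempty X := ⟨γ 0⟩
  choose! S hSl hSd using h1
  set F : ℝ → ℝ → ℕ → X := fun t s N => pt hX (γ t) (S N t) (s / N) with hF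
  have hle : ∀ t t' s s' : ℝ, 0 ≤ s → 0 ≤ s' → ∀ᶠ N : ℕ in atTop,
      dist (F t s N) (F t' s' N) ^ 2 ≤ (t - t') ^ 2 + (s - s') ^ 2 := by
    intro t t' s s' hs hs'
    filter_upwards [eventually_gt_atTop 0, eventually_ge_atTop ⌈s⌉₊, eventually_ge_atTop ⌈s'⌉₊]
      with N hN h1 h2
    have hN' : (0 : ℝ) < N := by exact_mod_cast hN
    have u1 : s / N ≤ 1 := by
      rw [div_le_one hN']; exact (Nat.le_ceil s).trans (by exact_mod_cast h1)
    have u2 : s' / N ≤ 1 := by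
      rw [div_le_one hN']; exact (Nat.le_ceil s').trans (by exact_mod_cast h2)
    have u0 : 0 ≤ s / N := by positivity
    have u0' : 0 ≤ s' / N := by positivity
    have m1 := isPt_pt hX (γ t) (S N t) u0 u1
    have m2 := isPt_pt hX (γ t') (S N t') u0' u2
    have a := m2 (F t s N)
    have b := m1 (γ t')
    have c := m1 (S N t')
    rw [dist_comm (F t s N) (γ t'), dist_comm (F t s N) (S N t'), dist_comm (γ t') (S N t'),
      hSd N hN] at a
    rw [dist_comm (γ t') (S N t), dist_comm (γ t) (S N t), hSd N hN, hSd N hN, hγ.sq_dist] at b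
    rw [dist_comm (γ t) (S N t), hSd N hN, hSd N hN, (hSl N hN).sq_dist] at c
    have e1 : s = s / N * N := by field_simp
    have e2 : s' = s' / N * N := by field_simp
    set u := s / N
    set u' := s' / N
    have b' := mul_le_mul_of_nonneg_left b (by linarith : 0 ≤ 1 - u')
    have c' := mul_le_mul_of_nonneg_left c u0'
    have e3 : (s - s') ^ 2 = (u * N - u' * N) ^ 2 := by rw [← e1, ← e2]
    rw [e3]
    change dist (F t s N) (F t' s' N) ^ 2 ≤ _ at a
    change (1 - u') * dist (γ t') (F t s N) ^ 2 ≤ _ at b'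
    change u' * dist (S N t') (F t s N) ^ 2 ≤ _ at c'
    linarith
  have hd : ∀ t s : ℝ, 0 ≤ s → ∀ᶠ N : ℕ in atTop, dist (γ t) (F t s N) = s := by
    intro t s hs
    filter_upwards [eventually_gt_atTop 0, eventually_ge_atTop ⌈s⌉₊] with N hN h1
    have hN' : (0 : ℝ) < N := by exact_mod_cast hN
    have u1 : s / N ≤ 1 := by
      rw [div_le_one hN']; exact (Nat.le_ceil s).trans (by exact_mod_cast h1)
    have : dist (γ t) (S N t) = N := by
      rw [← sq_eq_sq₀ dist_nonneg hN'.le, dist_comm, hSd N hN]; ring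
    rw [(isPt_pt hX (γ t) (S N t) (by positivity) u1).dist_left (by positivity) u1, this]
    field_simp
  have hω : (hyperfilter ℕ : Filter ℕ) ≤ atTop := Nat.hyperfilter_le_atTop
  obtain ⟨v, hv⟩ := exists_ulim (hyperfilter ℕ) (fun i : ℝ × {S : ℝ // 0 ≤ S} => F i.1 i.2) (by
    rintro ⟨t, s, hs⟩
    refine ⟨γ t, s, ?_⟩
    filter_upwards [hω (hd t s hs)] with n hn
    rw [dist_comm, hn])
  have hvd : ∀ t S (hS : 0 ≤ S), dist (γ t) (v (t, ⟨S, hS⟩)) = S := by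
    intro t S hS
    have h1 : Tendsto (fun n => dist (γ t) (F t S n)) (hyperfilter ℕ)
        (nhds (dist (γ t) (v (t, ⟨S, hS⟩)))) :=
      tendsto_const_nhds.dist (hv (t, ⟨S, hS⟩))
    refine tendsto_nhds_unique h1 (tendsto_const_nhds.congr' ?_)
    filter_upwards [hω (hd t S hS)] with n hn using hn.symm
  have hup : ∀ t t' S S' (hS : 0 ≤ S) (hS' : 0 ≤ S'),
      dist (v (t, ⟨S, hS⟩)) (v (t', ⟨S', hS'⟩)) ^ 2 ≤ (t - t') ^ 2 + (S - S') ^ 2 := by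
    intro t t' S S' hS hS'
    exact le_of_tendsto (((hv (t, ⟨S, hS⟩)).dist (hv (t', ⟨S', hS'⟩))).pow 2)
      (hω (hle t t' S S' hS hS'))
  set w : ℝ → ℝ → X := fun t S => if h : 0 ≤ S then v (t, ⟨S, h⟩) else γ t with hw
  have hw1 : ∀ t S, 0 ≤ S → dist (γ t) (w t S) = S := by
    intro t S hS
    simp only [hw, dif_pos hS, hvd]
  refine halfFlat_of_expanding hX hγ w ?_ ?_ ?_
  · intro t
    exact (dist_eq_zero.1 (hw1 t 0 le_rfl)).symm
  · intro t t' S S' hS hS'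
    simp only [hw, dif_pos hS, dif_pos hS']
    exact hup _ _ _ _ _ _
  · intro t s hs
    refine ⟨t, ?_⟩
    rw [dist_comm, hw1 t s hs]
    simp

/-- Translations of step `ℓ` along `γ` are induced by isometries. -/
def Periodic (γ : ℝ → X) (ℓ : ℝ) : Prop :=
  0 < ℓ ∧ ∀ k : ℤ, ∃ T : X → X, (∀ x y, dist (T x) (T y) = dist x y) ∧
    ∀ t, T (γ t) = γ (t + k * ℓ)

theorem Periodic.neg {ℓ : ℝ} (h : Periodic γ ℓ) : Periodic (fun t => γ (-t)) ℓ := by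
  refine ⟨h.1, fun k => ?_⟩
  obtain ⟨T, h1, h2⟩ := h.2 (-k)
  refine ⟨T, h1, fun t => ?_⟩
  rw [h2]; push_cast; ring_nf

theorem Line.convexOn (hX : BruhatTits X) (hγ : Line γ) (x : X) :
    ConvexOn ℝ Set.univ fun t => dist x (γ t) := by
  refine ⟨convex_univ, fun a _ b _ u v hu hv huv => ?_⟩
  have := hγ.dist_convex hX x a b hv (by linarith)
  rw [show 1 - v = u by linarith] at this
  simpa using this

theorem chord_le_chord {f : ℝ → ℝ} (hf : ConvexOn ℝ Set.univ f) {x y z w : ℝ} (hxy : x < y)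
    (hyz : y ≤ z) (hzw : z < w) : (f y - f x) / (y - x) ≤ (f w - f z) / (w - z) := by
  rcases hyz.eq_or_lt with rfl | hyz
  · exact hf.slope_mono_adjacent (Set.mem_univ _) (Set.mem_univ _) hxy hzw
  · exact (hf.slope_mono_adjacent (Set.mem_univ _) (Set.mem_univ _) hxy hyz).trans
      (hf.slope_mono_adjacent (Set.mem_univ _) (Set.mem_univ _) hyz hzw)

/-- A convex function with slopes in `[0, a₀]`, `a₀ < 1`, on a long interval is almost linear on
a shorter one. -/
theorem exists_almost_linear {f : ℝ → ℝ} (hf : ConvexOn ℝ Set.univ f) {p e u v a₀ : ℝ}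
    (hp : ∀ s, f p ≤ f s) (he : 0 < e) (hpe : p < e) (ha : a₀ < 1) (huv : u < v)
    (hv : f v - f u ≤ a₀ * (v - u)) {m : ℕ} (hm : 0 < m) (hu : (3 * m + 2) * e ≤ u) :
    ∃ j : ℕ, ∃ a ∈ Set.Icc 0 a₀, ∀ s, |s| ≤ e →
      |f ((j + 3) * e + s) - f ((j + 3) * e) - a * s| ≤ |s| / m := by
  have hm' : (0 : ℝ) < m := by exact_mod_cast hm
  set κ : ℕ → ℝ := fun j => (f ((j + 2) * e) - f ((j + 1) * e)) / e with hκ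
  have hκe : ∀ j : ℕ, κ j = (f ((j + 2) * e) - f ((j + 1) * e)) / ((j + 2) * e - (j + 1) * e) := by
    intro j
    rw [hκ]; ring
  have hlt : ∀ j : ℕ, ((j : ℝ) + 1) * e < (j + 2) * e := fun j => by nlinarith
  have hκ0 : ∀ j, 0 ≤ κ j := by
    intro j
    have : p < (j + 1) * e := by
      have : (0 : ℝ) ≤ j * e := by positivity
      linarith
    refine le_trans ?_ ((chord_le_chord hf this le_rfl (hlt j)).trans_eq (hκe j).symm)
    apply div_nonneg <;> linarith [hp ((j + 1) * e)]
  have hκa : ∀ j : ℕ, j ≤ 3 * m → κ j ≤ a₀ := by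
    intro j hj
    have hj' : (j : ℝ) ≤ 3 * m := by exact_mod_cast hj
    have h1 := chord_le_chord hf (hlt j) (z := u) (w := v) (by nlinarith) huv
    rw [← hκe] at h1
    exact h1.trans ((div_le_iff₀ (by linarith)).2 hv)
  obtain ⟨i, hi, hi2⟩ : ∃ i < m, κ (3 * i + 3) - κ (3 * i) ≤ 1 / m := by
    by_contra! hc
    have : ∀ i : ℕ, i ≤ m → (i : ℝ) / m ≤ κ (3 * i) := by
      intro i
      induction i with
      | zero => intro _; simpa using hκ0 0
      | succ i ih =>
        intro hi
        have h1 := ih (by omega)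
        have h2 := hc i (by omega)
        rw [show 3 * (i + 1) = 3 * i + 3 by ring]
        push_cast
        rw [add_div]
        linarith
    have h1 := this m le_rfl
    rw [div_self hm'.ne'] at h1
    linarith [hκa (3 * m) le_rfl]
  have e2 := hκe (3 * i + 3)
  refine ⟨3 * i, κ (3 * i), ⟨hκ0 _, hκa _ (by omega)⟩, fun s hs => ?_⟩
  have e1 := hκe (3 * i)
  push_cast at e1 e2 ⊢
  set c : ℝ := 3 * i with hc
  obtain ⟨hs1, hs2⟩ := abs_le.1 hs
  rcases lt_trichotomy s 0 with h | rfl | h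
  · have h1 := chord_le_chord hf (x := (c + 1) * e) (y := (c + 2) * e) (z := (c + 3) * e + s)
      (w := (c + 3) * e) (by nlinarith) (by nlinarith) (by linarith)
    have h2 := chord_le_chord hf (x := (c + 3) * e + s) (y := (c + 3) * e) (z := (c + 3 + 1) * e)
      (w := (c + 3 + 2) * e) (by nlinarith) (by nlinarith) (by linarith)
    rw [← e1] at h1
    rw [← e2] at h2
    rw [show (c + 3) * e - ((c + 3) * e + s) = -s by ring] at h1 h2
    rw [le_div_iff₀ (by linarith)] at h1
    rw [div_le_iff₀ (by linarith)] at h2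
    rw [abs_of_neg h, abs_le, div_eq_mul_one_div]
    have := mul_le_mul_of_nonneg_right hi2 (by linarith : 0 ≤ -s)
    constructor <;> nlinarith
  · simp
  · have h1 := chord_le_chord hf (x := (c + 1) * e) (y := (c + 2) * e) (z := (c + 3) * e)
      (w := (c + 3) * e + s) (by nlinarith) (by nlinarith) (by linarith)
    have h2 := chord_le_chord hf (x := (c + 3) * e) (y := (c + 3) * e + s) (z := (c + 3 + 1) * e)
      (w := (c + 3 + 2) * e) (by nlinarith) (by nlinarith) (by linarith)
    rw [← e1] at h1
    rw [← e2] at h2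
    rw [show (c + 3) * e + s - (c + 3) * e = s by ring] at h1 h2
    rw [le_div_iff₀ (by linarith)] at h1
    rw [div_le_iff₀ (by linarith)] at h2
    rw [abs_of_pos h, abs_le, div_eq_mul_one_div]
    have := mul_le_mul_of_nonneg_right hi2 h.le
    constructor <;> nlinarith

theorem exists_translate (hX : BruhatTits X) (hγ : Line γ) {ℓ : ℝ} (hper : Periodic γ ℓ) (x : X) :
    ∃ T : X → X, ∃ c : ℝ, (∀ x y, dist (T x) (T y) = dist x y) ∧ (∀ t, T (γ t) = γ (t + c)) ∧
      0 ≤ pr γ (T x) ∧ pr γ (T x) < ℓ := by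
  obtain ⟨T, h1, h2⟩ := hper.2 (-⌊pr γ x / ℓ⌋)
  refine ⟨T, _, h1, h2, ?_⟩
  rw [hγ.pr_map hX h1 h2]
  have h3 := Int.floor_le (pr γ x / ℓ)
  have h4 := Int.lt_floor_add_one (pr γ x / ℓ)
  rw [le_div_iff₀ hper.1] at h3
  rw [div_lt_iff₀ hper.1] at h4
  push_cast
  constructor <;> linarith

/-- Far away from the nearest point, the distance function to a fixed point grows along a rank
one axis almost at unit speed. -/
theorem eventually_unit_speed [ProperSpace X] (hX : BruhatTits X) (hγ : Line γ) {ℓ : ℝ}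
    (hper : Periodic γ ℓ) (hflat : ¬ HalfFlat γ) {T : ℝ} (hT : 0 < T) :
    ∃ M, ∀ z t, pr γ z + M ≤ t → dist z (γ (t - T)) ≤ dist z (γ t) - T + 1 := by
  by_contra! hc
  apply hflat
  have hℓ := hper.1
  have key : ∀ m : ℕ, ∃ z : X, ∃ a ∈ Set.Icc (0 : ℝ) (1 - 1 / T), 0 < m →
      (m * ℓ ≤ dist z (γ 0) ∧ ∀ s, |s| ≤ m * ℓ →
        |dist z (γ s) - dist z (γ 0) - a * s| ≤ |s| / m) := by
    intro m
    rcases m.eq_zero_or_pos with rfl | hm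
    · obtain ⟨z, t, h1, h2⟩ := hc T
      refine ⟨z, 0, ⟨le_rfl, ?_⟩, fun h => absurd h (lt_irrefl _)⟩
      rw [sub_nonneg, div_le_one hT]
      have h3 : dist z (γ (t - T)) ^ 2 ≤ dist z (γ t) ^ 2 := by
        rcases lt_or_ge (pr γ z) (t - T) with h | h
        · have := chord_le_chord (hγ.convexOn hX z) h le_rfl (by linarith : t - T < t)
          have h4 : 0 ≤ (dist z (γ (t - T)) - dist z (γ (pr γ z))) / (t - T - pr γ z) :=
            div_nonneg (sub_nonneg.2 (hγ.ht_le z _)) (by linarith)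
          have h5 := h4.trans this
          rw [le_div_iff₀ (by linarith)] at h5
          apply pow_le_pow_left₀ dist_nonneg; linarith
        · have : t - T = pr γ z := by linarith
          rw [this]
          exact pow_le_pow_left₀ dist_nonneg (hγ.ht_le z _) 2
      have h4 := abs_le_of_sq_le_sq' h3 dist_nonneg |>.2
      linarith
    have hm' : (1 : ℝ) ≤ m := by exact_mod_cast hm
    obtain ⟨z, t, h1, h2⟩ := hc (T + ℓ + (3 * m + 2) * (m * ℓ))
    obtain ⟨T₀, c, hT1, hT2, hp0, hpℓ⟩ := exists_translate hX hγ hper z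
    have hd : ∀ s, dist (T₀ z) (γ (s + c)) = dist z (γ s) := fun s => by rw [← hT2, hT1]
    have hmℓ : 0 < m * ℓ := by positivity
    have hpr := hγ.pr_map hX hT1 hT2 z
    obtain ⟨j, a, ha, hj⟩ := exists_almost_linear (hγ.convexOn hX (T₀ z)) (p := pr γ (T₀ z))
      (e := m * ℓ) (u := t - T + c) (v := t + c) (a₀ := 1 - 1 / T) (hγ.ht_le (T₀ z)) hmℓ
      (by nlinarith) (by simpa using hT) (by linarith) (by
        rw [hd, hd]
        have : (1 - 1 / T) * (t + c - (t - T + c)) = T - 1 := by field_simp; ring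
        linarith) hm (by linarith)
    obtain ⟨T₁, hT3, hT4⟩ := hper.2 (-((j + 3) * m))
    have hd' : ∀ s, dist (T₁ (T₀ z)) (γ s) = dist (T₀ z) (γ ((j + 3) * (m * ℓ) + s)) := by
      intro s
      rw [show s = ((j + 3) * (m * ℓ) + s) + ((-((j + 3) * m) : ℤ) : ℝ) * ℓ by push_cast; ring,
        ← hT4, hT3]
      congr 2; push_cast; ring
    refine ⟨T₁ (T₀ z), a, ha, fun _ => ⟨?_, fun s hs => ?_⟩⟩
    · rw [hd', add_zero]
      have h3 := hγ.sq_le hX (T₀ z) ((j + 3) * (m * ℓ))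
      have h4 : (m * ℓ) ^ 2 ≤ dist (T₀ z) (γ ((j + 3) * (m * ℓ))) ^ 2 := by
        refine le_trans ?_ ((le_add_of_nonneg_left (sq_nonneg _)).trans h3)
        apply pow_le_pow_left₀ hmℓ.le
        have : (0 : ℝ) ≤ j * (m * ℓ) := by positivity
        nlinarith
      exact abs_le_of_sq_le_sq' h4 dist_nonneg |>.2
    · rw [hd', hd', add_zero]
      exact hj s hs
  choose z a ha hz using key
  obtain ⟨b, hb, hlim⟩ := (isCompact_Icc (a := (0 : ℝ)) (b := 1 - 1 / T)).ultrafilter_le_nhds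
    ((hyperfilter ℕ).map a) (by
      rw [le_principal_iff]; exact Filter.mem_map.2 (Filter.univ_mem' ha))
  have hω : (hyperfilter ℕ : Filter ℕ) ≤ atTop := Nat.hyperfilter_le_atTop
  have htop : Tendsto (fun m : ℕ => (m : ℝ) * ℓ) atTop atTop :=
    tendsto_natCast_atTop_atTop.atTop_mul_const hℓ
  refine halfFlat_of_slope hX hγ (hyperfilter ℕ) z (a := b) ?_ (by linarith [hb.1]) ?_ ?_
  · refine Tendsto.mono_left (tendsto_atTop_mono' _ ?_ htop) hω
    filter_upwards [eventually_gt_atTop 0] with m hm using (hz m hm).1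
  · have : 0 < 1 / T := by positivity
    linarith [hb.2]
  · intro t
    have h1 : Tendsto (fun m => a m * t) (hyperfilter ℕ) (nhds (b * t)) :=
      Tendsto.mul_const t hlim
    have h2 : Tendsto (fun m => dist (z m) (γ t) - dist (z m) (γ 0) - a m * t) (hyperfilter ℕ)
        (nhds 0) := by
      refine Tendsto.mono_left (squeeze_zero_norm' ?_
        (tendsto_const_div_atTop_nhds_zero_nat |t|)) hω
      filter_upwards [eventually_gt_atTop 0, htop.eventually_ge_atTop |t|] with m hm hmt
      exact (hz m hm).2 t hmt
    have := h2.add h1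
    rw [zero_add] at this
    exact this.congr fun m => by ring

end RankOne

section OneSided

variable {X : Type*} [MetricSpace X] {γ : ℝ → X}

theorem pt_zero (hX : BruhatTits X) (x y : X) : pt hX x y 0 = x := by
  have := (isPt_pt hX x y le_rfl zero_le_one).dist_left le_rfl zero_le_one
  rw [zero_mul] at this
  exact (dist_eq_zero.1 this).symm

theorem pt_one (hX : BruhatTits X) (x y : X) : pt hX x y 1 = y := by
  have := (isPt_pt hX x y zero_le_one le_rfl).dist_right zero_le_one le_rfl
  rw [sub_self, zero_mul] at this
  exact (dist_eq_zero.1 this).symm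

theorem pt_map (hX : BruhatTits X) {T : X → X} (hT : ∀ x y, dist (T x) (T y) = dist x y)
    (x y : X) {l : ℝ} (h0 : 0 ≤ l) (h1 : l ≤ 1) :
    T (pt hX x y l) = pt hX (T x) (T y) l := by
  apply (isPt_pt hX (T x) (T y) h0 h1).eq_of_dist
  · rw [hT, hT, dist_comm, (isPt_pt hX x y h0 h1).dist_left h0 h1]
  · rw [hT, hT, dist_comm, (isPt_pt hX x y h0 h1).dist_right h0 h1]

theorem Line.abs_ht_sub_le (hγ : Line γ) (x y : X) : |ht γ x - ht γ y| ≤ dist x y := by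
  rw [abs_le]
  have h1 := hγ.ht_lip x y
  have h2 := hγ.ht_lip y x
  rw [dist_comm y x] at h2
  constructor <;> linarith

theorem Line.continuousOn_ht_pt (hX : BruhatTits X) (hγ : Line γ) (x y : X) :
    ContinuousOn (fun l => ht γ (pt hX x y l)) (Set.Icc 0 1) := by
  have : LipschitzOnWith (dist x y).toNNReal (fun l => ht γ (pt hX x y l)) (Set.Icc 0 1) := by
    apply LipschitzOnWith.of_dist_le_mul
    intro l hl k hk
    rw [Real.coe_toNNReal _ dist_nonneg, Real.dist_eq, Real.dist_eq]
    refine (hγ.abs_ht_sub_le _ _).trans_eq ?_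
    rw [dist_pt_pt hX x y hl.1 hl.2 hk.1 hk.2, mul_comm]
  exact this.continuousOn

theorem exists_high_segment (hX : BruhatTits X) (hγ : Line γ) {ℓ : ℝ} (hper : Periodic γ ℓ)
    {R n : ℝ} (hR : 0 < R) (hn : 0 ≤ n) {z : X} {t : ℝ} (htz : pr γ z ≤ t)
    (hd : dist z (γ t) < ht γ z + (t - pr γ z) - (n + R)) :
    ∃ x z l, 0 ≤ l ∧ l ≤ 1 ∧ ht γ x = 0 ∧ ht γ (pt hX x z l) = R ∧ 0 ≤ pr γ (pt hX x z l) ∧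
      pr γ (pt hX x z l) < ℓ ∧ pr γ z + n ≤ ℓ ∧ n ≤ (1 - l) * dist x z := by
  have hb := hγ.pr_lip hX z (γ t)
  rw [hγ.pr_self hX, abs_sub_comm, abs_of_nonneg (by linarith)] at hb
  have hx0 : ht γ (γ t) = 0 := hγ.ht_self hX t
  obtain ⟨l, hl, hlR⟩ := intermediate_value_Icc zero_le_one (hγ.continuousOn_ht_pt hX (γ t) z)
    (show R ∈ _ by
      rw [pt_zero, pt_one, hx0]; exact ⟨hR.le, by linarith⟩)
  change ht γ (pt hX (γ t) z l) = R at hlR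
  set y := pt hX (γ t) z l with hy
  have i := isPt_pt hX (γ t) z hl.1 hl.2
  have e1 := i.dist_left hl.1 hl.2
  have e2 := i.dist_right hl.1 hl.2
  rw [← hy, dist_comm z y] at e2
  rw [← hy] at e1
  have h1 := hγ.ht_lip z y
  rw [dist_comm z y, hlR] at h1
  have h2 := hγ.pr_lip hX (γ t) y
  rw [hγ.pr_self hX] at h2
  have h3 := (abs_le.1 h2).2
  rw [dist_comm z] at hd
  obtain ⟨T, c, hT, hTc, hp0, hpℓ⟩ := exists_translate hX hγ hper y
  refine ⟨T (γ t), T z, l, hl.1, hl.2, ?_⟩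
  rw [← pt_map hX hT _ _ hl.1 hl.2, ← hy, hγ.ht_map hX hT hTc, hγ.ht_map hX hT hTc, hT,
    hγ.pr_map hX hT hTc z]
  rw [hγ.pr_map hX hT hTc] at hp0 hpℓ ⊢
  rw [dist_comm z] at hb
  exact ⟨hx0, hlR, hp0, hpℓ, by linarith, by linarith⟩

theorem ht_sq_le_of_unit_speed (hX : BruhatTits X) (hγ : Line γ) {ℓ R n s M : ℝ} {x z : X} {l : ℝ}
    (h0 : 0 ≤ l) (h1 : l ≤ 1) (hy : ht γ (pt hX x z l) = R) (hp : 0 ≤ pr γ (pt hX x z l))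
    (hp' : pr γ (pt hX x z l) < ℓ) (hz : pr γ z + n ≤ ℓ) (hn : n ≤ (1 - l) * dist x z)
    (hs : 0 < s) (hM : ∀ z t, pr γ z + M ≤ t → dist z (γ (t - s)) ≤ dist z (γ t) - s + 1)
    (hnM : ℓ + M ≤ n) (hns : s ≤ n) :
    ht γ (pt hX x z (l + s / dist x z)) ^ 2 ≤ (R + ℓ + 1) ^ 2 + s * (4 * (R + ℓ) + 2) := by
  have hL : s ≤ (1 - l) * dist x z := hns.trans hn
  have hD : 0 < dist x z := by
    by_contra! h
    have : dist x z = 0 := le_antisymm h dist_nonneg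
    rw [this] at hL; linarith
  have hl1 : 0 < 1 - l := by
    by_contra! h
    nlinarith
  set L := (1 - l) * dist x z with hLd
  have hL0 : 0 < L := by positivity
  have hu0 : 0 ≤ s / L := by positivity
  have hu1 : s / L ≤ 1 := (div_le_one hL0).2 hL
  have i := isPt_pt_pt hX x z (a := l) (b := 1) ⟨h0, h1⟩ ⟨zero_le_one, le_rfl⟩ ⟨hu0, hu1⟩
  rw [show (1 - s / L) * l + s / L * 1 = l + s / dist x z by
    rw [hLd]; field_simp; ring, pt_one] at i
  set y := pt hX x z l with hyd
  have hyz : dist y z = L := by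
    rw [dist_comm, hyd, (isPt_pt hX x z h0 h1).dist_right h0 h1]
  set τ := pt hX x z (l + s / dist x z)
  have a1 := i (γ (-s))
  have a2 : dist y (γ 0) ≤ R + ℓ := by
    have := dist_triangle y (γ (pr γ y)) (γ 0)
    rw [hγ, sub_zero, abs_of_nonneg hp] at this
    have e : dist y (γ (pr γ y)) = R := hy
    linarith
  have a3 : dist (γ (-s)) y ≤ R + ℓ + s := by
    have := dist_triangle y (γ 0) (γ (-s))
    rw [hγ, show 0 - -s = s by ring, abs_of_pos hs] at this
    rw [dist_comm]; linarith
  have a4 : dist (γ (-s)) z ≤ L + (R + ℓ) - s + 1 := by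
    have h2 := hM z 0 (by linarith)
    rw [zero_sub] at h2
    have h3 := dist_triangle z y (γ 0)
    rw [dist_comm z y, hyz] at h3
    rw [dist_comm]; linarith
  have hA : 0 ≤ R + ℓ := dist_nonneg.trans a2
  have b3 : dist (γ (-s)) y ^ 2 ≤ (R + ℓ + s) ^ 2 := pow_le_pow_left₀ dist_nonneg a3 2
  have b4 : dist (γ (-s)) z ^ 2 ≤ (L + (R + ℓ) - s + 1) ^ 2 := pow_le_pow_left₀ dist_nonneg a4 2
  rw [hyz] at a1
  have c1 : ht γ τ ^ 2 ≤ dist (γ (-s)) τ ^ 2 := by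
    rw [dist_comm]
    exact pow_le_pow_left₀ (ht_nonneg _) (hγ.ht_le _ _) 2
  have c3 := mul_le_mul_of_nonneg_left b3 (by linarith : 0 ≤ 1 - s / L)
  have c4 := mul_le_mul_of_nonneg_left b4 hu0
  have hsL : s / L * L = s := by field_simp
  set u := s / L
  set A := R + ℓ
  have : u * s ≥ 0 := by positivity
  have e : (1 - u) * (A + s) ^ 2 + u * (L + A - s + 1) ^ 2 - u * (1 - u) * L ^ 2
      = (A + s) ^ 2 + (u * L) * (2 * (A + 1 - s)) + (u * L) ^ 2
        + u * ((1 - 2 * s) * (2 * A + 1)) := by ring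
  rw [hsL] at e
  have e2 : u * ((1 - 2 * s) * (2 * A + 1)) ≤ 2 * A + 1 := by
    have : u * (2 * A + 1) ≤ 1 * (2 * A + 1) := by gcongr
    nlinarith [mul_nonneg ‹u * s ≥ 0› (by linarith : 0 ≤ 2 * A + 1)]
  have c5 : ht γ τ ^ 2 ≤ (1 - u) * (A + s) ^ 2 + u * (L + A - s + 1) ^ 2 - u * (1 - u) * L ^ 2 := by
    linarith
  rw [e] at c5
  linarith

theorem ht_growth (hX : BruhatTits X) (hγ : Line γ) {x z : X} {l k : ℝ} (h0 : 0 ≤ l)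
    (hlk : l ≤ k) (hk : k ≤ 1) (hx : ht γ x = 0) :
    k * ht γ (pt hX x z l) ≤ l * ht γ (pt hX x z k) := by
  rcases hlk.eq_or_lt with rfl | hlk
  · exact le_rfl
  have hk0 : 0 < k := by linarith
  have i := isPt_pt_pt hX x z (a := 0) (b := k) (u := l / k) ⟨le_rfl, zero_le_one⟩ ⟨hk0.le, hk⟩
    ⟨by positivity, (div_le_one hk0).2 hlk.le⟩
  rw [pt_zero, mul_zero, zero_add, div_mul_cancel₀ _ hk0.ne'] at i
  have := hγ.ht_convex hX (by positivity) ((div_le_one hk0).2 hlk.le) i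
  rw [hx, mul_zero, zero_add, div_mul_eq_mul_div, le_div_iff₀ hk0] at this
  linarith

theorem eq_of_convex_sublinear {f : ℝ → ℝ} {R A B : ℝ} (hf : ∀ s, 0 ≤ f s)
    (hm : ∀ a b l : ℝ, 0 ≤ l → l ≤ 1 → f ((1 - l) * a + l * b) ≤ (1 - l) * f a + l * f b)
    (h0 : f 0 = R) (hneg : ∀ s ≤ 0, f s ≤ R) (hpos : ∀ s, 0 ≤ s → R ≤ f s)
    (hsub : ∀ s, 0 < s → f s ^ 2 ≤ A + s * B) (s : ℝ) : f s = R := by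
  have key : ∀ s, 0 < s → f s = R := by
    intro s hs
    by_contra hne
    have hlt : R < f s := lt_of_le_of_ne (hpos s hs.le) (Ne.symm hne)
    set δ := f s - R with hδ
    have hδ0 : 0 < δ := by linarith
    have hR : 0 ≤ R := h0 ▸ hf 0
    have grow : ∀ k : ℝ, 1 ≤ k → (k * δ) ^ 2 ≤ A + k * s * B := by
      intro k hk
      have h1 := hm 0 (k * s) (1 / k) (by positivity) (by rw [div_le_one (by linarith)]; exact hk)
      rw [mul_zero, zero_add, show 1 / k * (k * s) = s by field_simp, h0] at h1
      have h2 := mul_le_mul_of_nonneg_left h1 (by linarith : 0 ≤ k)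
      rw [show k * ((1 - 1 / k) * R + 1 / k * f (k * s)) = (k - 1) * R + f (k * s) by
        field_simp] at h2
      have h3 : k * δ ≤ f (k * s) := by rw [hδ]; linarith
      exact (pow_le_pow_left₀ (by positivity) h3 2).trans (hsub _ (by positivity))
    set k : ℝ := 1 + (|A| + s * |B|) / δ ^ 2 with hk
    have hk1 : 1 ≤ k := by rw [hk]; simp; positivity
    have h1 := grow k hk1
    have h2 : k * δ ^ 2 = δ ^ 2 + (|A| + s * |B|) := by rw [hk]; field_simp
    have h3 : k * (k * δ ^ 2) = (k * δ) ^ 2 := by ring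
    rw [← h3, h2] at h1
    have h4 : A ≤ k * |A| := by nlinarith [le_abs_self A, abs_nonneg A]
    have h5 : k * s * B ≤ k * s * |B| := by
      apply mul_le_mul_of_nonneg_left (le_abs_self B); positivity
    have h6 : 0 < k * δ ^ 2 := by positivity
    nlinarith
  rcases lt_trichotomy s 0 with h | rfl | h
  · apply le_antisymm (hneg s h.le)
    have h1 := hm s (-s) (1 / 2) (by norm_num) (by norm_num)
    rw [show (1 - 1 / 2) * s + 1 / 2 * -s = 0 by ring, h0, key (-s) (by linarith)] at h1
    linarith
  · exact h0
  · exact key s h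

theorem one_sided_bound [ProperSpace X] (hX : BruhatTits X) (hγ : Line γ) {ℓ : ℝ}
    (hper : Periodic γ ℓ) (hflat : ¬ HalfFlat γ) :
    ∃ C, ∀ z t, pr γ z ≤ t → ht γ z + (t - pr γ z) - C ≤ dist z (γ t) := by
  by_contra! hc
  apply hflat
  apply halfFlat_of_strips hX hγ
  intro N hN
  set R : ℝ := (N : ℝ) with hRN
  have hR : 0 < R := by rw [hRN]; exact_mod_cast hN
  have hℓ := hper.1
  have hseg : ∀ n : ℕ, ∃ x z l, 0 ≤ l ∧ l ≤ 1 ∧ ht γ x = 0 ∧ ht γ (pt hX x z l) = R ∧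
      0 ≤ pr γ (pt hX x z l) ∧ pr γ (pt hX x z l) < ℓ ∧ pr γ z + n ≤ ℓ ∧
      n ≤ (1 - l) * dist x z := by
    intro n
    obtain ⟨z, t, h1, h2⟩ := hc (n + R)
    exact exists_high_segment hX hγ hper hR (by positivity) h1 h2
  choose x z l h0 h1 hx hy hp hp' hz hn using hseg
  have hω : (hyperfilter ℕ : Filter ℕ) ≤ atTop := Nat.hyperfilter_le_atTop
  set D : ℕ → ℝ := fun n => dist (x n) (z n) with hDdef
  have hlD : ∀ n, R ≤ l n * D n := by
    intro n
    have := hγ.ht_lip (pt hX (x n) (z n) (l n)) (x n)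
    rw [hy, hx, dist_comm, (isPt_pt hX _ _ (h0 n) (h1 n)).dist_left (h0 n) (h1 n)] at this
    linarith
  have hD : ∀ n, 0 < D n := by
    intro n
    have h2 := hlD n
    by_contra! h
    nlinarith [h0 n]
  have hl0 : ∀ n, 0 < l n := by
    intro n
    have h2 := hlD n
    by_contra! h
    nlinarith [hD n]
  set τ : ℝ → ℕ → X := fun s n => pt hX (x n) (z n) (l n + s / D n) with hτ
  have hsub : ∀ s, 0 < s → ∀ᶠ n in atTop,
      ht γ (τ s n) ^ 2 ≤ (R + ℓ + 1) ^ 2 + s * (4 * (R + ℓ) + 2) := by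
    intro s hs
    obtain ⟨M, hM⟩ := eventually_unit_speed hX hγ hper hflat hs
    filter_upwards [eventually_ge_atTop ⌈ℓ + M⌉₊, eventually_ge_atTop ⌈s⌉₊] with n hn1 hn2
    exact ht_sq_le_of_unit_speed hX hγ (h0 n) (h1 n) (hy n) (hp n) (hp' n) (hz n) (hn n) hs hM
      ((Nat.le_ceil _).trans (by exact_mod_cast hn1)) ((Nat.le_ceil _).trans (by exact_mod_cast hn2))
  have hfwd : ∀ s, 0 ≤ s → ∀ᶠ n in atTop, l n + s / D n ≤ 1 := by
    intro s hs
    filter_upwards [eventually_ge_atTop ⌈s⌉₊] with n hn2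
    have h2 : s ≤ n := (Nat.le_ceil _).trans (by exact_mod_cast hn2)
    have h3 : s / D n ≤ 1 - l n := by
      rw [div_le_iff₀ (hD n)]; exact h2.trans (hn n)
    linarith
  have hgrow : ∀ s, 0 ≤ s → ∀ᶠ n in atTop,
      R * (l n * D n + s) ≤ (l n * D n) * ht γ (τ s n) := by
    intro s hs
    filter_upwards [hfwd s hs] with n hn1
    have h2 := ht_growth hX hγ (z := z n) (h0 n) (k := l n + s / D n)
      (by have := hD n; simp; positivity) hn1 (hx n)
    rw [hy] at h2
    have h3 := mul_le_mul_of_nonneg_right h2 (hD n).le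
    have h4 : s / D n * D n = s := div_mul_cancel₀ _ (hD n).ne'
    calc R * (l n * D n + s) = (l n + s / D n) * R * D n := by
          rw [show (l n + s / D n) * R * D n = R * (l n * D n + s / D n * D n) by ring, h4]
      _ ≤ _ := h3
      _ = _ := by ring
  have hback : ∀ B, ∀ᶠ n in atTop, B ≤ l n * D n := by
    intro B
    set Q := (R + ℓ + 1) ^ 2 + (4 * (R + ℓ) + 2) with hQ
    have hQ0 : 0 ≤ Q := by positivity
    set s := 1 + B ^ 2 * Q / R ^ 2 with hs
    have hs1 : 1 ≤ s := by rw [hs]; simp; positivity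
    filter_upwards [hsub s (by linarith), hgrow s (by linarith)] with n h2 h3
    by_contra! hB
    have ha := hlD n
    set a := l n * D n
    have h4 : R * s ≤ a * ht γ (τ s n) := by nlinarith
    have h5 : (R * s) ^ 2 ≤ (a * ht γ (τ s n)) ^ 2 := pow_le_pow_left₀ (by positivity) h4 2
    have h6 : ht γ (τ s n) ^ 2 ≤ s * Q := by rw [hQ]; nlinarith [sq_nonneg (R + ℓ + 1)]
    have h7 : a ^ 2 ≤ B ^ 2 := pow_le_pow_left₀ (by linarith) hB.le 2
    have h8 : (R * s) ^ 2 ≤ B ^ 2 * (s * Q) := by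
      rw [mul_pow a] at h5
      exact h5.trans (mul_le_mul h7 h6 (by positivity) (by positivity))
    have h9 : R ^ 2 * s = R ^ 2 + B ^ 2 * Q := by rw [hs]; field_simp
    have h10 : (R * s) ^ 2 = s * R ^ 2 + B ^ 2 * (s * Q) := by
      rw [show (R * s) ^ 2 = s * (R ^ 2 * s) by ring, h9]; ring
    have : 0 < s * R ^ 2 := by positivity
    linarith
  have hmem : ∀ s, ∀ᶠ n in atTop, 0 ≤ l n + s / D n ∧ l n + s / D n ≤ 1 := by
    intro s
    filter_upwards [hback (-s), hfwd |s| (abs_nonneg s)] with n h2 h3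
    have h4 : s / D n ≤ |s| / D n := div_le_div_of_nonneg_right (le_abs_self s) (hD n).le
    have h5 : -s / D n ≤ l n := (div_le_iff₀ (hD n)).2 h2
    rw [neg_div] at h5
    exact ⟨by linarith, by linarith⟩
  have hτd : ∀ s t, ∀ᶠ n in atTop, dist (τ s n) (τ t n) = |s - t| := by
    intro s t
    filter_upwards [hmem s, hmem t] with n h2 h3
    rw [hτ]
    simp only
    rw [dist_pt_pt hX _ _ h2.1 h2.2 h3.1 h3.2,
      show l n + s / D n - (l n + t / D n) = (s - t) / D n by ring, abs_div, abs_of_pos (hD n)]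
    exact div_mul_cancel₀ _ (hD n).ne'
  have hτ0 : ∀ n, τ 0 n = pt hX (x n) (z n) (l n) := by
    intro n; simp [hτ]
  obtain ⟨σ, hσ⟩ := exists_ulim (hyperfilter ℕ) τ (by
    intro s
    refine ⟨γ 0, |s| + (R + ℓ), ?_⟩
    filter_upwards [hω (hτd s 0)] with n h2
    rw [sub_zero] at h2
    have h3 := dist_triangle (τ 0 n) (γ (pr γ (τ 0 n))) (γ 0)
    rw [hγ, sub_zero, hτ0, abs_of_nonneg (hp n)] at h3
    have h4 : dist (pt hX (x n) (z n) (l n)) (γ (pr γ (pt hX (x n) (z n) (l n)))) = R := hy n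
    have h5 := dist_triangle (τ s n) (τ 0 n) (γ 0)
    rw [h2, hτ0] at h5
    linarith [hp' n])
  have hσl : Line σ := by
    intro s t
    refine tendsto_nhds_unique ((hσ s).dist (hσ t)) (tendsto_const_nhds.congr' ?_)
    filter_upwards [hω (hτd s t)] with n h2 using h2.symm
  have hcont : Continuous (ht γ) := by
    have : LipschitzWith 1 (ht γ) := LipschitzWith.of_dist_le_mul fun a b => by
      rw [Real.dist_eq, NNReal.coe_one, one_mul]; exact hγ.abs_ht_sub_le a b
    exact this.continuous
  have hht : ∀ s, Tendsto (fun n => ht γ (τ s n)) (hyperfilter ℕ) (nhds (ht γ (σ s))) :=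
    fun s => (hcont.tendsto _).comp (hσ s)
  refine ⟨σ, hσl, eq_of_convex_sublinear (fun s => ht_nonneg _) ?_ ?_ ?_ ?_
    (A := (R + ℓ + 1) ^ 2) (B := 4 * (R + ℓ) + 2) ?_⟩
  · intro a b k hk0 hk1
    exact hγ.ht_convex hX hk0 hk1 (hσl.isPt hX a b hk0 hk1)
  · refine tendsto_nhds_unique (hht 0) (tendsto_const_nhds.congr fun n => ?_)
    rw [hτ0, hy]
  · intro s hs
    refine le_of_tendsto (hht s) (hω ?_)
    filter_upwards [hmem s] with n h2
    have h3 : l n + s / D n ≤ l n := by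
      have := div_nonpos_of_nonpos_of_nonneg hs (hD n).le
      linarith
    have h4 := ht_growth hX hγ (z := z n) h2.1 h3 (h1 n) (hx n)
    rw [hy] at h4
    have h5 : l n * ht γ (τ s n) ≤ l n * R := h4.trans (mul_le_mul_of_nonneg_right h3 hR.le)
    exact le_of_mul_le_mul_left h5 (hl0 n)
  · intro s hs
    refine ge_of_tendsto (hht s) (hω ?_)
    filter_upwards [hgrow s hs] with n h2
    have ha : 0 < l n * D n := hR.trans_le (hlD n)
    have h3 : l n * D n * R ≤ l n * D n * ht γ (τ s n) := by nlinarith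
    exact le_of_mul_le_mul_left h3 ha
  · intro s hs
    exact le_of_tendsto ((hht s).pow 2) (hω (hsub s hs))

theorem two_sided_bound [ProperSpace X] (hX : BruhatTits X) (hγ : Line γ) {ℓ : ℝ}
    (hper : Periodic γ ℓ) (hflat : ¬ HalfFlat γ) :
    ∃ C, 1 ≤ C ∧ ∀ z t, ht γ z + |t - pr γ z| - C ≤ dist z (γ t) := by
  obtain ⟨C, hC⟩ := one_sided_bound hX hγ hper hflat
  obtain ⟨C', hC'⟩ := one_sided_bound hX hγ.neg hper.neg fun h => hflat h.of_neg
  refine ⟨max 1 (max C C'), le_max_left _ _, fun z t => ?_⟩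
  have m1 : C ≤ max 1 (max C C') := (le_max_left _ _).trans (le_max_right _ _)
  have m2 : C' ≤ max 1 (max C C') := (le_max_right _ _).trans (le_max_right _ _)
  rcases le_total (pr γ z) t with h | h
  · rw [abs_of_nonneg (by linarith)]
    linarith [hC z t h]
  · rw [abs_of_nonpos (by linarith)]
    have := hC' z (-t) (by rw [hγ.pr_neg hX]; linarith)
    rw [hγ.pr_neg hX, hγ.ht_neg hX, neg_neg] at this
    linarith

end OneSided

section Contracting

variable {X : Type*} [MetricSpace X] {γ : ℝ → X}

theorem dist_pt_line_le (hX : BruhatTits X) (hγ : Line γ) {x : X} {r q S C : ℝ} (hS : 0 < S)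
    (hC : 0 ≤ C) (hrq : |q - r| = S) (hb : S ≤ dist x (γ r))
    (hq : dist x (γ q) ≤ dist x (γ r) - S + C) :
    dist (pt hX (γ r) x (S / dist x (γ r))) (γ q) ^ 2 ≤ 2 * S * C + C ^ 2 := by
  set b := dist x (γ r) with hbd
  have hb0 : 0 < b := hS.trans_le hb
  have hu0 : 0 ≤ S / b := by positivity
  have hu1 : S / b ≤ 1 := (div_le_one hb0).2 hb
  have i := isPt_pt hX (γ r) x hu0 hu1 (γ q)
  rw [dist_comm (γ r) x, dist_comm (γ q) x, hγ.sq_dist, ← hbd, ← sq_abs (q - r), hrq] at i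
  rw [dist_comm]
  have h1 : dist x (γ q) ^ 2 ≤ (b - S + C) ^ 2 := pow_le_pow_left₀ dist_nonneg hq 2
  have h2 := mul_le_mul_of_nonneg_left h1 hu0
  have hub : S / b * b = S := by field_simp
  set u := S / b
  have e : (1 - u) * S ^ 2 + u * (b - S + C) ^ 2 - u * (1 - u) * b ^ 2
    = (1 - u) * S ^ 2 + 2 * (u * b) * (C - S) + u * (C - S) ^ 2 + (u * b) ^ 2 := by ring
  rw [hub] at e
  have h3 : u * C ^ 2 ≤ 1 * C ^ 2 := by gcongr
  have h4 : 0 ≤ u * (S * C) := by positivity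
  nlinarith

theorem ht_min_le (hX : BruhatTits X) (hγ : Line γ) {C : ℝ} (hC : 1 ≤ C)
    (hQ : ∀ z t, ht γ z + |t - pr γ z| - C ≤ dist z (γ t)) {x m : X}
    (hxm : 400 * C ≤ |pr γ x - pr γ m|)
    (hmin : ∀ l, 0 ≤ l → l ≤ 1 → ∀ n, IsPt x m l n → ht γ m ≤ ht γ n) :
    ht γ m ≤ 1400 * C := by
  set S := 200 * C with hS
  have hS0 : 0 < S := by linarith
  set r := pr γ m with hr
  set p := pr γ x with hp
  obtain ⟨r', q, h1, h2, h3, h4, h5⟩ : ∃ r' q, |r' - r| = S ∧ |q - r'| = S ∧ |q - r| = 2 * S ∧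
      |r' - p| = |p - r| - S ∧ |q - p| = |p - r| - 2 * S := by
    rcases abs_cases (p - r) with ⟨h, _⟩ | ⟨h, _⟩
    · refine ⟨r + S, r + 2 * S, ?_, ?_, ?_, ?_, ?_⟩
      · rw [abs_of_nonneg] <;> linarith
      · rw [abs_of_nonneg] <;> linarith
      · rw [abs_of_nonneg] <;> linarith
      · rw [abs_of_nonpos] <;> linarith
      · rw [abs_of_nonpos] <;> linarith
    · refine ⟨r - S, r - 2 * S, ?_, ?_, ?_, ?_, ?_⟩
      · rw [abs_of_nonpos] <;> linarith
      · rw [abs_of_nonpos] <;> linarith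
      · rw [abs_of_nonpos] <;> linarith
      · rw [abs_of_nonneg] <;> linarith
      · rw [abs_of_nonneg] <;> linarith
  have up : ∀ z t, dist z (γ t) ≤ ht γ z + |t - pr γ z| := by
    intro z t
    refine (dist_triangle z (γ (pr γ z)) (γ t)).trans_eq ?_
    rw [hγ, abs_sub_comm, ht]
  have lip : ∀ z t, |t - pr γ z| ≤ dist z (γ t) := by
    intro z t
    have := hγ.pr_lip hX (γ t) z
    rwa [hγ.pr_self hX, dist_comm] at this
  have hb := lip x r'
  have hc := lip m r'
  rw [← hp, h4] at hb
  rw [← hr, h1] at hc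
  have hQx := hQ x r'
  have hQm := hQ m r'
  have hux := up x q
  have hum := up m r'
  rw [← hp, h4] at hQx
  rw [← hp, h5] at hux
  rw [← hr, h1] at hQm hum
  have n1 := dist_pt_line_le hX hγ (C := C) hS0 (by linarith) h2 (by linarith : S ≤ dist x (γ r'))
    (by linarith)
  have n2 := dist_pt_line_le hX hγ (C := C) (q := r) hS0 (by linarith) (by rw [abs_sub_comm, h1])
    hc (by change ht γ m ≤ _; linarith)
  have hbS : S ≤ dist x (γ r') := by linarith
  set b := dist x (γ r') with hbd
  set c := dist m (γ r') with hcd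
  have hb0 : 0 < b := by linarith
  have hc0 : 0 < c := by linarith
  have f := (isPt_pt hX (γ r') x (l := S / b) (by positivity) ((div_le_one hb0).2 hbS)).fan
    (isPt_pt hX (γ r') m (l := S / c) (by positivity) ((div_le_one hc0).2 hc)) (by positivity)
    ((div_le_one hb0).2 hbS) (by positivity)
  rw [dist_comm (γ r') x, dist_comm (γ r') m, ← hbd, ← hcd] at f
  set p' := pt hX (γ r') x (S / b)
  set m' := pt hX (γ r') m (S / c)
  have k1 : dist p' (γ q) ≤ 21 * C := by
    apply abs_le_of_sq_le_sq' _ (by positivity) |>.2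
    refine n1.trans ?_
    rw [hS]; linarith [sq_nonneg C]
  have k2 : dist m' (γ r) ≤ 21 * C := by
    apply abs_le_of_sq_le_sq' _ (by positivity) |>.2
    refine n2.trans ?_
    rw [hS]; linarith [sq_nonneg C]
  have k3 : 358 * C ≤ dist p' m' := by
    have t1 := dist_triangle (γ q) p' (γ r)
    have t2 := dist_triangle p' m' (γ r)
    rw [hγ, h3, dist_comm (γ q)] at t1
    linarith
  have k4 : 3 * S ^ 2 ≤ dist p' m' ^ 2 := by
    have := pow_le_pow_left₀ (by linarith) k3 2
    rw [hS]; linarith [sq_nonneg C]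
  have e : b ^ 2 + c ^ 2 + b * c ≤ dist x m ^ 2 := by
    have e1 : S / b * b = S := by field_simp
    have e2 : S / c * c = S := by field_simp
    have e3 : (S / b) ^ 2 * b ^ 2 + (S / c) ^ 2 * c ^ 2 + S / b * (S / c) *
        (dist x m ^ 2 - b ^ 2 - c ^ 2) = 2 * S ^ 2 + S ^ 2 * ((dist x m ^ 2 - b ^ 2 - c ^ 2) / (b * c)) := by
      rw [← mul_pow, ← mul_pow, e1, e2]; field_simp; ring
    rw [e3] at f
    have : S ^ 2 * 1 ≤ S ^ 2 * ((dist x m ^ 2 - b ^ 2 - c ^ 2) / (b * c)) := by linarith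
    have := le_of_mul_le_mul_left this (by positivity)
    rw [le_div_iff₀ (by positivity)] at this
    linarith
  set s := c / (2 * b + c) with hs
  have hs0 : 0 ≤ s := by positivity
  have hs1 : s ≤ 1 := by rw [hs, div_le_one (by positivity)]; linarith
  have i := (isPt_pt hX m x hs0 hs1)
  have hn := hmin (1 - s) (by linarith) (by linarith) _ i.symm
  have j := i (γ r')
  rw [dist_comm (γ r') m, dist_comm (γ r') x, ← hcd, ← hbd, dist_comm m x] at j
  have g1 : dist (γ r') (pt hX m x s) ^ 2 ≤ c ^ 2 * (1 - s) ^ 2 + s ^ 2 * b ^ 2 - s * (1 - s) * (b * c) := by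
    have := mul_le_mul_of_nonneg_left e (mul_nonneg hs0 (by linarith : 0 ≤ 1 - s))
    linarith
  have g2 : c ^ 2 * (1 - s) ^ 2 + s ^ 2 * b ^ 2 - s * (1 - s) * (b * c) ≤ 3 / 4 * c ^ 2 := by
    have : c ^ 2 * (1 - s) ^ 2 + s ^ 2 * b ^ 2 - s * (1 - s) * (b * c)
      = 3 * b ^ 2 * c ^ 2 / (2 * b + c) ^ 2 := by
      rw [hs]; field_simp; ring
    rw [this, div_le_iff₀ (by positivity)]
    have : 3 / 4 * c ^ 2 * (2 * b + c) ^ 2 - 3 * b ^ 2 * c ^ 2 = 3 / 4 * c ^ 2 * (4 * b * c + c ^ 2) := by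
      ring
    have : 0 ≤ 3 / 4 * c ^ 2 * (4 * b * c + c ^ 2) := by positivity
    linarith
  have g3 := hγ.ht_le (pt hX m x s) r'
  rw [dist_comm] at g3
  have H0 := ht_nonneg (γ := γ) m
  have g4 : ht γ m ^ 2 ≤ 3 / 4 * (ht γ m + S) ^ 2 := by
    have a1 := pow_le_pow_left₀ H0 (hn.trans g3) 2
    have a2 := pow_le_pow_left₀ hc0.le hum 2
    linarith
  by_contra! hlt
  have h7 : 7 * S < ht γ m := by rw [hS]; linarith
  have g5 : (ht γ m + S) ^ 2 ≤ (8 / 7 * ht γ m) ^ 2 :=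
    pow_le_pow_left₀ (by linarith) (by linarith) 2
  have g6 : 0 < ht γ m ^ 2 := pow_pos (by linarith) 2
  linarith

/-- Rank one axes are strongly contracting. -/
theorem exists_contraction [ProperSpace X] (hX : BruhatTits X) (hγ : Line γ) {ℓ : ℝ}
    (hper : Periodic γ ℓ) (hflat : ¬ HalfFlat γ) :
    ∃ C, 0 ≤ C ∧ ∀ x z, |pr γ x - pr γ z| ≤ C ∨
      ht γ x + |pr γ x - pr γ z| + ht γ z - C ≤ dist x z := by
  obtain ⟨C, hC, hQ⟩ := two_sided_bound hX hγ hper hflat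
  refine ⟨2802 * C, by linarith, fun x z => ?_⟩
  obtain ⟨l, hl, hmin⟩ := isCompact_Icc.exists_isMinOn ⟨(0 : ℝ), by simp⟩
    (hγ.continuousOn_ht_pt hX x z)
  have hmin' : ∀ k ∈ Set.Icc (0 : ℝ) 1, ht γ (pt hX x z l) ≤ ht γ (pt hX x z k) :=
    fun k hk => hmin hk
  set m := pt hX x z l with hm
  rw [or_iff_not_imp_left]
  intro hlt
  rw [not_le] at hlt
  have tri := abs_sub_le (pr γ x) (pr γ m) (pr γ z)
  have uniq : ∀ x y : X, ∀ l, 0 ≤ l → l ≤ 1 → ∀ n, IsPt x y l n → n = pt hX x y l := by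
    intro x y l h0 h1 n hn
    exact (isPt_pt hX x y h0 h1).eq_of_dist (by rw [dist_comm, hn.dist_left h0 h1])
      (by rw [dist_comm, hn.dist_right h0 h1])
  have H : ht γ m ≤ 1400 * C := by
    rcases le_total (400 * C) |pr γ x - pr γ m| with h | h
    · apply ht_min_le hX hγ hC hQ h
      intro k h0 h1 n hn
      have i := isPt_pt_pt hX x z (a := 0) (b := l) (u := k) ⟨le_rfl, zero_le_one⟩ hl ⟨h0, h1⟩
      rw [pt_zero] at i
      rw [uniq _ _ _ h0 h1 n hn, ← uniq _ _ _ h0 h1 _ i]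
      apply hmin'
      constructor
      · have := mul_nonneg h0 hl.1
        linarith
      · have := mul_le_one₀ h1 hl.1 hl.2
        linarith
    · have h' : 400 * C ≤ |pr γ z - pr γ m| := by
        rw [abs_sub_comm]; linarith
      apply ht_min_le hX hγ hC hQ h'
      intro k h0 h1 n hn
      have i := isPt_pt_pt hX x z (a := 1) (b := l) (u := k) ⟨zero_le_one, le_rfl⟩ hl ⟨h0, h1⟩
      rw [pt_one] at i
      rw [uniq _ _ _ h0 h1 n hn, ← uniq _ _ _ h0 h1 _ i]
      apply hmin'
      constructor
      · have := mul_nonneg h0 hl.1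
        linarith
      · have := mul_le_mul_of_nonneg_left hl.2 h0
        linarith
  have i := isPt_pt hX x z hl.1 hl.2
  have e1 := i.dist_left hl.1 hl.2
  have e2 := i.dist_right hl.1 hl.2
  rw [← hm] at e1 e2
  have q1 := hQ x (pr γ m)
  have q2 := hQ z (pr γ m)
  have t1 := dist_triangle x m (γ (pr γ m))
  have t2 := dist_triangle z m (γ (pr γ m))
  have H' : dist m (γ (pr γ m)) ≤ 1400 * C := H
  rw [abs_sub_comm] at q1
  linarith

end Contracting

section Near

variable {X : Type*} [MetricSpace X]

/-- `p` is a nearest point to `x` in `Y`. -/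
def Near (Y : Set X) (x p : X) : Prop := p ∈ Y ∧ ∀ y ∈ Y, dist x p ≤ dist x y

/-- `Y` is `C`-strongly contracting. -/
def Contr (Y : Set X) (C : ℝ) : Prop :=
  ∀ x z p q, Near Y x p → Near Y z q → C < dist p q →
    dist x p + dist p q + dist q z ≤ dist x z + C

theorem near_self {Y : Set X} {y : X} (hy : y ∈ Y) : Near Y y y :=
  ⟨hy, fun z _ => by rw [dist_self]; exact dist_nonneg⟩

theorem Near.eq_of_mem {Y : Set X} {y p : X} (h : Near Y y p) (hy : y ∈ Y) : p = y := by
  have := h.2 y hy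
  rw [dist_self] at this
  exact (dist_eq_zero.1 (le_antisymm this dist_nonneg)).symm

theorem Contr.mem {Y : Set X} {C : ℝ} (h : Contr Y C) (hC : 0 ≤ C) {y z q : X} (hy : y ∈ Y)
    (hq : Near Y z q) : dist y q + dist q z ≤ dist y z + 2 * C := by
  rcases lt_or_ge C (dist y q) with h1 | h1
  · have := h y z y q (near_self hy) hq h1
    rw [dist_self] at this
    linarith
  · have := hq.2 y hy
    rw [dist_comm z, dist_comm z] at this
    linarith

theorem Contr.unique {Y : Set X} {C : ℝ} (h : Contr Y C) {z p q : X}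
    (hp : Near Y z p) (hq : Near Y z q) : dist p q ≤ C := by
  by_contra! h1
  have := h z z p q hp hq h1
  rw [dist_self] at this
  linarith [dist_nonneg (x := z) (y := p), dist_nonneg (x := q) (y := z)]

theorem contr_of_coarse {Y : Set X} {P : X → X} {C : ℝ} (hP : ∀ x, P x ∈ Y)
    (hc : ∀ x z, dist (P x) (P z) ≤ C ∨
      dist x (P x) + dist (P x) (P z) + dist (P z) z ≤ dist x z + C)
    (hy : ∀ y ∈ Y, dist y (P y) ≤ C) : Contr Y (5 * C) := by
  have key : ∀ x p, Near Y x p → dist p (P x) ≤ 2 * C := by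
    intro x p hp
    have h1 := hy p hp.1
    have h2 := hp.2 _ (hP x)
    have h3 : dist (P x) (P p) ≤ C := by
      rcases hc x p with h | h
      · exact h
      · rw [dist_comm (P p) p] at h
        linarith [dist_nonneg (x := p) (y := P p)]
    have h4 := dist_triangle_right p (P x) (P p)
    linarith
  intro x z p q hp hq hlt
  have h1 := key x p hp
  have h2 := key z q hq
  have h3 := dist_triangle p (P x) q
  have h4 := dist_triangle_right (P x) q (P z)
  have h5 := hp.2 _ (hP x)
  have h6 := hq.2 _ (hP z)
  rw [dist_comm q z]
  rcases hc x z with h | h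
  · linarith
  · rw [dist_comm (P z) z] at h
    linarith

end Near

section Orbits

variable {G X : Type*} [Group G] [MetricSpace X] [MulAction G X] {o : X}

theorem dist_inv_smul (hIso : IsometricAction G X) (f : G) (x y : X) :
    dist (f⁻¹ • x) y = dist x (f • y) := by
  rw [← hIso f, smul_inv_smul]

theorem finite_ball [ProperSpace X] (hPD : ProperlyDiscontinuousAction G X) (o : X) (r : ℝ) :
    {g : G | dist o (g • o) ≤ r}.Finite := by
  refine (hPD _ (isCompact_closedBall o r)).subset fun g hg => ?_
  have hr : 0 ≤ r := dist_nonneg.trans hg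
  exact ⟨g • o, ⟨o, mem_closedBall_self hr, rfl⟩, by rw [mem_closedBall, dist_comm]; exact hg⟩

theorem exists_near (hfin : ∀ r, {g : G | dist o (g • o) ≤ r}.Finite)
    {Y : Set X} (hY : Y ⊆ Set.range fun g : G => g • o) (hne : Y.Nonempty) (x : X) :
    ∃ p, Near Y x p := by
  obtain ⟨y, hy⟩ := hne
  have hf : (Y ∩ closedBall x (dist x y)).Finite := by
    refine ((hfin (dist o x + dist x y)).image fun g => g • o).subset ?_
    rintro w ⟨hw, hw'⟩
    obtain ⟨g, rfl⟩ := hY hw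
    refine ⟨g, ?_, rfl⟩
    rw [mem_closedBall, dist_comm] at hw'
    exact (dist_triangle _ _ _).trans (by gcongr)
  obtain ⟨p, hp, hmin⟩ := Set.exists_min_image _ (fun w => dist x w) hf
    ⟨y, hy, by rw [mem_closedBall, dist_comm]⟩
  refine ⟨p, hp.1, fun w hw => ?_⟩
  rcases le_total (dist x w) (dist x y) with h | h
  · exact hmin w ⟨hw, by rw [mem_closedBall, dist_comm]; exact h⟩
  · exact (hmin y ⟨hy, by rw [mem_closedBall, dist_comm]⟩).trans h

theorem Near.smul (hIso : IsometricAction G X) {Y : Set X} {x p : X} (h : Near Y x p) {f : G}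
    (hf : ∀ y, f • y ∈ Y ↔ y ∈ Y) : Near Y (f • x) (f • p) := by
  refine ⟨(hf p).2 h.1, fun y hy => ?_⟩
  rw [hIso]
  have := h.2 (f⁻¹ • y) ((hf _).1 (by rwa [smul_inv_smul]))
  rwa [dist_comm x (f⁻¹ • y), dist_inv_smul hIso, dist_comm y] at this

theorem mem_zOrbit (g : G) (i : ℤ) : g ^ i • o ∈ zOrbit o g := ⟨i, rfl⟩

theorem self_mem_zOrbit (g : G) : o ∈ zOrbit o g := ⟨0, by simp⟩

theorem zOrbit_subset (g : G) : zOrbit o g ⊆ Set.range fun f : G => f • o := by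
  rintro _ ⟨i, rfl⟩
  exact ⟨g ^ i, rfl⟩

theorem zpow_smul_mem_zOrbit (g : G) (i : ℤ) (y : X) :
    g ^ i • y ∈ zOrbit o g ↔ y ∈ zOrbit o g := by
  constructor
  · rintro ⟨j, hj⟩
    refine ⟨-i + j, ?_⟩
    simp only at hj ⊢
    rw [zpow_add, mul_smul, hj, zpow_neg, inv_smul_smul]
  · rintro ⟨j, rfl⟩
    exact ⟨i + j, by simp only; rw [zpow_add, mul_smul]⟩

theorem Near.zpow_smul (hIso : IsometricAction G X) {g : G} {x p : X}
    (h : Near (zOrbit o g) x p) (i : ℤ) : Near (zOrbit o g) (g ^ i • x) (g ^ i • p) :=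
  h.smul hIso (zpow_smul_mem_zOrbit g i)

/-- The orbit of `o` under `⟨g⟩` is contracting, and it is a rough geodesic line on which `g` acts
with translation length `ℓ`. -/
structure Axial (o : X) (g : G) (C ℓ D : ℝ) : Prop where
  C_nonneg : 0 ≤ C
  contr : Contr (zOrbit o g) C
  ℓ_pos : 0 < ℓ
  le_dist : ∀ i j : ℤ, ℓ * |(i : ℝ) - j| - D ≤ dist (g ^ i • o) (g ^ j • o)
  dist_le : ∀ i j : ℤ, dist (g ^ i • o) (g ^ j • o) ≤ ℓ * |(i : ℝ) - j| + D

theorem Axial.le_dist' {g : G} {C ℓ D : ℝ} (h : Axial o g C ℓ D) (i : ℤ) :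
    ℓ * |(i : ℝ)| - D ≤ dist o (g ^ i • o) := by
  have := h.le_dist 0 i
  rwa [zpow_zero, one_smul, Int.cast_zero, zero_sub, abs_neg] at this

theorem Axial.dist_le' {g : G} {C ℓ D : ℝ} (h : Axial o g C ℓ D) (i : ℤ) :
    dist o (g ^ i • o) ≤ ℓ * |(i : ℝ)| + D := by
  have := h.dist_le 0 i
  rwa [zpow_zero, one_smul, Int.cast_zero, zero_sub, abs_neg] at this

theorem Axial.D_nonneg {g : G} {C ℓ D : ℝ} (h : Axial o g C ℓ D) : 0 ≤ D := by
  have := h.dist_le 0 0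
  simpa using this

theorem Axial.zpow_ne_one {g : G} {C ℓ D : ℝ} (h : Axial o g C ℓ D) {k : ℤ} (hk : k ≠ 0) :
    g ^ k ≠ 1 := by
  intro h1
  obtain ⟨n, hn⟩ := exists_nat_gt (D / ℓ)
  rw [div_lt_iff₀ h.ℓ_pos] at hn
  have h2 := h.le_dist' (k * n)
  rw [zpow_mul, h1, one_zpow, one_smul, dist_self] at h2
  push_cast at h2
  have h3 : (1 : ℝ) ≤ |(k : ℝ)| := by exact_mod_cast Int.one_le_abs hk
  rw [abs_mul, Nat.abs_cast] at h2
  have h4 : (n : ℝ) ≤ |(k : ℝ)| * n := le_mul_of_one_le_left (by positivity) h3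
  nlinarith [h.ℓ_pos]

theorem exists_axial [ProperSpace X] (hIso : IsometricAction G X) (hX : BruhatTits X) {g : G}
    (hg : Rank1Isometry X g) (o : X) : ∃ C ℓ D, Axial o g C ℓ D := by
  obtain ⟨ℓ, ⟨hℓ, -, -⟩, γ, hγ, hgγ, hflat⟩ := hg
  have hγ : Line γ := hγ
  have hpow : ∀ (k : ℤ) (t : ℝ), g ^ k • γ t = γ (t + k * ℓ) := by
    intro k
    induction k with
    | zero => intro t; simp
    | succ k ih =>
      intro t
      rw [zpow_add_one, mul_smul, hgγ, ih]
      push_cast; congr 1; ring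
    | pred k ih =>
      intro t
      have h1 : g⁻¹ • γ t = γ (t - ℓ) := by rw [inv_smul_eq_iff, hgγ, sub_add_cancel]
      rw [zpow_sub_one, mul_smul, h1, ih]
      push_cast; congr 1; ring
  have hper : Periodic γ ℓ := ⟨hℓ, fun k => ⟨fun x => g ^ k • x, hIso _, hpow k⟩⟩
  obtain ⟨C, hC, hcon⟩ := exists_contraction hX hγ hper hflat
  set D₀ := dist o (γ 0) with hD₀
  have hD : 0 ≤ D₀ := dist_nonneg
  have hdo : ∀ k : ℤ, dist (g ^ k • o) (γ (k * ℓ)) = D₀ := by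
    intro k
    rw [show γ (k * ℓ) = g ^ k • γ 0 by rw [hpow, zero_add], hIso]
  have hdd : ∀ i j : ℤ, dist (γ (i * ℓ)) (γ (j * ℓ)) = ℓ * |(i : ℝ) - j| := by
    intro i j
    rw [hγ, ← sub_mul, abs_mul, abs_of_pos hℓ, mul_comm]
  set P : X → X := fun x => g ^ ⌊pr γ x / ℓ⌋ • o with hP
  have hPd : ∀ x, dist (P x) (γ (pr γ x)) ≤ D₀ + ℓ := by
    intro x
    have h1 := Int.floor_le (pr γ x / ℓ)
    have h2 := Int.lt_floor_add_one (pr γ x / ℓ)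
    rw [le_div_iff₀ hℓ] at h1
    rw [div_lt_iff₀ hℓ] at h2
    have h3 := dist_triangle (P x) (γ (⌊pr γ x / ℓ⌋ * ℓ)) (γ (pr γ x))
    rw [hP] at h3 ⊢
    simp only at h3 ⊢
    rw [hdo, hγ, abs_sub_comm, abs_of_nonneg (by linarith)] at h3
    linarith
  have hho := ht_nonneg (γ := γ) o
  have hcontr := contr_of_coarse (Y := zOrbit o g) (P := P) (C := C + 4 * (D₀ + ℓ) + ht γ o)
    (fun x => mem_zOrbit g _) (by
      intro x z
      have h1 := hPd x
      have h2 := hPd z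
      have h3 := dist_triangle (P x) (γ (pr γ x)) (P z)
      have h4 := dist_triangle_right (γ (pr γ x)) (P z) (γ (pr γ z))
      rw [hγ] at h4
      rcases hcon x z with h | h
      · left; linarith
      · right
        have h5 := dist_triangle_right x (P x) (γ (pr γ x))
        have h6 := dist_triangle_right z (P z) (γ (pr γ z))
        rw [dist_comm (P z) z]
        change dist x (P x) ≤ ht γ x + _ at h5
        change dist z (P z) ≤ ht γ z + _ at h6
        linarith) (by
      rintro _ ⟨i, rfl⟩
      have h1 := hPd (g ^ i • o)
      have h2 := dist_triangle_right (g ^ i • o) (P (g ^ i • o)) (γ (pr γ (g ^ i • o)))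
      have h3 : dist (g ^ i • o) (γ (pr γ (g ^ i • o))) = ht γ o :=
        hγ.ht_map hX (hIso (g ^ i)) (hpow i) o
      simp only
      linarith)
  refine ⟨_, ℓ, 2 * D₀, by positivity, hcontr, hℓ, fun i j => ?_, fun i j => ?_⟩
  · have h1 := dist_triangle4 (γ (i * ℓ)) (g ^ i • o) (g ^ j • o) (γ (j * ℓ))
    rw [hdd, hdo, dist_comm (γ _), hdo] at h1
    linarith
  · have h1 := dist_triangle4 (g ^ i • o) (γ (i * ℓ)) (γ (j * ℓ)) (g ^ j • o)
    rw [hdd, hdo, dist_comm (γ _) (g ^ j • o), hdo] at h1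
    linarith

/-- `f` commensurates `⟨g⟩`. -/
def Comm (g f : G) : Prop := ∃ k l : ℤ, k ≠ 0 ∧ l ≠ 0 ∧ f * g ^ k * f⁻¹ = g ^ l

theorem zpow_of_conj {g f : G} {k l : ℤ} (h : f * g ^ k * f⁻¹ = g ^ l) (n : ℤ) :
    f * g ^ (k * n) * f⁻¹ = g ^ (l * n) := by
  rw [zpow_mul, zpow_mul, ← h, conj_zpow]

theorem Axial.conj_bound (hIso : IsometricAction G X) {g : G} {C ℓ D : ℝ} (h : Axial o g C ℓ D)
    {f : G} {k l : ℤ} (hl : l ≠ 0) (hf : f * g ^ k * f⁻¹ = g ^ l) {q : X}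
    (hq : Near (zOrbit o g) (f • o) q) {n : ℕ} (hn : C + D < ℓ * n) :
    2 * dist (f • o) q + ℓ * n * |(l : ℝ)| ≤ ℓ * n * |(k : ℝ)| + C + 2 * D := by
  obtain ⟨j, rfl⟩ := hq.1
  simp only at hq ⊢
  have h1 := hq.zpow_smul hIso (l * n)
  have h3 : (1 : ℝ) ≤ |(l : ℝ)| := by exact_mod_cast Int.one_le_abs hl
  have e1 : g ^ (l * (n : ℤ)) • f • o = f • g ^ (k * (n : ℤ)) • o := by
    rw [smul_smul, smul_smul, ← zpow_of_conj hf]; group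
  have d1 : dist (g ^ j • o) (g ^ (l * (n : ℤ)) • g ^ j • o) = dist o (g ^ (l * (n : ℤ)) • o) := by
    rw [smul_smul, ← zpow_add, add_comm, zpow_add, mul_smul, hIso]
  have d2 := h.le_dist' (l * n)
  have d3 := h.dist_le' (k * n)
  push_cast at d2 d3
  rw [abs_mul, Nat.abs_cast] at d2 d3
  have h4 : ℓ * n ≤ ℓ * (|(l : ℝ)| * n) := by
    have := h.ℓ_pos
    apply mul_le_mul_of_nonneg_left _ this.le
    exact le_mul_of_one_le_left (by positivity) h3
  have c := h.contr _ _ _ _ hq h1 (by rw [d1]; linarith)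
  rw [d1, dist_comm (g ^ (l * (n : ℤ)) • g ^ j • o), hIso, e1, hIso] at c
  linarith

theorem Comm.dist_le (hIso : IsometricAction G X)
    (hfin : ∀ r, {g : G | dist o (g • o) ≤ r}.Finite) {g : G} {C ℓ D : ℝ}
    (h : Axial o g C ℓ D) {f : G} (hf : Comm g f) :
    ∃ j : ℤ, dist (f • o) (g ^ j • o) ≤ C + 2 * D := by
  obtain ⟨k, l, hk, hl, hf⟩ := hf
  have hf' : f⁻¹ * g ^ l * f⁻¹⁻¹ = g ^ k := by rw [← hf]; group
  have near := exists_near hfin (zOrbit_subset g) ⟨o, self_mem_zOrbit g⟩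
  obtain ⟨q, hq⟩ := near (f • o)
  obtain ⟨q', hq'⟩ := near (f⁻¹ • o)
  obtain ⟨j, rfl⟩ := id hq.1
  obtain ⟨n, hn⟩ := exists_nat_gt ((2 * C + 3 * D) / ℓ)
  rw [div_lt_iff₀ h.ℓ_pos, mul_comm] at hn
  have hD := h.D_nonneg
  have hC := h.C_nonneg
  have b1 := h.conj_bound hIso hl hf hq (n := n) (by linarith)
  have b2 := h.conj_bound hIso hk hf' hq' (n := n) (by linarith)
  have hkl : |k| ≤ |l| := by
    by_contra! hlt
    have : (|l| : ℝ) + 1 ≤ |(k : ℝ)| := by exact_mod_cast hlt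
    have h5 : ℓ * n * (|(l : ℝ)| + 1) ≤ ℓ * n * |(k : ℝ)| :=
      mul_le_mul_of_nonneg_left this (mul_nonneg h.ℓ_pos.le n.cast_nonneg)
    linarith [dist_nonneg (x := f⁻¹ • o) (y := q')]
  have hkl' : |(k : ℝ)| ≤ |(l : ℝ)| := by exact_mod_cast hkl
  have h5 : ℓ * n * |(k : ℝ)| ≤ ℓ * n * |(l : ℝ)| :=
    mul_le_mul_of_nonneg_left hkl' (mul_nonneg h.ℓ_pos.le n.cast_nonneg)
  exact ⟨j, by simp only at b1; linarith⟩

/-- The projection of a translate of the axis by an element not commensurating `⟨g⟩` is bounded. -/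
theorem Axial.exists_proj_bound (hIso : IsometricAction G X)
    (hfin : ∀ r, {g : G | dist o (g • o) ≤ r}.Finite) {g : G} {C ℓ D : ℝ}
    (h : Axial o g C ℓ D) {f : G} (hf : ¬ Comm g f) :
    ∃ B, ∀ y ∈ zOrbit o g, ∀ p, Near (zOrbit o g) (f • y) p → dist p o ≤ B := by
  have near := exists_near hfin (zOrbit_subset g) ⟨o, self_mem_zOrbit g⟩
  obtain ⟨q, hq⟩ := near (f • o)
  obtain ⟨j₀, rfl⟩ := id hq.1
  simp only at hq
  set F := (hfin (C * 5 + 3 * D)).toFinset with hF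
  have hD := h.D_nonneg
  have hC := h.C_nonneg
  have hℓ := h.ℓ_pos
  refine ⟨dist (g ^ j₀ • o) o + C + (ℓ * F.card + D), ?_⟩
  rintro _ ⟨m, rfl⟩ p hp
  obtain ⟨j, rfl⟩ := id hp.1
  simp only at hp ⊢
  have tri := dist_triangle_left (g ^ j • o) o (g ^ j₀ • o)
  rcases le_or_gt (dist (g ^ j₀ • o) (g ^ j • o)) C with hle | hgt
  · have : 0 ≤ ℓ * F.card := by positivity
    linarith
  have c := h.contr _ _ _ _ hq hp hgt
  rw [hIso] at c
  suffices hcard : |j₀ - j| ≤ F.card by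
    have h1 := h.dist_le j₀ j
    have h2 : |(j₀ : ℝ) - j| ≤ F.card := by exact_mod_cast hcard
    have h3 : ℓ * |(j₀ : ℝ) - j| ≤ ℓ * F.card := by gcongr
    linarith
  by_contra! hcard
  have key : ∀ k : ℤ, k ∈ Finset.Icc (min j₀ j) (max j₀ j) → ∃ i : ℤ, g ^ (-k) * f * g ^ i ∈ F := by
    intro k hk
    have hk' : |(j₀ : ℝ) - k| + |(k : ℝ) - j| = |(j₀ : ℝ) - j| := by
      rw [Finset.mem_Icc] at hk
      have : |j₀ - k| + |k - j| = |j₀ - j| := by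
        rcases le_total j₀ j with hj | hj
        · rw [min_eq_left hj, max_eq_right hj] at hk
          rw [abs_of_nonpos, abs_of_nonpos, abs_of_nonpos] <;> omega
        · rw [min_eq_right hj, max_eq_left hj] at hk
          rw [abs_of_nonneg, abs_of_nonneg, abs_of_nonneg] <;> omega
      exact_mod_cast this
    obtain ⟨r, hr⟩ := near (f⁻¹ • g ^ k • o)
    obtain ⟨i, rfl⟩ := id hr.1
    simp only at hr
    have a1 := h.contr.mem hC (self_mem_zOrbit g) hr
    have a2 := h.contr.mem hC (mem_zOrbit g m) hr
    rw [dist_comm o (f⁻¹ • _), dist_inv_smul hIso] at a1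
    rw [dist_comm (g ^ m • o) (f⁻¹ • _), dist_inv_smul hIso] at a2
    have t1 := dist_triangle (g ^ k • o) (g ^ j₀ • o) (f • o)
    have t2 := dist_triangle (g ^ k • o) (g ^ j • o) (f • g ^ m • o)
    have t3 := dist_triangle_right o (g ^ m • o) (g ^ i • o)
    have u1 := h.dist_le j₀ k
    have u2 := h.dist_le k j
    have u3 := h.le_dist j₀ j
    rw [dist_comm (g ^ k • o) (g ^ j₀ • o), dist_comm (g ^ j₀ • o) (f • o)] at t1
    rw [← mul_right_inj' hℓ.ne'] at hk'
    have e : dist (g ^ i • o) (f⁻¹ • g ^ k • o) ≤ C * 5 + 3 * D := by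
      linarith [dist_nonneg (x := g ^ i • o) (y := f⁻¹ • g ^ k • o)]
    refine ⟨i, ?_⟩
    rw [hF, Set.Finite.mem_toFinset, Set.mem_ofPred_eq, mul_smul, mul_smul, zpow_neg,
      dist_comm, dist_inv_smul hIso]
    rwa [dist_comm, dist_inv_smul hIso, dist_comm] at e
  choose! i hi using key
  obtain ⟨k, hk, k', hk', hne, heq⟩ := Finset.exists_ne_map_eq_of_card_lt_of_maps_to
    (s := Finset.Icc (min j₀ j) (max j₀ j)) (t := F) (f := fun k => g ^ (-k) * f * g ^ (i k)) (by
      rw [Int.card_Icc]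
      have : max j₀ j - min j₀ j = |j₀ - j| := by
        rw [max_sub_min_eq_abs, abs_sub_comm]
      omega) (fun k hk => hi k hk)
  have e1 : f * g ^ (i k - i k') * f⁻¹ = g ^ (k - k') := by
    have : f * g ^ i k = g ^ k * (g ^ (-k') * f * g ^ (i k')) := by rw [← heq]; group
    rw [zpow_sub, ← mul_assoc, this]; group
  apply hf
  refine ⟨i k - i k', k - k', fun h0 => ?_, sub_ne_zero.2 hne, e1⟩
  rw [h0, zpow_zero, mul_one, mul_inv_cancel] at e1
  exact h.zpow_ne_one (sub_ne_zero.2 hne) e1.symm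

/-- An infinite set of elements commensurating `⟨g⟩` has two elements differing by a power. -/
theorem exists_mul_inv_eq_zpow (hIso : IsometricAction G X)
    (hfin : ∀ r, {g : G | dist o (g • o) ≤ r}.Finite) {g : G} {C ℓ D : ℝ}
    (h : Axial o g C ℓ D) {ι : Type*} [Infinite ι] (a : ι → G) (ha : ∀ i, Comm g (a i)) :
    ∃ i j, i ≠ j ∧ ∃ k : ℤ, a i * (a j)⁻¹ = g ^ k := by
  choose n hn using fun i => (ha i).dist_le hIso hfin h
  have hmem : ∀ i, g ^ (-n i) * a i ∈ {g : G | dist o (g • o) ≤ C + 2 * D} := by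
    intro i
    rw [Set.mem_ofPred_eq, mul_smul, zpow_neg, dist_comm, dist_inv_smul hIso]
    exact hn i
  have := (hfin (C + 2 * D)).to_subtype
  obtain ⟨i, j, hij, he⟩ := Finite.exists_ne_map_eq_of_infinite
    (fun i => (⟨g ^ (-n i) * a i, hmem i⟩ : {g : G | dist o (g • o) ≤ C + 2 * D}))
  refine ⟨i, j, hij, n i - n j, ?_⟩
  have he : g ^ (-n i) * a i = g ^ (-n j) * a j := congrArg Subtype.val he
  have : a i = g ^ (n i) * (g ^ (-n j) * a j) := by rw [← he]; group
  rw [this]; group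

theorem exists_not_comm (hIso : IsometricAction G X)
    (hfin : ∀ r, {g : G | dist o (g • o) ≤ r}.Finite) {g : G} {C ℓ D : ℝ}
    (h : Axial o g C ℓ D) (hNE : NonElementary G) (Γ : Subgroup G) (hΓ : Γ.Normal)
    (hinf : (Γ : Set G).Infinite) : ∃ f ∈ Γ, ¬ Comm g f := by
  by_contra! hc
  have : Infinite Γ := hinf.to_subtype
  obtain ⟨a, b, hab, k, hk⟩ := exists_mul_inv_eq_zpow hIso hfin h (fun f : Γ => (f : G))
    fun f => hc f f.2
  have hk0 : k ≠ 0 := by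
    rintro rfl
    rw [zpow_zero, mul_inv_eq_one] at hk
    exact hab (Subtype.ext hk)
  have hkΓ : g ^ k ∈ Γ := hk ▸ Γ.mul_mem a.2 (Γ.inv_mem b.2)
  have hall : ∀ x : G, Comm g x := by
    intro x
    have ht : x * g ^ k * x⁻¹ ∈ Γ := hΓ.conj_mem _ hkΓ x
    obtain ⟨m, n, hmn, l, hl⟩ := exists_mul_inv_eq_zpow hIso hfin h
      (fun n : ℤ => (x * g ^ k * x⁻¹) ^ n) fun n => hc _ (Γ.zpow_mem ht n)
    have e : x * g ^ (k * (m - n)) * x⁻¹ = g ^ l := by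
      rw [← hl, ← zpow_neg, ← zpow_add, conj_zpow, ← zpow_mul, sub_eq_add_neg]
    have hne : k * (m - n) ≠ 0 := mul_ne_zero hk0 (sub_ne_zero.2 hmn)
    refine ⟨_, l, hne, ?_, e⟩
    rintro rfl
    rw [zpow_zero, conj_eq_one_iff] at e
    exact h.zpow_ne_one hne e
  have hfinite : Finite (G ⧸ Subgroup.zpowers g) := by
    have := (hfin (C + 2 * D)).to_subtype
    refine Finite.of_surjective
      (fun b : {g : G | dist o (g • o) ≤ C + 2 * D} => (QuotientGroup.mk ((b : G)⁻¹) :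
        G ⧸ Subgroup.zpowers g)) ?_
    intro q
    obtain ⟨x, rfl⟩ := QuotientGroup.mk_surjective q
    obtain ⟨j, hj⟩ := (hall x⁻¹).dist_le hIso hfin h
    refine ⟨⟨g ^ (-j) * x⁻¹, ?_⟩, ?_⟩
    · rw [Set.mem_ofPred_eq, mul_smul, zpow_neg, dist_comm, dist_inv_smul hIso]
      exact hj
    · rw [QuotientGroup.eq]
      exact ⟨-j, by simp⟩
  exact Subgroup.index_ne_zero_of_finite (hNE g)

end Orbits

section Chains

variable {X : Type*} [MetricSpace X]

/-- A bi-infinite chain of contracting sets, where `pr i` is the projection to the `i`-th set, which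
is entered near `e i` and left near `s i`. -/
structure Chain (pr : ℤ → X → X) (s e : ℤ → X) (C K W : ℝ) : Prop where
  C_nonneg : 0 ≤ C
  K_nonneg : 0 ≤ K
  contr : ∀ i x z, C < dist (pr i x) (pr i z) →
    dist x (pr i x) + dist (pr i x) (pr i z) + dist (pr i z) z ≤ dist x z + C
  behrstock : ∀ i x, dist (pr i x) (s i) ≤ K ∨ dist (pr (i + 1) x) (e (i + 1)) ≤ K
  next : ∀ i, dist (pr (i + 1) (s i)) (e (i + 1)) ≤ K
  prev : ∀ i, dist (pr i (e (i + 1))) (s i) ≤ K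
  fix : ∀ i, pr i (s i) = s i
  long : ∀ i, 3 * K + C + 1 ≤ dist (e i) (s i)
  le_W : ∀ i, dist (e i) (s i) ≤ W
  le_W' : ∀ i, dist (s i) (e (i + 1)) ≤ W

namespace Chain

variable {pr : ℤ → X → X} {s e : ℤ → X} {C K W : ℝ}

theorem not_left (h : Chain pr s e C K W) {i : ℤ} {x : X} (hR : dist (pr i x) (s i) ≤ K) :
    ¬ dist (pr i x) (e i) ≤ K := fun hL => by
  have := dist_triangle_left (e i) (s i) (pr i x)
  linarith [h.long i, h.C_nonneg, h.K_nonneg]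

theorem right_mono (h : Chain pr s e C K W) {x : X} {i j : ℤ} (hij : j ≤ i)
    (hR : dist (pr i x) (s i) ≤ K) : dist (pr j x) (s j) ≤ K := by
  induction j, hij using Int.leInductionDown with
  | base => exact hR
  | pred n _ ih =>
    rcases h.behrstock (n - 1) x with h1 | h1
    · exact h1
    · rw [sub_add_cancel] at h1
      exact absurd h1 (h.not_left ih)

theorem left_mono (h : Chain pr s e C K W) {x : X} {i j : ℤ} (hij : i ≤ j)
    (hL : dist (pr i x) (e i) ≤ K) : dist (pr j x) (e j) ≤ K := by
  induction j, hij using Int.leInduction with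
  | base => exact hL
  | succ n _ ih =>
    rcases h.behrstock n x with h1 | h1
    · exact absurd ih (h.not_left h1)
    · exact h1

theorem through (h : Chain pr s e C K W) {x z : X} {i : ℤ} (hL : dist (pr i x) (e i) ≤ K)
    (hR : dist (pr i z) (s i) ≤ K) :
    dist x (e i) + dist (e i) (s i) + dist (s i) z ≤ dist x z + (4 * K + C) := by
  have t1 := dist_triangle4 (e i) (pr i x) (pr i z) (s i)
  rw [dist_comm (e i) (pr i x)] at t1
  have t2 := dist_triangle x (pr i x) (e i)
  have t3 := dist_triangle_left (s i) z (pr i z)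
  have := h.contr i x z (by linarith [h.long i, h.K_nonneg])
  linarith

theorem dist_succ_le (h : Chain pr s e C K W) (i : ℤ) : dist (s i) (s (i + 1)) ≤ 2 * W := by
  have := dist_triangle (s i) (e (i + 1)) (s (i + 1))
  linarith [h.le_W (i + 1), h.le_W' i]

theorem right_descent (h : Chain pr s e C K W) {x : X} {i : ℤ}
    (hR : dist (pr (i + 1) x) (s (i + 1)) ≤ K) :
    dist x (s (i + 1)) + 1 ≤ dist x (s i) := by
  have c := h.next i
  have t1 := dist_triangle4 (e (i + 1)) (pr (i + 1) (s i)) (pr (i + 1) x) (s (i + 1))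
  rw [dist_comm (e (i + 1)) (pr _ _), dist_comm (pr (i + 1) (s i)) (pr _ _)] at t1
  have hl := h.long (i + 1)
  have c := h.contr (i + 1) x (s i) (by linarith [h.K_nonneg])
  have t2 := dist_triangle x (pr (i + 1) x) (s (i + 1))
  linarith [dist_nonneg (x := pr (i + 1) (s i)) (y := s i)]

theorem left_descent (h : Chain pr s e C K W) {x : X} {i : ℤ} (hL : dist (pr i x) (e i) ≤ K) :
    dist x (e i) + 1 ≤ dist x (e (i + 1)) := by
  have c := h.prev i
  have t1 := dist_triangle4 (e i) (pr i x) (pr i (e (i + 1))) (s i)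
  rw [dist_comm (e i) (pr i x)] at t1
  have hl := h.long i
  have c := h.contr i x (e (i + 1)) (by linarith [h.K_nonneg])
  have t2 := dist_triangle x (pr i x) (e i)
  linarith [dist_nonneg (x := pr i (e (i + 1))) (y := e (i + 1))]

theorem right_dist (h : Chain pr s e C K W) {x : X} {i : ℤ} (n : ℕ)
    (hR : dist (pr (i + n) x) (s (i + n)) ≤ K) : dist x (s (i + n)) + n ≤ dist x (s i) := by
  induction n with
  | zero => simp
  | succ n ih =>
    push_cast at hR ⊢
    rw [← add_assoc i] at hR ⊢
    have := ih (h.right_mono (by omega) hR)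
    linarith [h.right_descent hR]

theorem left_dist (h : Chain pr s e C K W) {x : X} {i : ℤ} (n : ℕ)
    (hL : dist (pr (i - n) x) (e (i - n)) ≤ K) : dist x (e (i - n)) + n ≤ dist x (e i) := by
  induction n with
  | zero => simp
  | succ n ih =>
    push_cast at hL ⊢
    have e1 : i - ((n : ℤ) + 1) + 1 = i - n := by ring
    have := ih (h.left_mono (by omega) hL)
    have d := h.left_descent hL
    rw [e1] at d
    linarith

theorem exists_threshold (h : Chain pr s e C K W) (x : X) :
    ∃ t : ℤ, dist (pr (t - 1) x) (s (t - 1)) ≤ K ∧ ¬ dist (pr t x) (s t) ≤ K := by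
  obtain ⟨n, hn⟩ := exists_nat_gt (dist x (s 0))
  obtain ⟨m, hm⟩ := exists_nat_gt (dist x (e 0))
  have h1 : ¬ dist (pr n x) (s n) ≤ K := fun hR => by
    have := h.right_dist (x := x) (i := 0) n (by rwa [zero_add])
    linarith [dist_nonneg (x := x) (y := s (0 + n))]
  have h2 : ¬ dist (pr (-m) x) (e (-m)) ≤ K := fun hL => by
    have := h.left_dist (x := x) (i := 0) m (by rwa [zero_sub])
    linarith [dist_nonneg (x := x) (y := e (0 - m))]
  have h3 : dist (pr (-m - 1) x) (s (-m - 1)) ≤ K := by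
    rcases h.behrstock (-m - 1) x with h3 | h3
    · exact h3
    · rw [sub_add_cancel] at h3
      exact absurd h3 h2
  obtain ⟨t, ht, hmin⟩ := Int.exists_least_of_bdd (P := fun i => ¬ dist (pr i x) (s i) ≤ K)
    ⟨-m - 1, fun z hz => by
      by_contra! hlt
      exact hz (h.right_mono hlt.le h3)⟩ ⟨n, h1⟩
  refine ⟨t, ?_, ht⟩
  by_contra hc
  have := hmin _ hc
  omega

theorem exists_coarse_proj (h : Chain pr s e C K W) : ∃ P : X → X, ∃ C', (∀ x, ∃ j, P x = s j) ∧
    (∀ x z, dist (P x) (P z) ≤ C' ∨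
      dist x (P x) + dist (P x) (P z) + dist (P z) z ≤ dist x z + C') ∧
    ∀ j, dist (s j) (P (s j)) ≤ C' := by
  choose t ht1 ht2 using h.exists_threshold
  have ht3 : ∀ x, dist (pr (t x + 1) x) (e (t x + 1)) ≤ K := fun x =>
    (h.behrstock (t x) x).resolve_left (ht2 x)
  have hC := h.C_nonneg
  have hK := h.K_nonneg
  have hW : 0 ≤ W := dist_nonneg.trans (h.le_W 0)
  refine ⟨fun x => s (t x), 8 * W + 2 * (4 * K + C), fun x => ⟨_, rfl⟩, ?_, ?_⟩
  · have key : ∀ x z, t x ≤ t z → dist (s (t x)) (s (t z)) ≤ 8 * W + 2 * (4 * K + C) ∨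
        dist x (s (t x)) + dist (s (t x)) (s (t z)) + dist (s (t z)) z ≤
          dist x z + (8 * W + 2 * (4 * K + C)) := by
      intro x z hle
      rcases lt_or_ge (t z) (t x + 4) with hlt | hge
      · left
        have a1 := h.dist_succ_le (t x)
        have a2 := h.dist_succ_le (t x + 1)
        have a3 := h.dist_succ_le (t x + 1 + 1)
        have b2 := dist_triangle (s (t x)) (s (t x + 1)) (s (t x + 1 + 1))
        have b3 := dist_triangle (s (t x)) (s (t x + 1 + 1)) (s (t x + 1 + 1 + 1))
        obtain h0 | h0 | h0 | h0 : t z = t x ∨ t z = t x + 1 ∨ t z = t x + 1 + 1 ∨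
          t z = t x + 1 + 1 + 1 := by omega
        · rw [h0, dist_self]; positivity
        all_goals rw [h0]; linarith
      · right
        have a1 := h.through (ht3 x) (h.right_mono (i := t z - 1) (by omega) (ht1 z))
        have a2 := h.through (h.left_mono (j := t z - 1) (by omega) (h.next (t x + 1))) (ht1 z)
        have b1 := h.dist_succ_le (t x)
        have b2 := h.dist_succ_le (t z - 1)
        rw [sub_add_cancel] at b2
        have c1 := dist_triangle x (e (t x + 1)) (s (t x + 1))
        have c2 := dist_triangle (s (t x + 1)) (e (t z - 1)) (s (t z - 1))
        have c3 := dist_triangle_right x (s (t x)) (s (t x + 1))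
        have c4 := dist_triangle4 (s (t x)) (s (t x + 1)) (s (t z - 1)) (s (t z))
        have c5 := dist_triangle_left (s (t z)) z (s (t z - 1))
        linarith
    intro x z
    rcases le_total (t x) (t z) with hle | hle
    · exact key x z hle
    · have := key z x hle
      rw [dist_comm (s (t z)), dist_comm z, dist_comm z, dist_comm (s (t x)) x] at this
      rcases this with h1 | h1
      · exact Or.inl h1
      · right; linarith
  · intro j
    have h1 : t (s j) = j + 1 := by
      have a1 : ¬ t (s j) ≤ j := fun hle => ht2 (s j) (h.right_mono hle (by
        rw [h.fix, dist_self]; exact hK))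
      have a2 : ¬ j + 1 ≤ t (s j) - 1 := fun hle => h.not_left (h.right_mono hle (ht1 (s j)))
        (h.next j)
      omega
    simp only
    rw [h1]
    linarith [h.dist_succ_le j]

theorem le_dist (h : Chain pr s e C K W) (n : ℕ) : (n : ℝ) ≤ dist (s n) (s 0) := by
  have := h.right_dist (x := s n) (i := 0) n (by rw [zero_add, h.fix, dist_self]; exact h.K_nonneg)
  rwa [zero_add, dist_self, zero_add] at this

end Chain

end Chains

section Behrstock

variable {G X : Type*} [Group G] [MetricSpace X] [MulAction G X] {o : X}

theorem Contr.behrstock (hIso : IsometricAction G X) {Y : Set X} {C B : ℝ} (hY : Contr Y C)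
    (hex : ∀ x, ∃ p, Near Y x p) {f : G}
    (hf : ∀ y ∈ Y, ∀ p, Near Y (f • y) p → dist p o ≤ B)
    (hf' : ∀ y ∈ Y, ∀ p, Near Y (f⁻¹ • y) p → dist p o ≤ B) {z p q : X}
    (hp : Near Y z p) (hq : Near Y (f⁻¹ • z) q) : dist p o ≤ B + C ∨ dist q o ≤ B + C := by
  by_contra! hc
  obtain ⟨u, hu⟩ := hex (f • q)
  obtain ⟨w, hw⟩ := hex (f⁻¹ • p)
  have hu' := hf _ hq.1 _ hu
  have hw' := hf' _ hp.1 _ hw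
  have t1 := dist_triangle p u o
  have t2 := dist_triangle q w o
  have c1 := hY _ _ _ _ hp hu (by linarith)
  have c2 := hY _ _ _ _ hq hw (by linarith)
  rw [hIso, dist_inv_smul hIso] at c2
  linarith [dist_nonneg (x := u) (y := f • q), dist_nonneg (x := w) (y := f⁻¹ • p)]

/-- A normal subgroup containing an element not commensurating a rank one element contains an
element whose orbit is contracting. -/
theorem exists_contr_mem (hIso : IsometricAction G X)
    (hfin : ∀ r, {g : G | dist o (g • o) ≤ r}.Finite) {g : G} {C ℓ D : ℝ}
    (h : Axial o g C ℓ D) {Γ : Subgroup G} (hΓ : Γ.Normal) {f : G} (hf : f ∈ Γ)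
    (hfg : ¬ Comm g f) :
    ∃ k ∈ Γ, ∃ C', Contr (zOrbit o k) C' ∧ ∀ n : ℕ, (n : ℝ) ≤ dist o (k ^ n • o) := by
  have near := exists_near hfin (zOrbit_subset g) ⟨o, self_mem_zOrbit g⟩
  have hfg' : ¬ Comm g f⁻¹ := by
    rintro ⟨k, l, hk, hl, e⟩
    exact hfg ⟨l, k, hl, hk, by rw [← e]; group⟩
  obtain ⟨B₁, hB₁⟩ := h.exists_proj_bound hIso hfin hfg
  obtain ⟨B₂, hB₂⟩ := h.exists_proj_bound hIso hfin hfg'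
  set B := max (max B₁ B₂) 0
  have bd : ∀ y ∈ zOrbit o g, ∀ p, Near (zOrbit o g) (f • y) p → dist p o ≤ B := fun y hy p hp =>
    (hB₁ y hy p hp).trans (by simp [B])
  have bd' : ∀ y ∈ zOrbit o g, ∀ p, Near (zOrbit o g) (f⁻¹ • y) p → dist p o ≤ B :=
    fun y hy p hp => (hB₂ y hy p hp).trans (by simp [B])
  have hB : 0 ≤ B := le_max_right _ _
  have hC := h.C_nonneg
  set K := B + C with hK
  obtain ⟨n, hn⟩ := exists_nat_gt ((3 * K + C + 1 + D) / ℓ)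
  rw [div_lt_iff₀ h.ℓ_pos, mul_comm] at hn
  set v : G := g ^ (n : ℤ) with hv
  have hlong : 3 * K + C + 1 ≤ dist o (v • o) := by
    have := h.le_dist' n
    rw [Int.cast_natCast, Nat.abs_cast] at this
    linarith
  have hvN : ∀ {x p}, Near (zOrbit o g) x p → Near (zOrbit o g) (v⁻¹ • x) (v⁻¹ • p) := by
    intro x p hp
    rw [hv, ← zpow_neg]
    exact hp.zpow_smul hIso _
  have hvY : ∀ {y}, y ∈ zOrbit o g → v⁻¹ • y ∈ zOrbit o g := by
    intro y hy
    rw [hv, ← zpow_neg, zpow_smul_mem_zOrbit]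
    exact hy
  have bh : ∀ {z p q}, Near (zOrbit o g) z p → Near (zOrbit o g) (f⁻¹ • z) q →
      dist p o ≤ K ∨ dist q o ≤ K := fun hp hq => h.contr.behrstock hIso near bd bd' hp hq
  have bh' : ∀ {z p q}, Near (zOrbit o g) z p → Near (zOrbit o g) (f • z) q →
      dist p o ≤ K ∨ dist q o ≤ K := fun hp hq =>
    h.contr.behrstock hIso (f := f⁻¹) near bd' (by rwa [inv_inv]) hp (by rwa [inv_inv])
  set k : G := f * v * f⁻¹ * v⁻¹ with hk
  have hkΓ : k ∈ Γ := by
    rw [hk, mul_assoc, mul_assoc, ← mul_assoc v]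
    exact Γ.mul_mem hf (hΓ.conj_mem _ (Γ.inv_mem hf) v)
  have step : ∀ {z p q}, Near (zOrbit o g) (f⁻¹ • z) p → dist p o ≤ K →
      Near (zOrbit o g) (k⁻¹ • z) q → dist q (v • o) ≤ K := by
    intro z p q hp hpo hq
    have hq' := hvN hq
    have e1 : v⁻¹ • k⁻¹ • z = f • v⁻¹ • f⁻¹ • z := by simp only [smul_smul, hk]; group
    rw [e1] at hq'
    rcases bh' (hvN hp) hq' with h1 | h1
    · rw [dist_inv_smul hIso] at h1
      have := dist_triangle_left o (v • o) p
      linarith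
    · rwa [dist_inv_smul hIso] at h1
  choose π hπ using near
  have hπk : ∀ (i : ℤ) x z, C < dist (k ^ i • π (k ^ (-i) • x)) (k ^ i • π (k ^ (-i) • z)) →
    dist x (k ^ i • π (k ^ (-i) • x)) + dist (k ^ i • π (k ^ (-i) • x)) (k ^ i • π (k ^ (-i) • z)) +
      dist (k ^ i • π (k ^ (-i) • z)) z ≤ dist x z + C := by
    intro i x z hlt
    rw [hIso] at hlt
    have := h.contr _ _ _ _ (hπ _) (hπ _) hlt
    rw [hIso, zpow_neg, dist_inv_smul hIso, dist_comm (π _) (_⁻¹ • z), dist_inv_smul hIso] at this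
    rw [hIso, dist_comm _ z, zpow_neg]
    exact this
  have hsucc : ∀ (i : ℤ) (x : X), k ^ (-(i + 1)) • x = k⁻¹ • k ^ (-i) • x := by
    intro i x
    rw [smul_smul]; congr 1; group
  have hinv : ∀ (i : ℤ) (x : X), k ^ (-i) • k ^ i • x = x := by
    intro i x
    rw [zpow_neg, inv_smul_smul]
  have chain : Chain (fun i x => k ^ i • π (k ^ (-i) • x)) (fun i => k ^ i • o)
      (fun i => k ^ i • v • o) C K (max (dist o (v • o)) (dist o (k • v • o))) := by
    refine ⟨hC, by positivity, hπk, ?_, ?_, ?_, ?_, ?_, ?_, ?_⟩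
    · intro i x
      rw [hIso, hIso, hsucc]
      by_cases h1 : dist (π (k ^ (-i) • x)) o ≤ K
      · exact Or.inl h1
      · exact Or.inr (step (hπ _) ((bh (hπ _) (hπ _)).resolve_left h1) (hπ _))
    · intro i
      rw [hIso, hsucc, hinv]
      exact step (hπ _) ((bd' _ (self_mem_zOrbit g) _ (hπ _)).trans (by linarith)) (hπ _)
    · intro i
      rw [hIso, zpow_add_one, mul_smul, hinv]
      refine (bh (hπ _) (hπ _)).resolve_right fun h1 => ?_
      have e1 : v⁻¹ • f⁻¹ • k • v • o = f⁻¹ • o := by simp only [smul_smul, hk]; group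
      have h2 := hvN (hπ (f⁻¹ • k • v • o))
      rw [e1] at h2
      have h3 := bd' _ (self_mem_zOrbit g) _ h2
      rw [dist_inv_smul hIso] at h3
      have := dist_triangle_left o (v • o) (π (f⁻¹ • k • v • o))
      linarith
    · intro i
      rw [hinv, (hπ o).eq_of_mem (self_mem_zOrbit g)]
    · intro i
      rw [hIso, dist_comm]
      exact hlong
    · intro i
      rw [hIso, dist_comm]
      exact le_max_left _ _
    · intro i
      rw [zpow_add_one, mul_smul, hIso]
      exact le_max_right _ _
  obtain ⟨P, C', hP, hc, hs⟩ := chain.exists_coarse_proj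
  refine ⟨k, hkΓ, 5 * C', contr_of_coarse (P := P) ?_ hc ?_, fun n => ?_⟩
  · intro x
    obtain ⟨j, hj⟩ := hP x
    rw [hj]
    exact mem_zOrbit k j
  · rintro _ ⟨j, rfl⟩
    exact hs j
  · have := chain.le_dist n
    rwa [zpow_zero, one_smul, zpow_natCast, dist_comm] at this

end Behrstock

section Growth

theorem sum_exp_le {α : Type*} (len : α → ℝ) (hlen : ∀ a, 0 ≤ len a) {A σ τ : ℝ} (hA : 0 ≤ A)
    (hσ : 0 < σ) (hτ : τ < σ)
    (hN : ∀ (n : ℕ) (W : Finset α), (∀ w ∈ W, len w ≤ n) → (W.card : ℝ) ≤ A * Real.exp (τ * n))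
    (W : Finset α) :
    ∑ w ∈ W, Real.exp (-σ * len w) ≤ A * Real.exp σ * (1 - Real.exp (τ - σ))⁻¹ := by
  classical
  obtain ⟨m, hm⟩ : ∃ m, ∀ w ∈ W, ⌈len w⌉₊ ∈ Finset.range m := by
    refine ⟨W.sup (fun w => ⌈len w⌉₊) + 1, fun w hw => ?_⟩
    rw [Finset.mem_range]
    exact Nat.lt_succ_of_le (Finset.le_sup (f := fun w => ⌈len w⌉₊) hw)
  rw [← Finset.sum_fiberwise_of_maps_to hm]
  have hr0 : 0 ≤ Real.exp (τ - σ) := (Real.exp_pos _).le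
  have hr1 : Real.exp (τ - σ) < 1 := Real.exp_lt_one_iff.2 (by linarith)
  have key : ∀ n : ℕ, ∑ w ∈ W with ⌈len w⌉₊ = n, Real.exp (-σ * len w) ≤
      A * Real.exp σ * Real.exp (τ - σ) ^ n := by
    intro n
    have h1 : ∀ w ∈ W.filter (fun w => ⌈len w⌉₊ = n),
        Real.exp (-σ * len w) ≤ Real.exp (σ - σ * n) := by
      intro w hw
      rw [Finset.mem_filter] at hw
      have h2 := Nat.ceil_lt_add_one (hlen w)
      rw [hw.2] at h2
      apply Real.exp_le_exp.2
      have : σ * n ≤ σ * (len w + 1) := mul_le_mul_of_nonneg_left h2.le hσ.le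
      linarith
    have h3 := Finset.sum_le_card_nsmul _ _ _ h1
    rw [nsmul_eq_mul] at h3
    have h4 := hN n (W.filter fun w => ⌈len w⌉₊ = n) (by
      intro w hw
      rw [Finset.mem_filter] at hw
      rw [← hw.2]
      exact Nat.le_ceil _)
    have h5 := mul_le_mul_of_nonneg_right h4 (Real.exp_pos (σ - σ * n)).le
    refine h3.trans (h5.trans (le_of_eq ?_))
    rw [← Real.exp_nat_mul, mul_assoc, mul_assoc, ← Real.exp_add, ← Real.exp_add]
    congr 2; ring
  refine (Finset.sum_le_sum fun n _ => key n).trans ?_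
  rw [← Finset.mul_sum]
  refine mul_le_mul_of_nonneg_left ?_ (by positivity)
  rw [← tsum_geometric_of_lt_one hr0 hr1]
  exact (summable_geometric_of_lt_one hr0 hr1).sum_le_tsum _ fun n _ => by positivity

variable {G X : Type*} [Group G] [MetricSpace X] [MulAction G X] {o : X}

theorem exists_card_le (hfin : ∀ r, {g : G | dist o (g • o) ≤ r}.Finite) {τ : ℝ} (hτ : 0 < τ)
    (h : growthExp o (Set.univ : Set G) < ENNReal.ofReal τ) :
    ∃ A, 0 ≤ A ∧ ∀ (n : ℕ) (W : Finset G), (∀ w ∈ W, dist o (w • o) ≤ n) →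
      (W.card : ℝ) ≤ A * Real.exp (τ * n) := by
  have h1 := Filter.eventually_lt_of_limsup_lt h
  obtain ⟨R, hR⟩ := Filter.eventually_atTop.1 (h1.and (Filter.eventually_gt_atTop 0))
  have hcard : ∀ (r : ℝ) (W : Finset G), (∀ w ∈ W, dist o (w • o) ≤ r) →
      W.card ≤ Nat.card {g : G // g ∈ Set.univ ∧ dist o (g • o) ≤ r} := by
    intro r W hW
    have : Finite {g : G // g ∈ Set.univ ∧ dist o (g • o) ≤ r} := by
      refine ((hfin r).subset ?_).to_subtype
      exact fun g hg => hg.2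
    rw [← Fintype.card_coe, ← Nat.card_eq_fintype_card]
    exact Nat.card_le_card_of_injective
      (fun w : W => (⟨w, trivial, hW w w.2⟩ : {g : G // g ∈ Set.univ ∧ dist o (g • o) ≤ r}))
      fun a b hab => Subtype.ext (congrArg (fun z => z.1) hab)
  have hbig : ∀ r, R ≤ r → ∀ W : Finset G, (∀ w ∈ W, dist o (w • o) ≤ r) →
      (W.card : ℝ) ≤ Real.exp (τ * r) := by
    intro r hr W hW
    obtain ⟨h2, h3⟩ := hR r hr
    rw [ENNReal.ofReal_lt_ofReal_iff hτ, div_lt_iff₀ h3] at h2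
    rcases W.eq_empty_or_nonempty with rfl | hne
    · rw [Finset.card_empty, Nat.cast_zero]
      positivity
    have h4 : (0 : ℝ) < W.card := by exact_mod_cast hne.card_pos
    have h5 : (W.card : ℝ) ≤ Nat.card {g : G // g ∈ Set.univ ∧ dist o (g • o) ≤ r} := by
      exact_mod_cast hcard r W hW
    refine h5.trans ?_
    rw [← Real.log_le_iff_le_exp (by linarith)]
    exact h2.le
  refine ⟨Real.exp (τ * |R|), by positivity, fun n W hW => ?_⟩
  have h6 := hbig (|R| + n) (by linarith [le_abs_self R, n.cast_nonneg (α := ℝ)]) W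
    fun w hw => (hW w hw).trans (by linarith [abs_nonneg R])
  rwa [mul_add, Real.exp_add] at h6

/-- A ping-pong lower bound on the growth exponent. -/
theorem le_growthExp_of_free (hIso : IsometricAction G X)
    (hfin : ∀ r, {g : G | dist o (g • o) ≤ r}.Finite) {ι : Type*} (s : Finset ι) (φ : ι → G)
    (S : Set G) (h1 : 1 ∈ S) (hS : ∀ a ∈ s, ∀ w ∈ S, φ a * w ∈ S)
    (hinj : ∀ a ∈ s, ∀ b ∈ s, ∀ w ∈ S, ∀ w' ∈ S, φ a * w = φ b * w' → a = b) {σ : ℝ} (hσ : 0 < σ)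
    (hq : 1 < ∑ a ∈ s, Real.exp (-σ * dist o (φ a • o))) :
    ENNReal.ofReal σ ≤ growthExp o (Set.univ : Set G) := by
  classical
  by_contra! hlt
  obtain ⟨c, hc1, hc2⟩ := exists_between hlt
  obtain ⟨A, hA, hN⟩ := exists_card_le hfin (τ := c.toReal)
    (ENNReal.toReal_pos (pos_of_gt hc1).ne' (ne_top_of_lt hc2))
    (by rwa [ENNReal.ofReal_toReal (ne_top_of_lt hc2)])
  have hτ : c.toReal < σ := by
    rwa [← ENNReal.ofReal_lt_ofReal_iff hσ, ENNReal.ofReal_toReal (ne_top_of_lt hc2)]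
  have hM := sum_exp_le (fun w : G => dist o (w • o)) (fun _ => dist_nonneg) hA hσ hτ hN
  set q := ∑ a ∈ s, Real.exp (-σ * dist o (φ a • o))
  have words : ∀ k : ℕ, ∃ W : Finset G, (∀ w ∈ W, w ∈ S) ∧
      q ^ k ≤ ∑ w ∈ W, Real.exp (-σ * dist o (w • o)) := by
    intro k
    induction k with
    | zero => exact ⟨{1}, by simpa using h1, by simp⟩
    | succ k ih =>
      obtain ⟨W, hW, hk⟩ := ih
      refine ⟨(s ×ˢ W).image fun x => φ x.1 * x.2, ?_, ?_⟩
      · intro w hw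
        obtain ⟨⟨a, v⟩, hav, rfl⟩ := Finset.mem_image.1 hw
        rw [Finset.mem_product] at hav
        exact hS _ hav.1 _ (hW _ hav.2)
      · rw [Finset.sum_image, Finset.sum_product, pow_succ']
        · calc q * q ^ k ≤ q * ∑ w ∈ W, Real.exp (-σ * dist o (w • o)) :=
                mul_le_mul_of_nonneg_left hk (by linarith)
            _ = ∑ a ∈ s, ∑ w ∈ W, Real.exp (-σ * dist o (φ a • o)) *
                  Real.exp (-σ * dist o (w • o)) := by
                rw [Finset.sum_mul_sum]
            _ ≤ _ := by
                refine Finset.sum_le_sum fun a _ => Finset.sum_le_sum fun w _ => ?_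
                rw [← Real.exp_add]
                apply Real.exp_le_exp.2
                have := dist_triangle o (φ a • o) ((φ a * w) • o)
                rw [mul_smul, hIso] at this
                rw [mul_smul]
                have := mul_le_mul_of_nonneg_left this hσ.le
                linarith
        · rintro ⟨a, v⟩ hav ⟨b, w⟩ hbw heq
          rw [Finset.mem_coe, Finset.mem_product] at hav hbw
          simp only at heq hav hbw
          obtain rfl := hinj a hav.1 b hbw.1 v (hW _ hav.2) w (hW _ hbw.2) heq
          rw [mul_left_cancel heq]
  obtain ⟨k, hk⟩ := pow_unbounded_of_one_lt (A * Real.exp σ * (1 - Real.exp (c.toReal - σ))⁻¹) hq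
  obtain ⟨W, -, hW⟩ := words k
  linarith [hM W]

/-- Existence of a free subsemigroup. -/
theorem growthExp_pos (hIso : IsometricAction G X)
    (hfin : ∀ r, {g : G | dist o (g • o) ≤ r}.Finite) {g : G} {C ℓ D : ℝ}
    (h : Axial o g C ℓ D) {f : G} (hfg : ¬ Comm g f) :
    0 < growthExp o (Set.univ : Set G) := by
  have near := exists_near hfin (zOrbit_subset g) ⟨o, self_mem_zOrbit g⟩
  have hfg' : ¬ Comm g f⁻¹ := by
    rintro ⟨k, l, hk, hl, e⟩
    exact hfg ⟨l, k, hl, hk, by rw [← e]; group⟩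
  obtain ⟨B₁, hB₁⟩ := h.exists_proj_bound hIso hfin hfg
  obtain ⟨B₂, hB₂⟩ := h.exists_proj_bound hIso hfin hfg'
  set K := max (max B₁ B₂) 0 + C
  have hK : 0 ≤ K := add_nonneg (le_max_right _ _) h.C_nonneg
  have bh : ∀ {z p q}, Near (zOrbit o g) z p → Near (zOrbit o g) (f • z) q →
      dist p o ≤ K ∨ dist q o ≤ K := fun hp hq =>
    h.contr.behrstock hIso (f := f⁻¹) near (fun y hy p hp => (hB₂ y hy p hp).trans (by simp))
      (fun y hy p hp => (hB₁ y hy p (by rwa [inv_inv] at hp)).trans (by simp)) hp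
      (by rwa [inv_inv])
  obtain ⟨n, hn⟩ := exists_nat_gt ((2 * K + D) / ℓ)
  rw [div_lt_iff₀ h.ℓ_pos, mul_comm] at hn
  have hlong : ∀ i j : ℤ, (n : ℝ) ≤ |(i : ℝ) - j| → 2 * K < dist (g ^ i • o) (g ^ j • o) := by
    intro i j hij
    have h1 := h.le_dist i j
    have h2 := mul_le_mul_of_nonneg_left hij h.ℓ_pos.le
    linarith
  obtain ⟨E, hE, hE'⟩ : ∃ E : Bool → ℤ, (∀ b, (n : ℝ) ≤ |((0 : ℤ) : ℝ) - E b|) ∧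
      ∀ a b, a ≠ b → (n : ℝ) ≤ |(E a : ℝ) - E b| := by
    refine ⟨fun b => if b then n else 2 * n, fun b => ?_, fun a b hab => ?_⟩
    · cases b <;> simp
      linarith [n.cast_nonneg (α := ℝ)]
    · cases a <;> cases b <;> simp at hab ⊢
      · rw [two_mul, add_sub_cancel_right, Nat.abs_cast]
      · rw [two_mul, sub_add_cancel_left, abs_neg, Nat.abs_cast]
  set φ : Bool → G := fun b => f * g ^ E b with hφ
  set L := max (max (dist o (φ true • o)) (dist o (φ false • o))) 1
  have hL : 0 < L := lt_max_of_lt_right one_pos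
  have hlog := Real.log_pos (one_lt_two)
  have hσ : 0 < Real.log 2 / (2 * L) := by positivity
  refine (ENNReal.ofReal_pos.2 hσ).trans_le ?_
  refine le_growthExp_of_free hIso hfin Finset.univ φ
    {w | ∀ p, Near (zOrbit o g) (w • o) p → dist p o ≤ K} ?_ ?_ ?_ hσ ?_
  · intro p hp
    rw [one_smul] at hp
    rw [hp.eq_of_mem (self_mem_zOrbit g), dist_self]
    exact hK
  · intro b _ w hw p hp
    obtain ⟨q, hq⟩ := near (w • o)
    have h1 := hw q hq
    have h2 := hq.zpow_smul hIso (E b)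
    simp only [hφ, mul_smul] at hp
    refine (bh h2 hp).resolve_left fun h3 => ?_
    have h4 := hlong 0 _ (hE b)
    rw [zpow_zero, one_smul] at h4
    rw [← hIso (g ^ E b)] at h1
    have := dist_triangle_left o (g ^ E b • o) (g ^ E b • q)
    linarith
  · intro a _ b _ w hw w' hw' heq
    by_contra hab
    simp only [hφ, mul_assoc, mul_right_inj] at heq
    obtain ⟨q, hq⟩ := near (w' • o)
    have h1 := hw' q hq
    have h2 := (hq.zpow_smul hIso (E b)).zpow_smul hIso (-E a)
    rw [← mul_smul (g ^ E b), ← heq, mul_smul, zpow_neg, inv_smul_smul] at h2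
    have h3 := hw _ h2
    rw [dist_inv_smul hIso] at h3
    rw [← hIso (g ^ E b)] at h1
    have h4 := hlong _ _ (hE' a b hab)
    have := dist_triangle_left (g ^ E a • o) (g ^ E b • o) (g ^ E b • q)
    linarith
  · have h1 : ∀ b, (1 : ℝ) / 2 < Real.exp (-(Real.log 2 / (2 * L)) * dist o (φ b • o)) := by
      intro b
      have hb : dist o (φ b • o) ≤ L := by
        cases b
        · exact (le_max_right _ _).trans (le_max_left _ _)
        · exact (le_max_left _ _).trans (le_max_left _ _)
      rw [← Real.log_lt_iff_lt_exp (by norm_num), one_div, Real.log_inv]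
      have h2 := mul_le_mul_of_nonneg_left hb hσ.le
      have h3 : Real.log 2 / (2 * L) * L = Real.log 2 / 2 := by field_simp
      linarith
    rw [Fintype.sum_bool]
    linarith [h1 true, h1 false]

end Growth

section Separated

variable {G X : Type*} [Group G] [MetricSpace X] [MulAction G X] {o : X}

/-- A divergent Poincaré series has finite separated subsets with arbitrarily large sums. -/
theorem exists_separated (hIso : IsometricAction G X)
    (hfin : ∀ r, {g : G | dist o (g • o) ≤ r}.Finite) {ι : Type*} {a : ι → G}
    (ha : Function.Injective a) {δ : ℝ} (hδ : 0 < δ)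
    (hsum : ¬ Summable fun i => Real.exp (-δ * dist o (a i • o))) (M R : ℝ) {D : ℝ} (hD : 0 ≤ D) :
    ∃ s : Finset ι, (∀ i ∈ s, R < dist o (a i • o)) ∧
      (∀ i ∈ s, ∀ j ∈ s, i ≠ j → D < dist (a i • o) (a j • o)) ∧
      M < ∑ i ∈ s, Real.exp (-δ * dist o (a i • o)) := by
  classical
  set w : ι → ℝ := fun i => Real.exp (-δ * dist o (a i • o)) with hw
  have hw0 : ∀ i, 0 ≤ w i := fun i => (Real.exp_pos _).le
  have hlarge : ∀ M', ∃ F : Finset ι, M' < ∑ i ∈ F, w i := by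
    intro M'
    by_contra! hc
    exact hsum (summable_of_sum_le hw0 hc)
  have hsmall : {i | dist o (a i • o) ≤ R}.Finite := (hfin R).preimage ha.injOn
  set V := (hfin D).toFinset.card * Real.exp (δ * D) with hV
  have hV0 : 0 ≤ V := by positivity
  obtain ⟨F, hF⟩ := hlarge (V * max M 0 + ∑ i ∈ hsmall.toFinset, w i)
  set F' := F \ hsmall.toFinset with hF'
  have hF'sum : V * max M 0 < ∑ i ∈ F', w i := by
    have h1 : ∑ i ∈ F, w i ≤ ∑ i ∈ F' ∪ hsmall.toFinset, w i :=
      Finset.sum_le_sum_of_subset_of_nonneg (by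
        intro i hi
        by_cases h : i ∈ hsmall.toFinset <;> simp [F', hi, h]) fun i _ _ => hw0 i
    have h2 : ∑ i ∈ F' ∪ hsmall.toFinset, w i = _ :=
      Finset.sum_union Finset.sdiff_disjoint
    linarith
  have hexmax : ∀ P : Finset ι → Prop, P ∅ →
      ∃ s, (s ⊆ F' ∧ P s) ∧ ∀ t, t ⊆ F' → P t → t.card ≤ s.card := by
    intro P hP
    obtain ⟨s, hs, hmax⟩ := Finset.exists_max_image (F'.powerset.filter P) Finset.card
      ⟨∅, Finset.mem_filter.2 ⟨Finset.empty_mem_powerset _, hP⟩⟩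
    rw [Finset.mem_filter, Finset.mem_powerset] at hs
    exact ⟨s, hs, fun t ht ht' => hmax t (Finset.mem_filter.2 ⟨Finset.mem_powerset.2 ht, ht'⟩)⟩
  obtain ⟨s, hs, hmax⟩ := hexmax
    (fun s => ∀ i ∈ s, ∀ j ∈ s, i ≠ j → D < dist (a i • o) (a j • o)) (by simp)
  refine ⟨s, fun i hi => ?_, hs.2, ?_⟩
  · have := hs.1 hi
    rw [hF', Finset.mem_sdiff, Set.Finite.mem_toFinset] at this
    exact not_le.1 this.2
  have hcov : ∀ i ∈ F', ∃ j ∈ s, dist (a j • o) (a i • o) ≤ D := by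
    intro i hi
    by_contra! hc'
    have his : i ∉ s := fun h => by
      have := hc' i h
      rw [dist_self] at this
      linarith
    have := hmax (insert i s) (Finset.insert_subset hi hs.1) (by
      intro x hx y hy hxy
      rw [Finset.mem_insert] at hx hy
      rcases hx with rfl | hx <;> rcases hy with rfl | hy
      · exact absurd rfl hxy
      · rw [dist_comm]; exact hc' y hy
      · exact hc' x hx
      · exact hs.2 x hx y hy hxy)
    rw [Finset.card_insert_of_notMem his] at this
    omega
  have hfib : ∀ j, ∑ i ∈ F' with dist (a j • o) (a i • o) ≤ D, w i ≤ V * w j := by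
    intro j
    have h1 : ∀ i ∈ F'.filter fun i => dist (a j • o) (a i • o) ≤ D,
        w i ≤ Real.exp (δ * D) * w j := by
      intro i hi
      rw [Finset.mem_filter] at hi
      rw [hw]
      simp only
      rw [← Real.exp_add]
      apply Real.exp_le_exp.2
      have h2 := dist_triangle_right o (a j • o) (a i • o)
      have := mul_le_mul_of_nonneg_left (h2.trans (add_le_add_right hi.2 _)) hδ.le
      linarith
    have h3 : (F'.filter fun i => dist (a j • o) (a i • o) ≤ D).card ≤
        (hfin D).toFinset.card := by
      refine Finset.card_le_card_of_injOn (fun i => (a j)⁻¹ * a i) ?_ ?_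
      · intro i hi
        rw [Finset.mem_coe, Finset.mem_filter] at hi
        rw [Finset.mem_coe, Set.Finite.mem_toFinset, Set.mem_ofPred_eq, mul_smul, dist_comm,
          dist_inv_smul hIso, dist_comm]
        exact hi.2
      · intro x _ y _ hxy
        exact ha (mul_left_cancel hxy)
    refine (Finset.sum_le_card_nsmul _ _ _ h1).trans ?_
    rw [nsmul_eq_mul, hV, mul_assoc]
    exact mul_le_mul_of_nonneg_right (by exact_mod_cast h3) (by have := hw0 j; positivity)
  have hle : ∑ i ∈ F', w i ≤ V * ∑ j ∈ s, w j := by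
    rw [Finset.mul_sum]
    refine le_trans ?_ (Finset.sum_le_sum fun j _ => hfib j)
    simp only [Finset.sum_filter]
    rw [Finset.sum_comm]
    refine Finset.sum_le_sum fun i hi => ?_
    obtain ⟨j, hj, hji⟩ := hcov i hi
    refine le_trans (le_of_eq ?_) (Finset.single_le_sum (fun j _ => ?_) hj)
    · rw [if_pos hji]
    · split_ifs
      exacts [hw0 i, le_rfl]
  by_contra! hc
  have := mul_le_mul_of_nonneg_left (hc.trans (le_max_left M 0)) hV0
  linarith

end Separated

section PingPong

variable {G X : Type*} [Group G] [MetricSpace X] [MulAction G X] {o : X}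

/-- `a` has minimal length in its coset of `Γ`. -/
def MinRep (o : X) (Γ : Subgroup G) (a : G) : Prop :=
  ∀ γ ∈ Γ, dist o (a • o) ≤ dist o ((a * γ) • o)

theorem MinRep.near_inv (hIso : IsometricAction G X) {Γ : Subgroup G} {a k : G}
    (ha : MinRep o Γ a) (hk : k ∈ Γ) : Near (zOrbit o k) (a⁻¹ • o) o := by
  refine ⟨self_mem_zOrbit k, ?_⟩
  rintro _ ⟨i, rfl⟩
  have := ha _ (Γ.zpow_mem hk i)
  simp only
  rwa [dist_inv_smul hIso, dist_inv_smul hIso, ← mul_smul]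

theorem MinRep.le_mul_left {Γ : Subgroup G} (hΓ : Γ.Normal) {a γ : G} (ha : MinRep o Γ a)
    (hγ : γ ∈ Γ) : dist o (a • o) ≤ dist o ((γ * a) • o) := by
  have := ha _ (hΓ.conj_mem _ hγ a⁻¹)
  rwa [inv_inv, ← mul_assoc, ← mul_assoc, mul_inv_cancel, one_mul] at this

theorem MinRep.near (hIso : IsometricAction G X) {Γ : Subgroup G} (hΓ : Γ.Normal) {a k : G}
    (ha : MinRep o Γ a) (hk : k ∈ Γ) : Near (zOrbit o k) (a • o) o := by
  refine ⟨self_mem_zOrbit k, ?_⟩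
  rintro _ ⟨i, rfl⟩
  have := ha.le_mul_left hΓ (Γ.inv_mem (Γ.zpow_mem hk i))
  simp only
  rwa [mul_smul, dist_comm o (_ • _ • o), dist_inv_smul hIso, dist_comm] at this

theorem MinRep.dist_through (hIso : IsometricAction G X) {Γ : Subgroup G} {a k h : G} {C : ℝ}
    (ha : MinRep o Γ a) (hk : k ∈ Γ) (hC : Contr (zOrbit o k) C) {i : ℤ} (hh : h = k ^ i)
    (hlong : 2 * C < dist o (h • o)) {z q : X} (hq : Near (zOrbit o k) z q) (hqo : dist q o ≤ C) :
    dist o (a • o) + dist o (h • q) + dist q z ≤ dist o (a • h • z) + C := by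
  have h1 := hq.zpow_smul hIso i
  rw [← hh] at h1
  have h2 := dist_triangle o (h • q) (h • o)
  rw [hIso] at h2
  have := hC _ _ _ _ (ha.near_inv hIso hk) h1 (by linarith)
  rw [dist_inv_smul hIso, dist_inv_smul hIso, hIso h] at this
  exact this

theorem MinRep.closed (hIso : IsometricAction G X) {Γ : Subgroup G} (hΓ : Γ.Normal) {a k h : G}
    {C : ℝ} (ha : MinRep o Γ a) (hk : k ∈ Γ) (hC : Contr (zOrbit o k) C) {i : ℤ} (hh : h = k ^ i)
    (hlong : 2 * C < dist o (h • o)) (hlen : C < dist o (a • o)) {z p q : X}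
    (hq : Near (zOrbit o k) z q) (hqo : dist q o ≤ C) (hp : Near (zOrbit o k) (a • h • z) p) :
    dist p o ≤ C := by
  by_contra! hlt
  have h1 := ha.dist_through hIso hk hC hh hlong hq hqo
  rw [dist_comm] at hlt
  have h2 := hC _ _ _ _ (ha.near hIso hΓ hk) hp hlt
  have h3 := dist_triangle o (h • q) (h • z)
  have h4 := dist_triangle o p (a • h • z)
  rw [hIso] at h3 h2
  rw [dist_comm (a • o)] at h2
  linarith

theorem MinRep.inj_aux (hIso : IsometricAction G X) {Γ : Subgroup G} (hΓ : Γ.Normal) {a b k h : G}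
    {C : ℝ} (hex : ∀ x, ∃ p, Near (zOrbit o k) x p) (ha : MinRep o Γ a) (hb : MinRep o Γ b)
    (hk : k ∈ Γ) (hC : Contr (zOrbit o k) C) {i : ℤ} (hh : h = k ^ i)
    (hlong : 5 * C < dist o (h • o)) (hC0 : 0 ≤ C) (hab : dist o (a • o) ≤ dist o (b • o))
    (hsep : 2 * dist o (h • o) + 4 * C < dist (a • o) (b • o)) {z z' q q' : X}
    (hq : Near (zOrbit o k) z q) (hqo : dist q o ≤ C)
    (hq' : Near (zOrbit o k) z' q') (hqo' : dist q' o ≤ C) : a • h • z ≠ b • h • z' := by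
  intro heq
  have hhΓ : h ∈ Γ := hh ▸ Γ.zpow_mem hk i
  have h1 := hb.dist_through hIso hk hC hh (by linarith) hq' hqo'
  rw [← heq] at h1
  have h2 : dist (b • o) (a • h • z) ≤ dist o (h • q') + dist q' z' := by
    rw [heq, hIso]
    have := dist_triangle o (h • q') (h • z')
    rwa [hIso h] at this
  have e1 : ∀ x y : X, dist (a⁻¹ • x) y = dist x (a • y) := dist_inv_smul hIso a
  obtain ⟨r, hr⟩ := hex (a⁻¹ • b • o)
  have h3 := hq.zpow_smul hIso i
  rw [← hh] at h3
  have e2 : dist (h • q) (h • o) ≤ C := by rwa [hIso]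
  rcases lt_or_ge C (dist r (h • q)) with hlt | hle
  · have h4 := hC _ _ _ _ hr h3 hlt
    rw [e1 _ (h • z), hIso h] at h4
    have h5 := dist_triangle4 o (a • o) (a • h • q) (a • h • z)
    rw [hIso a, hIso a, hIso h] at h5
    have h6 := dist_triangle_right o (h • q) (h • o)
    rw [dist_comm (h • q) (h • o), dist_comm (h • o)] at h6
    have h7 := dist_triangle4 (a⁻¹ • b • o) r (h • q) o
    rw [e1, dist_comm (b • o)] at h7
    have h8 := dist_comm (h • q) o
    linarith
  · have h4 := dist_triangle_right (h • o) r (h • q)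
    rw [dist_comm (h • o) (h • q)] at h4
    have h5 := dist_triangle o r (h • o)
    rw [dist_comm r (h • o)] at h5
    have h6 := hC _ _ _ _ (ha.near_inv hIso hk) hr (by linarith)
    rw [e1, hIso a⁻¹] at h6
    have h7 := hb.le_mul_left hΓ (hΓ.conj_mem _ (Γ.inv_mem hhΓ) a)
    have h8 := dist_triangle o (a • o) ((a * h⁻¹ * a⁻¹ * b) • o)
    have h9 : dist (a • o) ((a * h⁻¹ * a⁻¹ * b) • o) = dist (h • o) (a⁻¹ • b • o) := by
      rw [mul_assoc, mul_assoc, mul_smul, hIso, mul_smul, mul_smul, dist_comm,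
        dist_inv_smul hIso, dist_comm]
    have h10 := dist_triangle (h • o) r (a⁻¹ • b • o)
    linarith

theorem lt_growthExp_of_contr (hIso : IsometricAction G X)
    (hfin : ∀ r, {g : G | dist o (g • o) ≤ r}.Finite) {Γ : Subgroup G} (hΓ : Γ.Normal) {k : G}
    (hk : k ∈ Γ) {C : ℝ} (hC : Contr (zOrbit o k) C)
    (hunb : ∀ n : ℕ, (n : ℝ) ≤ dist o (k ^ n • o)) {ι : Type*} {a : ι → G}
    (ha : Function.Injective a) (hmin : ∀ i, MinRep o Γ (a i)) {δ : ℝ} (hδ : 0 < δ)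
    (hsum : ¬ Summable fun i => Real.exp (-δ * dist o (a i • o))) :
    ENNReal.ofReal δ < growthExp o (Set.univ : Set G) := by
  have hex := exists_near hfin (zOrbit_subset k) ⟨o, self_mem_zOrbit k⟩
  have hC0 : 0 ≤ C := by
    have := hC.unique (near_self (self_mem_zOrbit k)) (near_self (self_mem_zOrbit k))
    rwa [dist_self] at this
  obtain ⟨n, hn⟩ := exists_nat_gt (5 * C)
  obtain ⟨h, hh⟩ : ∃ h, h = k ^ (n : ℤ) := ⟨_, rfl⟩
  have hlong : 5 * C < dist o (h • o) := by
    rw [hh, zpow_natCast]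
    exact hn.trans_le (hunb n)
  obtain ⟨s, hs1, hs2, hs3⟩ := exists_separated hIso hfin ha hδ hsum
    (Real.exp (δ * dist o (h • o))) C (D := 2 * dist o (h • o) + 4 * C)
    (by have := dist_nonneg (x := o) (y := h • o); linarith)
  have hgt : 1 < ∑ i ∈ s, Real.exp (-δ * dist o ((a i * h) • o)) := by
    have h1 : Real.exp (-(δ * dist o (h • o))) * ∑ i ∈ s, Real.exp (-δ * dist o (a i • o)) ≤
        ∑ i ∈ s, Real.exp (-δ * dist o ((a i * h) • o)) := by
      rw [Finset.mul_sum]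
      refine Finset.sum_le_sum fun i _ => ?_
      rw [← Real.exp_add]
      apply Real.exp_le_exp.2
      have := dist_triangle o (a i • o) ((a i * h) • o)
      rw [mul_smul, hIso] at this
      rw [mul_smul]
      have := mul_le_mul_of_nonneg_left this hδ.le
      linarith
    refine lt_of_lt_of_le ?_ h1
    have := mul_lt_mul_of_pos_left hs3 (Real.exp_pos (-(δ * dist o (h • o))))
    rwa [← Real.exp_add, neg_add_cancel, Real.exp_zero] at this
  have hcont : Continuous fun σ : ℝ => ∑ i ∈ s, Real.exp (-σ * dist o ((a i * h) • o)) := by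
    fun_prop
  obtain ⟨σ, hσ1, hσ2⟩ := (((hcont.tendsto δ).eventually (lt_mem_nhds hgt)).filter_mono
    nhdsWithin_le_nhds |>.and (self_mem_nhdsWithin (s := Set.Ioi δ))).exists
  have hσ2 : δ < σ := hσ2
  refine ((ENNReal.ofReal_lt_ofReal_iff (hδ.trans hσ2)).2 hσ2).trans_le ?_
  refine le_growthExp_of_free hIso hfin s (fun i => a i * h)
    {w | ∀ p, Near (zOrbit o k) (w • o) p → dist p o ≤ C} ?_ ?_ ?_ (hδ.trans hσ2) hσ1
  · intro p hp
    rw [one_smul] at hp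
    rw [hp.eq_of_mem (self_mem_zOrbit k), dist_self]
    exact hC0
  · intro i hi w hw p hp
    obtain ⟨q, hq⟩ := hex (w • o)
    rw [mul_smul, mul_smul] at hp
    exact (hmin i).closed hIso hΓ hk hC hh (by linarith) (hs1 i hi) hq (hw q hq) hp
  · intro i hi j hj w hw w' hw' heq
    by_contra hij
    obtain ⟨q, hq⟩ := hex (w • o)
    obtain ⟨q', hq'⟩ := hex (w' • o)
    have heq' : a i • h • w • o = a j • h • w' • o := by
      rw [smul_smul, smul_smul, heq, mul_smul, mul_smul]
    rcases le_total (dist o (a i • o)) (dist o (a j • o)) with hle | hle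
    · exact (hmin i).inj_aux hIso hΓ hex (hmin j) hk hC hh hlong hC0 hle (hs2 i hi j hj hij)
        hq (hw q hq) hq' (hw' q' hq') heq'
    · exact (hmin j).inj_aux hIso hΓ hex (hmin i) hk hC hh hlong hC0 hle
        (hs2 j hj i hi (Ne.symm hij)) hq' (hw' q' hq') hq (hw q hq) heq'.symm

end PingPong

section Quotient

theorem exists_exponent {B : ℕ → ℕ} {K : ℕ} (hB : ∀ n, 1 ≤ B n)
    (hK : ∀ n m, B (n + m) ≤ K * (B n * B m)) :
    ∃ δ : ℝ, 0 ≤ δ ∧ Tendsto (fun n : ℕ => Real.log (K * B n) / n) atTop (nhds δ) ∧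
      ∀ n : ℕ, Real.exp (δ * n) ≤ K * B n := by
  have hK1 : 1 ≤ K := by
    rcases Nat.eq_zero_or_pos K with rfl | h
    · have := hK 0 0
      rw [zero_mul] at this
      have := hB (0 + 0)
      omega
    · exact h
  have hge : ∀ n, (1 : ℝ) ≤ K * B n := fun n => by exact_mod_cast Nat.mul_pos hK1 (hB n)
  have hsub : Subadditive fun n => Real.log (K * B n) := by
    intro m n
    rw [← Real.log_mul (by linarith [hge m]) (by linarith [hge n])]
    apply Real.log_le_log (by linarith [hge (m + n)])
    have h1 : (B (m + n) : ℝ) ≤ K * (B m * B n) := by exact_mod_cast hK m n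
    calc (K : ℝ) * B (m + n) ≤ K * (K * (B m * B n)) := by gcongr
      _ = _ := by ring
  have hbdd : BddBelow (Set.range fun n : ℕ => Real.log (K * B n) / n) := by
    refine ⟨0, ?_⟩
    rintro _ ⟨n, rfl⟩
    exact div_nonneg (Real.log_nonneg (hge n)) n.cast_nonneg
  refine ⟨hsub.lim, ge_of_tendsto' (hsub.tendsto_lim hbdd) fun n =>
    div_nonneg (Real.log_nonneg (hge n)) n.cast_nonneg, hsub.tendsto_lim hbdd, fun n => ?_⟩
  rcases Nat.eq_zero_or_pos n with rfl | hn
  · simpa using hge 0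
  · have h1 := hsub.lim_le_div hbdd hn.ne'
    rw [le_div_iff₀ (by exact_mod_cast hn)] at h1
    rwa [← Real.le_log_iff_exp_le (by linarith [hge n])]

theorem not_summable_of_exp_le {ι : Type*} {len : ι → ℝ} (hlen : ∀ r, {i | len i ≤ r}.Finite)
    {K : ℕ} {δ : ℝ} (hδ : 0 < δ)
    (h : ∀ n : ℕ, Real.exp (δ * n) ≤ K * Nat.card {i // len i ≤ n}) :
    ¬ Summable fun i => Real.exp (-δ * len i) := by
  classical
  intro hs
  have hK : (0 : ℝ) < K := by
    have h0 := (Real.exp_pos _).trans_le (h 0)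
    by_contra! hK
    have := mul_nonpos_of_nonpos_of_nonneg hK
      (Nat.cast_nonneg (α := ℝ) (Nat.card {i // len i ≤ ((0 : ℕ) : ℝ)}))
    linarith
  obtain ⟨s, hs⟩ := summable_iff_vanishing_norm.1 hs (1 / (2 * K)) (by positivity)
  have key : ∀ n : ℕ, Real.exp (δ * n) ≤ 2 * K * s.card := by
    intro n
    have hc : Nat.card {i // len i ≤ n} = (hlen n).toFinset.card :=
      Nat.card_eq_card_finite_toFinset (hlen n)
    have h1 := h n
    rw [hc] at h1
    set W := (hlen n).toFinset
    have h2 : (W.card : ℝ) ≤ (W \ s).card + s.card := by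
      exact_mod_cast Finset.card_le_card_sdiff_add_card
    have h3 := hs (W \ s) Finset.sdiff_disjoint
    have h4 : (W \ s).card • Real.exp (-δ * n) ≤ ∑ i ∈ W \ s, Real.exp (-δ * len i) := by
      refine Finset.card_nsmul_le_sum _ _ _ fun i hi => ?_
      have hi : len i ≤ n := by
        have := (Finset.mem_sdiff.1 hi).1
        rwa [Set.Finite.mem_toFinset] at this
      apply Real.exp_le_exp.2
      have := mul_le_mul_of_nonneg_left hi hδ.le
      linarith
    have h5 : ((W \ s).card : ℝ) * Real.exp (-δ * n) < 1 / (2 * K) := by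
      rw [nsmul_eq_mul] at h4
      exact h4.trans_lt ((le_abs_self _).trans_lt h3)
    have h6 := mul_lt_mul_of_pos_right h5 (Real.exp_pos (δ * n))
    rw [mul_assoc, ← Real.exp_add, neg_mul, neg_add_cancel, Real.exp_zero, mul_one] at h6
    have h7 := mul_le_mul_of_nonneg_left (h2.trans (add_le_add_left h6.le _)) hK.le
    have h8 : (K : ℝ) * (1 / (2 * K) * Real.exp (δ * n) + s.card) =
        Real.exp (δ * n) / 2 + K * s.card := by field_simp
    rw [h8] at h7
    linarith
  obtain ⟨n, hn⟩ := exists_nat_gt (2 * K * s.card / δ)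
  rw [div_lt_iff₀ hδ, mul_comm] at hn
  linarith [key n, Real.add_one_le_exp (δ * n)]

variable {G X : Type*} [Group G] [MetricSpace X] [MulAction G X] {o : X}

theorem QuasiConvexGSpace.exists_split (hIso : IsometricAction G X)
    (hQC : QuasiConvexGSpace G o) : ∃ c : ℕ, ∀ (a : G) (n m : ℕ), dist o (a • o) ≤ n + m →
      ∃ u : G, dist o (u • o) ≤ n ∧ dist o ((u⁻¹ * a) • o) ≤ m + 2 * c := by
  obtain ⟨C, hC, h⟩ := hQC
  obtain ⟨c, hc⟩ := exists_nat_gt C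
  refine ⟨c, fun a n m ha => ?_⟩
  have hm := m.cast_nonneg (α := ℝ)
  have hn := n.cast_nonneg (α := ℝ)
  rcases le_or_gt (dist o (a • o)) n with h1 | h1
  · refine ⟨a, h1, ?_⟩
    rw [inv_mul_cancel, one_smul, dist_self]
    positivity
  rcases lt_or_ge (n : ℝ) c with h2 | h2
  · refine ⟨1, ?_, ?_⟩
    · rw [one_smul, dist_self]; exact hn
    · rw [inv_one, one_mul]; linarith
  obtain ⟨γ, ⟨g0, g1, hγ⟩, hd⟩ := h 1 a
  rw [one_smul] at g0 g1 hγ hd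
  have ht : (n : ℝ) - c ∈ Set.Icc 0 (dist o (a • o)) := ⟨by linarith, by linarith⟩
  have hne : (Set.range fun u : G => u • o).Nonempty := ⟨_, 1, rfl⟩
  obtain ⟨_, ⟨u, rfl⟩, hu⟩ := (infDist_lt_iff hne).1 ((hd _ ht).trans_lt hc)
  simp only at hu
  have d0 := hγ 0 ⟨le_rfl, dist_nonneg⟩ _ ht
  have d1 := hγ _ ht _ ⟨dist_nonneg, le_rfl⟩
  rw [g0, zero_sub, abs_neg, abs_of_nonneg ht.1] at d0
  rw [g1, abs_sub_comm, abs_of_nonneg (by linarith [ht.2])] at d1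
  refine ⟨u, ?_, ?_⟩
  · have := dist_triangle o (γ (n - c)) (u • o)
    linarith
  · rw [mul_smul, dist_comm, dist_inv_smul hIso]
    have := dist_triangle_left (u • o) (a • o) (γ (n - c))
    rw [dist_comm (a • o)]
    linarith

theorem exists_minimal_rep (hfin : ∀ r, {g : G | dist o (g • o) ≤ r}.Finite) (Γ : Subgroup G) :
    ∃ a : G ⧸ Γ → G, (∀ q, (QuotientGroup.mk (a q) : G ⧸ Γ) = q) ∧
      ∀ x : G, dist o (a (QuotientGroup.mk x) • o) ≤ dist o (x • o) := by
  have key : ∀ q : G ⧸ Γ, ∃ x : G, (QuotientGroup.mk x : G ⧸ Γ) = q ∧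
      ∀ y : G, (QuotientGroup.mk y : G ⧸ Γ) = q → dist o (x • o) ≤ dist o (y • o) := by
    intro q
    obtain ⟨x, hx⟩ := QuotientGroup.mk_surjective q
    obtain ⟨p, ⟨y, hy, rfl⟩, hmin⟩ := exists_near hfin
      (Y := (fun x : G => x • o) '' {x | (QuotientGroup.mk x : G ⧸ Γ) = q})
      (Set.image_subset_range _ _) ⟨_, x, hx, rfl⟩ o
    exact ⟨y, hy, fun z hz => hmin _ ⟨z, hz, rfl⟩⟩
  choose a ha hmin using key
  exact ⟨a, ha, fun x => hmin _ x rfl⟩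

theorem exists_quotient_exponent (hIso : IsometricAction G X)
    (hfin : ∀ r, {g : G | dist o (g • o) ≤ r}.Finite) (hQC : QuasiConvexGSpace G o)
    {Γ : Subgroup G} (hΓ : Γ.Normal) {a : G ⧸ Γ → G}
    (ha : ∀ q, (QuotientGroup.mk (a q) : G ⧸ Γ) = q)
    (hmin : ∀ x : G, dist o (a (QuotientGroup.mk x) • o) ≤ dist o (x • o)) :
    ∃ δ : ℝ, 0 ≤ δ ∧ quotGrowthExp o Γ ≤ ENNReal.ofReal δ ∧
      (0 < δ → ¬ Summable fun q => Real.exp (-δ * dist o (a q • o))) := by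
  have hinj : Function.Injective a := fun q q' h => by rw [← ha q, h, ha]
  have hqfin : ∀ r, {q | dist o (a q • o) ≤ r}.Finite := fun r => (hfin r).preimage hinj.injOn
  obtain ⟨c, hc⟩ := QuasiConvexGSpace.exists_split hIso hQC
  set B : ℕ → ℕ := fun n => Nat.card {q // dist o (a q • o) ≤ n} with hBdef
  have hB : ∀ n, 1 ≤ B n := by
    intro n
    have : Finite {q // dist o (a q • o) ≤ n} := (hqfin n).to_subtype
    have : Nonempty {q // dist o (a q • o) ≤ n} := by
      refine ⟨⟨QuotientGroup.mk 1, (hmin 1).trans ?_⟩⟩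
      rw [one_smul, dist_self]
      exact n.cast_nonneg
    exact Nat.card_pos
  have hsplit : ∀ n m, B (n + m) ≤ B n * B (m + 2 * c) := by
    intro n m
    have : Finite {q // dist o (a q • o) ≤ n} := (hqfin n).to_subtype
    have : Finite {q // dist o (a q • o) ≤ ((m + 2 * c : ℕ) : ℝ)} := (hqfin _).to_subtype
    rw [hBdef]
    simp only
    rw [← Nat.card_prod]
    choose u hu1 hu2 using fun q : {q // dist o (a q • o) ≤ ((n + m : ℕ) : ℝ)} =>
      hc (a q) n m (by have := q.2; push_cast at this; exact this)
    refine Nat.card_le_card_of_injective (fun q =>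
      (⟨QuotientGroup.mk (u q), (hmin _).trans (hu1 q)⟩,
        ⟨QuotientGroup.mk ((u q)⁻¹ * a q), (hmin _).trans (by
          push_cast; exact hu2 q)⟩)) fun q q' h => ?_
    have e1 : (QuotientGroup.mk (u q) : G ⧸ Γ) = QuotientGroup.mk (u q') :=
      congrArg (fun z => z.1.1) h
    have e2 : (QuotientGroup.mk ((u q)⁻¹ * a q) : G ⧸ Γ) = QuotientGroup.mk ((u q')⁻¹ * a q') :=
      congrArg (fun z => z.2.1) h
    have e3 : (QuotientGroup.mk (u q * ((u q)⁻¹ * a q)) : G ⧸ Γ) =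
        QuotientGroup.mk (u q' * ((u q')⁻¹ * a q')) :=
      congrArg₂ (fun x y : G ⧸ Γ => x * y) e1 e2
    rw [mul_inv_cancel_left, mul_inv_cancel_left, ha, ha] at e3
    exact Subtype.ext e3
  have hK : ∀ n m, B (n + m) ≤ B (2 * c + 2 * c) * (B n * B m) := by
    intro n m
    calc B (n + m) ≤ B n * B (m + 2 * c) := hsplit n m
      _ ≤ B n * (B m * B (2 * c + 2 * c)) := Nat.mul_le_mul_left _ (hsplit m (2 * c))
      _ = _ := by ring
  obtain ⟨δ, hδ, hlim, hexp⟩ := exists_exponent hB hK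
  refine ⟨δ, hδ, ?_, fun hpos => not_summable_of_exp_le hqfin hpos hexp⟩
  have hlim' : Tendsto (fun r : ℝ => ENNReal.ofReal
      (Real.log (B (2 * c + 2 * c) * B ⌈r⌉₊) / ⌈r⌉₊ * (⌈r⌉₊ / r))) atTop
      (nhds (ENNReal.ofReal δ)) := by
    have := (hlim.comp (tendsto_nat_ceil_atTop (α := ℝ))).mul
      (tendsto_nat_ceil_div_atTop (R := ℝ))
    rw [mul_one] at this
    exact (ENNReal.continuous_ofReal.tendsto δ).comp this
  rw [← hlim'.limsup_eq]
  refine limsup_le_limsup ?_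
  filter_upwards [eventually_gt_atTop (0 : ℝ)] with r hr
  apply ENNReal.ofReal_le_ofReal
  have hceil : (0 : ℝ) < ⌈r⌉₊ := by exact_mod_cast Nat.ceil_pos.2 hr
  rw [div_mul_div_cancel₀ hceil.ne']
  refine div_le_div_of_nonneg_right ?_ hr.le
  have hsub : ∀ q : G ⧸ Γ, (∃ g : G, QuotientGroup.mk g = q ∧
      (⨅ γ : Γ, dist o ((g * γ) • o)) ≤ r) → dist o (a q • o) ≤ (⌈r⌉₊ : ℝ) := by
    rintro q ⟨g, rfl, hg⟩
    refine (le_ciInf fun γ : Γ => ?_).trans (hg.trans (Nat.le_ceil r))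
    have := hmin (g * γ)
    rwa [QuotientGroup.mk_mul_of_mem g γ.2] at this
  have : Finite {q // dist o (a q • o) ≤ (⌈r⌉₊ : ℝ)} := (hqfin _).to_subtype
  have hcard := Nat.card_le_card_of_injective (fun q : {q : G ⧸ Γ // ∃ g : G,
      QuotientGroup.mk g = q ∧ (⨅ γ : Γ, dist o ((g * γ) • o)) ≤ r} =>
    (⟨q, hsub q q.2⟩ : {q // dist o (a q • o) ≤ (⌈r⌉₊ : ℝ)}))
    fun x y h => Subtype.ext (congrArg (fun z => z.1) h)
  rcases Nat.eq_zero_or_pos (Nat.card {q : G ⧸ Γ // ∃ g : G,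
    QuotientGroup.mk g = q ∧ (⨅ γ : Γ, dist o ((g * γ) • o)) ≤ r}) with h0 | h0
  · rw [h0, Nat.cast_zero, Real.log_zero]
    apply Real.log_nonneg
    exact_mod_cast Nat.mul_pos (hB _) (hB _)
  · apply Real.log_le_log (by exact_mod_cast h0)
    exact_mod_cast hcard.trans (Nat.le_mul_of_pos_left _ (hB _))

theorem growthTight [ProperSpace X] (hIso : IsometricAction G X)
    (hPD : ProperlyDiscontinuousAction G X) (hNE : NonElementary G) (hQC : QuasiConvexGSpace G o)
    (hX : BruhatTits X) {g : G} (hg : Rank1Isometry X g) : GrowthTight G o := by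
  intro Γ hΓ hinf
  have hfin := finite_ball (G := G) hPD o
  obtain ⟨C, ℓ, D, h⟩ := exists_axial hIso hX hg o
  obtain ⟨f, hf, hfg⟩ := exists_not_comm hIso hfin h hNE Γ hΓ hinf
  obtain ⟨k, hk, C', hC', hunb⟩ := exists_contr_mem hIso hfin h hΓ hf hfg
  obtain ⟨a, ha, hmin⟩ := exists_minimal_rep hfin Γ
  obtain ⟨δ, hδ, hle, hsum⟩ := exists_quotient_exponent hIso hfin hQC hΓ ha hmin
  refine hle.trans_lt ?_
  rcases hδ.eq_or_lt with rfl | hpos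
  · rw [ENNReal.ofReal_zero]
    exact growthExp_pos hIso hfin h hfg
  · refine lt_growthExp_of_contr hIso hfin hΓ hk hC' hunb
      (fun q q' h => by rw [← ha q, h, ha]) (fun q γ hγ => ?_) hpos (hsum hpos)
    have := hmin (a q * γ)
    rwa [QuotientGroup.mk_mul_of_mem _ hγ, ha] at this

end Quotient

end GrowthTightness

/-- **Theorem.** If `G` is a finitely generated, non-elementary group and `X` is a
quasi-convex CAT(0) `G`-space on which some element of `G` acts as a rank 1 isometry,
then `G ↷ X` is a growth tight action. -/
theorem growth_tight_of_CAT0_rank1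
    {G X : Type*} [Group G] [MetricSpace X] [MulAction G X] (o : X)
    (hFG : Group.FG G) (hNE : NonElementary G)
    (hProp : ProperSpace X) (hGeo : GeodesicSpace X)
    (hIso : IsometricAction G X) (hPD : ProperlyDiscontinuousAction G X)
    (hQC : QuasiConvexGSpace G o)
    (hCAT : CAT0 X)
    (g : G) (hg : Rank1Isometry X g) :
    GrowthTight G o :=
  GrowthTightness.growthTight hIso hPD hNE hQC
    (GrowthTightness.bruhatTits_of_CAT0 hGeo hCAT) hg
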